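/- arXiv:math/0309252 — 2 statements merged into one kernel-verified Lean document; each statement's English description precedes it below -/
import Mathlib

section
/- Let n ≥ 0 be an integer, let p, q ∈ ℂ with 0 < |p| < 1 and 0 < |q| < 1, and let t_0, ..., t_{2n+3} ∈ ℂ satisfy |t_r| < 1 for every r and ∏_{r=0}^{2n+3} t_r = pq. Then ((p;p)_∞ (q;q)_∞)^n/(2^n · n!) · (1/(2π)^n) ∫_{[0,2π]^n} ∏_{i=1}^{n} ∏_{r=0}^{2n+3} Γ(t_r z_i^{±1};p,q) / ( ∏_{1≤i<j≤n} Γ(z_i^{±1} z_j^{±1};p,q) · ∏_{i=1}^{n} Γ(z_i^{±2};p,q) ) dθ_1⋯dθ_n = ∏_{0≤r<s≤2n+3} Γ(t_r t_s;p,q), where z_i = e^{iθ_i}. -/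
open scoped BigOperators Real
open MeasureTheory

/-- The elliptic Gamma function `Γ(x;p,q)`. -/
noncomputable def ellGamma (x p q : ℂ) : ℂ :=
  ∏' jk : ℕ × ℕ, ((1 - p ^ (jk.1 + 1) * q ^ (jk.2 + 1) / x) / (1 - p ^ jk.1 * q ^ jk.2 * x))

/-- `(p;p)_∞`. -/
noncomputable def qPoch (p : ℂ) : ℂ := ∏' k : ℕ, (1 - p ^ (k + 1))

/-- `n`-fold contour integral over the unit torus. -/
noncomputable def torusInt (n : ℕ) (f : (Fin n → ℂ) → ℂ) : ℂ :=
  ((1 / (2 * Real.pi) : ℝ) : ℂ) ^ n *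
    ∫ θ in Set.univ.pi fun _ : Fin n => Set.Icc (0 : ℝ) (2 * Real.pi),
      f fun i => Complex.exp (Complex.I * (θ i))

namespace EllipticBeta

open Filter Topology

/-- A nonzero complex number of modulus less than one. -/
class Nome (p : ℂ) : Prop where
  ne_zero : p ≠ 0
  norm_lt_one : ‖p‖ < 1

section LinearProduct

variable {ι : Type*}

/-- The product `∏ (1 - a i x)` over all `i`. -/
noncomputable def linProd (a : ι → ℂ) (x : ℂ) : ℂ := ∏' i, (1 - a i * x)

variable {a : ι → ℂ}

lemma multipliable_linProd (ha : Summable fun i => ‖a i‖) (x : ℂ) :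
    Multipliable fun i => 1 - a i * x := by
  simp only [sub_eq_add_neg]
  apply multipliable_one_add_of_summable
  simpa using ha.mul_right ‖x‖

lemma differentiable_linProd (ha : Summable fun i => ‖a i‖) :
    Differentiable ℂ (linProd a) := by
  have key (R : ℝ) : DifferentiableOn ℂ (linProd a) (Metric.ball 0 R) := by
    have h := Summable.hasProdLocallyUniformlyOn_one_add (f := fun i x => -(a i * x))
      (K := Metric.ball (0 : ℂ) R) Metric.isOpen_ball (ha.mul_right R)
      (Eventually.of_forall fun i x hx => by
        simp only [norm_neg, norm_mul]
        gcongr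
        simpa using (Metric.mem_ball.mp hx).le)
      (fun i => by fun_prop)
    simp only [← sub_eq_add_neg] at h
    exact TendstoLocallyUniformlyOn.differentiableOn h
      (Eventually.of_forall fun s => by fun_prop) Metric.isOpen_ball
  intro x
  exact (key (‖x‖ + 1)).differentiableAt (Metric.isOpen_ball.mem_nhds (by simp))

lemma linProd_ne_zero (ha : Summable fun i => ‖a i‖) {x : ℂ} (h : ∀ i, a i * x ≠ 1) :
    linProd a x ≠ 0 := by
  simp only [linProd, sub_eq_add_neg]
  apply tprod_one_add_ne_zero_of_summable
  · intro i hi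
    exact h i (by linear_combination -hi)
  · simpa using ha.mul_right ‖x‖

lemma linProd_eq_zero {x : ℂ} {i : ι} (h : a i * x = 1) : linProd a x = 0 :=
  tprod_of_exists_eq_zero ⟨i, by simp [h]⟩

end LinearProduct

section Products

variable {p q : ℂ}

lemma summable_norm_pow (p : ℂ) [Nome p] : Summable fun k : ℕ => ‖p ^ k‖ := by
  simpa using summable_geometric_of_lt_one (norm_nonneg p) Nome.norm_lt_one

lemma summable_norm_pow_mul_pow (p q : ℂ) [Nome p] [Nome q] :
    Summable fun jk : ℕ × ℕ => ‖p ^ jk.1 * q ^ jk.2‖ :=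
  Summable.mul_norm (summable_norm_pow p) (summable_norm_pow q)

/-- The infinite `p`-shifted factorial `(x;p)_∞`. -/
noncomputable def poch (p x : ℂ) : ℂ := linProd (fun k : ℕ => p ^ k) x

/-- The infinite double shifted factorial `(x;p,q)_∞`. -/
noncomputable def poch₂ (p q x : ℂ) : ℂ := linProd (fun jk : ℕ × ℕ => p ^ jk.1 * q ^ jk.2) x

@[fun_prop] lemma differentiable_poch [Nome p] : Differentiable ℂ (poch p) :=
  differentiable_linProd (summable_norm_pow p)

@[fun_prop] lemma differentiable_poch₂ [Nome p] [Nome q] : Differentiable ℂ (poch₂ p q) :=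
  differentiable_linProd (summable_norm_pow_mul_pow p q)

lemma poch_eq [Nome p] (x : ℂ) : poch p x = (1 - x) * poch p (p * x) := by
  have h := multipliable_linProd (summable_norm_pow p) (p * x)
  unfold poch linProd
  rw [tprod_eq_zero_mul']
  · simp [pow_succ, mul_assoc]
  · simpa [pow_succ, mul_assoc] using h

lemma poch_ne_zero [Nome p] {x : ℂ} (h : ∀ k : ℕ, p ^ k * x ≠ 1) : poch p x ≠ 0 :=
  linProd_ne_zero (summable_norm_pow p) h

lemma norm_pow_le_one [Nome p] (k : ℕ) : ‖p ^ k‖ ≤ 1 := by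
  rw [norm_pow]
  exact pow_le_one₀ (norm_nonneg _) Nome.norm_lt_one.le

lemma poch_ne_zero_of_norm_lt_one [Nome p] {x : ℂ} (h : ‖x‖ < 1) : poch p x ≠ 0 := by
  refine poch_ne_zero fun k hk => ?_
  have := congrArg norm hk
  rw [norm_mul, norm_one] at this
  nlinarith [norm_pow_le_one (p := p) k, norm_nonneg x, norm_nonneg (p ^ k)]

lemma qPoch_eq_poch : qPoch p = poch p p := by
  simp [qPoch, poch, linProd, pow_succ]

lemma qPoch_ne_zero [Nome p] : qPoch p ≠ 0 := by
  rw [qPoch_eq_poch]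
  exact poch_ne_zero_of_norm_lt_one Nome.norm_lt_one

lemma poch₂_comm (x : ℂ) : poch₂ p q x = poch₂ q p x := by
  unfold poch₂ linProd
  rw [← (Equiv.prodComm ℕ ℕ).tprod_eq]
  simp [mul_comm]

lemma poch₂_eq_left [Nome p] [Nome q] (x : ℂ) :
    poch₂ p q x = poch q x * poch₂ p q (p * x) := by
  have fib (x : ℂ) : (Multipliable fun j : ℕ => poch q (p ^ j * x)) ∧
      poch₂ p q x = ∏' j : ℕ, poch q (p ^ j * x) := by
    have hm := multipliable_linProd (summable_norm_pow_mul_pow p q) x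
    have hf (j : ℕ) : HasProd (fun k : ℕ => 1 - p ^ j * q ^ k * x) (poch q (p ^ j * x)) := by
      have e : (fun k : ℕ => 1 - p ^ j * q ^ k * x) = fun k => 1 - q ^ k * (p ^ j * x) := by
        funext k
        ring
      rw [e]
      exact (multipliable_linProd (summable_norm_pow q) (p ^ j * x)).hasProd
    have := hm.hasProd.prod_fiberwise hf
    exact ⟨this.multipliable, this.tprod_eq.symm⟩
  rw [(fib x).2, (fib (p * x)).2, tprod_eq_zero_mul']
  · simp [pow_succ, mul_assoc]
  · simpa [pow_succ, mul_assoc] using (fib (p * x)).1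

lemma poch₂_eq_right [Nome p] [Nome q] (x : ℂ) :
    poch₂ p q x = poch p x * poch₂ p q (q * x) := by
  rw [poch₂_comm, poch₂_eq_left, poch₂_comm]

lemma poch₂_ne_zero_of_norm_lt_one [Nome p] [Nome q] {x : ℂ} (h : ‖x‖ < 1) :
    poch₂ p q x ≠ 0 := by
  refine linProd_ne_zero (summable_norm_pow_mul_pow p q) fun jk hk => ?_
  have := congrArg norm hk
  rw [norm_mul, norm_mul, norm_one] at this
  have h1 : ‖p ^ jk.1‖ * ‖q ^ jk.2‖ ≤ 1 :=
    mul_le_one₀ (norm_pow_le_one _) (norm_nonneg _) (norm_pow_le_one _)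
  nlinarith [norm_nonneg x, norm_nonneg (p ^ jk.1), norm_nonneg (q ^ jk.2)]

lemma poch₂_ne_zero_of_norm_le_one [Nome p] [Nome q] {x : ℂ} (h : ‖x‖ ≤ 1) (h1 : x ≠ 1) :
    poch₂ p q x ≠ 0 := by
  have hp := Nome.norm_lt_one (p := p)
  have hq := Nome.norm_lt_one (p := q)
  have h2 : ‖q * x‖ < 1 := by rw [norm_mul]; nlinarith [norm_nonneg x, norm_nonneg q]
  have h3 : ‖p * x‖ < 1 := by rw [norm_mul]; nlinarith [norm_nonneg x, norm_nonneg p]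
  rw [poch₂_eq_right, poch_eq]
  exact mul_ne_zero (mul_ne_zero (sub_ne_zero.2 h1.symm) (poch_ne_zero_of_norm_lt_one h3))
    (poch₂_ne_zero_of_norm_lt_one h2)

lemma ellGamma_eq [Nome p] [Nome q] (x : ℂ) :
    ellGamma x p q = poch₂ p q (p * q / x) / poch₂ p q x := by
  unfold ellGamma
  by_cases h : ∃ jk : ℕ × ℕ, p ^ jk.1 * q ^ jk.2 * x = 1
  · obtain ⟨jk, h⟩ := h
    rw [tprod_of_exists_eq_zero ⟨jk, by simp [h]⟩]
    simp [poch₂, linProd_eq_zero (a := fun jk : ℕ × ℕ => p ^ jk.1 * q ^ jk.2) h]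
  · push Not at h
    have h0 : poch₂ p q x ≠ 0 := linProd_ne_zero (summable_norm_pow_mul_pow p q) h
    have h1 := (multipliable_linProd (summable_norm_pow_mul_pow p q) (p * q / x)).hasProd
    have h2 := (multipliable_linProd (summable_norm_pow_mul_pow p q) x).hasProd
    have := h1.div₀ h2 h0
    refine Eq.trans (tprod_congr fun jk => ?_) this.tprod_eq
    ring

end Products

section Theta

variable {p q : ℂ}

/-- The theta function `θ(x;p) = (x;p)_∞ (p/x;p)_∞`. -/
noncomputable def theta (p x : ℂ) : ℂ := poch p x * poch p (p / x)

lemma theta_inv [Nome p] {x : ℂ} (hx : x ≠ 0) : theta p x⁻¹ = -x⁻¹ * theta p x := by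
  unfold theta
  rw [poch_eq x⁻¹, poch_eq x, div_inv_eq_mul, ← div_eq_mul_inv]
  field_simp
  ring

lemma theta_nome_mul [Nome p] {x : ℂ} (hx : x ≠ 0) : theta p (p * x) = -x⁻¹ * theta p x := by
  have hp := Nome.ne_zero (p := p)
  rw [← theta_inv hx, theta, theta, div_inv_eq_mul, mul_comm, div_mul_cancel_left₀ hp]

@[simp] lemma theta_one [Nome p] : theta p 1 = 0 := by
  rw [theta, poch_eq]
  simp

lemma theta_ne_zero [Nome p] {x : ℂ} (h1 : ‖p‖ < ‖x‖) (h2 : ‖p * x‖ < 1) (h : x ≠ 1) :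
    theta p x ≠ 0 := by
  have h3 : ‖p / x‖ < 1 := by
    rw [norm_div, div_lt_one ((norm_nonneg p).trans_lt h1)]
    exact h1
  rw [theta, poch_eq]
  exact mul_ne_zero (mul_ne_zero (sub_ne_zero.2 h.symm) (poch_ne_zero_of_norm_lt_one h2))
    (poch_ne_zero_of_norm_lt_one h3)

lemma theta_ne_zero_of_norm_lt_one [Nome p] {x : ℂ} (h1 : ‖p‖ < ‖x‖) (h2 : ‖x‖ < 1) :
    theta p x ≠ 0 := by
  refine theta_ne_zero h1 ?_ (by rintro rfl; simp at h2)
  rw [norm_mul]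
  nlinarith [norm_nonneg p, norm_nonneg x, Nome.norm_lt_one (p := p)]

lemma theta_neg_one_ne_zero [Nome p] : theta p (-1) ≠ 0 := by
  have := Nome.norm_lt_one (p := p)
  exact theta_ne_zero (by simpa) (by simpa) (by norm_num)

lemma differentiableAt_theta [Nome p] {x : ℂ} (hx : x ≠ 0) : DifferentiableAt ℂ (theta p) x := by
  unfold theta
  fun_prop (disch := assumption)

lemma countable_theta_eq_zero [Nome p] : {x : ℂ | theta p x = 0}.Countable := by
  refine ((Set.countable_range fun k : ℕ => (p ^ k)⁻¹).union
    (Set.countable_range fun k : ℕ => p ^ k * p)).mono fun x hx => ?_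
  rcases mul_eq_zero.1 (show poch p x * poch p (p / x) = 0 from hx) with h | h
  · by_contra! hne
    refine poch_ne_zero (fun k hk => hne (Or.inl ⟨k, ?_⟩)) h
    exact (eq_inv_of_mul_eq_one_right hk).symm
  · by_contra! hne
    refine poch_ne_zero (fun k hk => hne (Or.inr ⟨k, ?_⟩)) h
    rcases eq_or_ne x 0 with rfl | hx0
    · simp at hk
    · field_simp at hk
      exact hk

end Theta

section Gamma

variable {p q : ℂ} [Nome p] [Nome q]

lemma ellGamma_comm (x : ℂ) : ellGamma x p q = ellGamma x q p := by
  rw [ellGamma_eq, ellGamma_eq, poch₂_comm, poch₂_comm x, mul_comm p]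

lemma ellGamma_right_mul {x : ℂ} (hx : x ≠ 0) (h : ‖x‖ < 1) :
    ellGamma (q * x) p q = theta p x * ellGamma x p q := by
  have hq := Nome.ne_zero (p := q)
  have e : p * q / (q * x) = p / x := by field_simp
  have e' : q * (p / x) = p * q / x := by ring
  rw [ellGamma_eq, ellGamma_eq, theta, poch₂_eq_right x, e, poch₂_eq_right (p / x), e']
  have h1 : poch p x ≠ 0 := poch_ne_zero_of_norm_lt_one h
  by_cases h2 : poch₂ p q (q * x) = 0
  · simp [h2]
  · field_simp

lemma poch₂_reflect_ne_zero {x : ℂ} (h : ‖p * q‖ < ‖x‖) : poch₂ p q (p * q / x) ≠ 0 := by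
  apply poch₂_ne_zero_of_norm_lt_one
  rw [norm_div, div_lt_one ((norm_nonneg _).trans_lt h)]
  exact h

lemma ellGamma_ne_zero {x : ℂ} (h : ‖p * q‖ < ‖x‖) (h1 : ‖x‖ < 1) : ellGamma x p q ≠ 0 := by
  rw [ellGamma_eq]
  exact div_ne_zero (poch₂_reflect_ne_zero h) (poch₂_ne_zero_of_norm_lt_one h1)

lemma ellGamma_mul_reflect {x : ℂ} (h : ‖p * q‖ < ‖x‖) (h1 : ‖x‖ < 1) :
    ellGamma x p q * ellGamma (p * q / x) p q = 1 := by
  have hp := Nome.ne_zero (p := p)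
  have hq := Nome.ne_zero (p := q)
  have h2 := poch₂_reflect_ne_zero h
  have h3 : poch₂ p q x ≠ 0 := poch₂_ne_zero_of_norm_lt_one h1
  rw [ellGamma_eq, ellGamma_eq, div_div_cancel₀ (mul_ne_zero hp hq)]
  field_simp

lemma inv_ellGamma_mul_ellGamma_inv {x : ℂ} (h : ‖x‖ = 1) :
    (ellGamma x p q * ellGamma x⁻¹ p q)⁻¹ = theta p x * theta q x⁻¹ := by
  have hx : x ≠ 0 := by rintro rfl; simp at h
  have hp := Nome.norm_lt_one (p := p)
  have hq := Nome.norm_lt_one (p := q)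
  have hpq : ‖p * q‖ < 1 := by
    rw [norm_mul]
    exact mul_lt_one_of_nonneg_of_lt_one_left (norm_nonneg _) hp hq.le
  have h1 : poch₂ p q (p * q * x) ≠ 0 := poch₂_ne_zero_of_norm_lt_one (by simpa [h] using hpq)
  have h2 : poch₂ p q (p * q / x) ≠ 0 := poch₂_ne_zero_of_norm_lt_one (by simpa [h] using hpq)
  have e1 : poch₂ p q x = poch p x * (poch q (q * x) * poch₂ p q (p * q * x)) := by
    rw [poch₂_eq_right, poch₂_eq_left (q * x), mul_assoc p]
  have e2 : poch₂ p q x⁻¹ = poch q x⁻¹ * (poch p (p / x) * poch₂ p q (p * q / x)) := by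
    rw [poch₂_eq_left, ← div_eq_mul_inv, poch₂_eq_right (p / x)]
    ring_nf
  rw [ellGamma_eq, ellGamma_eq, e1, e2, div_inv_eq_mul, theta, theta, div_inv_eq_mul]
  field_simp

lemma ellGamma_left_nome : ellGamma p p q = qPoch q / qPoch p := by
  have hp := Nome.ne_zero (p := p)
  have hpn := Nome.norm_lt_one (p := p)
  have hqn := Nome.norm_lt_one (p := q)
  have hpq : ‖p * q‖ < 1 := by
    rw [norm_mul]
    exact mul_lt_one_of_nonneg_of_lt_one_left (norm_nonneg _) hpn hqn.le
  rw [ellGamma_eq, mul_div_cancel_left₀ _ hp, poch₂_eq_left q, poch₂_eq_right p, mul_comm q,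
    mul_div_mul_right _ _ (poch₂_ne_zero_of_norm_lt_one hpq), qPoch_eq_poch, qPoch_eq_poch]

lemma differentiableAt_ellGamma {x : ℂ} (hx : x ≠ 0) (h : ‖x‖ ≤ 1) (h1 : x ≠ 1) :
    DifferentiableAt ℂ (fun x => ellGamma x p q) x := by
  have e : (fun x => ellGamma x p q) = fun x => poch₂ p q (p * q / x) / poch₂ p q x :=
    funext ellGamma_eq
  have := poch₂_ne_zero_of_norm_le_one (p := p) (q := q) h h1
  rw [e]
  fun_prop (disch := assumption)

end Gamma

section Mean

open Metric

/-- The average of `f` over the unit circle. -/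
noncomputable def mean (f : ℂ → ℂ) : ℂ := Real.circleAverage f 0 1

variable {f g : ℂ → ℂ}

lemma mean_congr (h : ∀ z, ‖z‖ = 1 → f z = g z) : mean f = mean g :=
  Real.circleAverage_congr_sphere fun z hz => h z (by simpa using hz)

lemma mean_inv (f : ℂ → ℂ) : mean (fun z => f z⁻¹) = mean f :=
  Real.circleAverage_zero_one_congr_inv

lemma mean_const_mul (c : ℂ) (f : ℂ → ℂ) : mean (fun z => c * f z) = c * mean f :=
  Real.circleAverage_fun_smul (a := c) (f := f) (c := 0) (R := 1)

lemma circleIntegrable_of_continuousOn (h : ContinuousOn f (sphere 0 1)) :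
    CircleIntegrable f 0 1 := h.circleIntegrable zero_le_one

lemma mean_add (hf : ContinuousOn f (sphere 0 1)) (hg : ContinuousOn g (sphere 0 1)) :
    mean (fun z => f z + g z) = mean f + mean g :=
  Real.circleAverage_fun_add (circleIntegrable_of_continuousOn hf)
    (circleIntegrable_of_continuousOn hg)

lemma mean_sub (hf : ContinuousOn f (sphere 0 1)) (hg : ContinuousOn g (sphere 0 1)) :
    mean (fun z => f z - g z) = mean f - mean g :=
  Real.circleAverage_fun_sub (circleIntegrable_of_continuousOn hf)
    (circleIntegrable_of_continuousOn hg)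

lemma mean_sum {ι : Type*} (s : Finset ι) {f : ι → ℂ → ℂ}
    (hf : ∀ i ∈ s, ContinuousOn (f i) (sphere 0 1)) :
    mean (fun z => ∑ i ∈ s, f i z) = ∑ i ∈ s, mean (f i) :=
  Real.circleAverage_fun_sum fun i hi => circleIntegrable_of_continuousOn (hf i hi)

lemma circleAverage_comp_const_mul (c : ℂ) (f : ℂ → ℂ) :
    mean (fun z => f (c * z)) = Real.circleAverage f 0 ‖c‖ := by
  rw [mean, Real.circleAverage_eq_integral_add c.arg (f := f), Real.circleAverage]
  congr 1
  refine intervalIntegral.integral_congr fun θ _ => ?_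
  rw [circleMap_zero, circleMap_zero]
  conv_lhs => rw [← Complex.norm_mul_exp_arg_mul_I c]
  push_cast
  rw [add_mul, Complex.exp_add]
  ring_nf

/-- Averages of a holomorphic function over concentric circles agree. -/
lemma mean_comp_const_mul {c : ℂ} (hc : c ≠ 0) (h1 : ‖c‖ ≤ 1) {s : Set ℂ} (hs : s.Countable)
    (hf : ContinuousOn f (closedBall 0 1 \ ball 0 ‖c‖))
    (hd : ∀ z ∈ (ball 0 1 \ closedBall 0 ‖c‖) \ s, DifferentiableAt ℂ f z) :
    mean (fun z => f (c * z)) = mean f := by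
  rw [circleAverage_comp_const_mul, mean, Real.circleAverage_eq_circleIntegral (by simpa),
    Real.circleAverage_eq_circleIntegral one_ne_zero]
  congr 1
  exact (Complex.circleIntegral_sub_center_inv_smul_eq_of_differentiable_on_annulus_off_countable
    (norm_pos_iff.2 hc) h1 hs hf hd).symm

/-- The average of an entire-on-`ℂˣ` function does not change under dilations. -/
lemma mean_comp_const_mul' (hf : ∀ z ≠ 0, DifferentiableAt ℂ f z) {c : ℂ} (hc : c ≠ 0) :
    mean (fun z => f (c * z)) = mean f := by
  have key : ∀ {g : ℂ → ℂ}, (∀ z ≠ 0, DifferentiableAt ℂ g z) → ∀ {c : ℂ}, c ≠ 0 → ‖c‖ ≤ 1 →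
      mean (fun z => g (c * z)) = mean g := fun {g} hg c hc h1 => by
    have hne : ∀ z : ℂ, z ∉ ball (0 : ℂ) ‖c‖ → z ≠ 0 := by
      rintro z hz rfl
      exact hz (mem_ball_self (norm_pos_iff.2 hc))
    refine mean_comp_const_mul hc h1 Set.countable_empty
      (fun z hz => (hg z (hne z hz.2)).continuousAt.continuousWithinAt) fun z hz => hg z ?_
    exact hne z fun h => hz.1.2 (ball_subset_closedBall h)
  rcases le_total ‖c‖ 1 with h1 | h1
  · exact key hf hc h1
  · have := key (g := fun z => f (c * z)) (fun z hz => by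
      have := hf (c * z) (mul_ne_zero hc hz)
      fun_prop) (inv_ne_zero hc) (by rw [norm_inv]; exact inv_le_one_of_one_le₀ h1)
    simp only [mul_inv_cancel_left₀ hc] at this
    exact this.symm

/-- A holomorphic function on the annulus `‖c‖ ≤ ‖z‖ ≤ 1` which is odd under `z ↦ c / z` has zero
average. -/
lemma mean_eq_zero_of_reflect {c : ℂ} (hc : c ≠ 0) (h1 : ‖c‖ ≤ 1)
    (hf : ∀ z, ‖c‖ ≤ ‖z‖ → ‖z‖ ≤ 1 → DifferentiableAt ℂ f z)
    (h : ∀ z, ‖z‖ = 1 → f (c * z⁻¹) = -f z) : mean f = 0 := by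
  have e := mean_comp_const_mul (f := f) hc h1 Set.countable_empty
    (fun z hz => (hf z (by simpa using hz.2)
      (by simpa using hz.1)).continuousAt.continuousWithinAt)
    (fun z hz => hf z (by simpa using (not_le.1 fun h => hz.1.2 (by simpa using h)).le)
      (by simpa using (mem_ball_zero_iff.1 hz.1.1).le))
  rw [← mean_inv, mean_congr (g := fun z => (-1) * f z) (fun z hz => by simp [h z hz]),
    mean_const_mul] at e
  linear_combination (-1 / 2 : ℂ) * e

/-- A continuous function on the unit circle with vanishing Fourier coefficients is zero. -/
lemma eq_zero_of_mean_zpow_mul (hf : ContinuousOn f (sphere 0 1))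
    (h : ∀ k : ℤ, mean (fun z => z ^ (-k) * f z) = 0) : f 1 = 0 := by
  have : Fact (0 < 2 * π) := ⟨Real.two_pi_pos⟩
  have hc : Continuous fun x : AddCircle (2 * π) => f (AddCircle.toCircle x) :=
    hf.comp_continuous (by fun_prop) fun x => by simp [Circle.norm_coe]
  let F : C(AddCircle (2 * π), ℂ) := ⟨_, hc⟩
  have hF : ∀ k, fourierCoeff F k = 0 := fun k => by
    rw [fourierCoeff_eq_intervalIntegral _ _ 0, ← h k, mean, Real.circleAverage, zero_add, one_div]
    congr 1
    refine intervalIntegral.integral_congr fun θ _ => ?_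
    simp only [F, ContinuousMap.coe_mk, AddCircle.toCircle_apply_mk, fourier_coe_apply,
      circleMap_zero, Circle.coe_exp, smul_eq_mul]
    rw [Complex.ofReal_one, one_mul, ← Complex.exp_int_mul]
    congr 2
    · push_cast
      field_simp
    · congr 2
      push_cast
      field_simp
  have hs : Summable (fourierCoeff F) := by
    rw [funext hF]
    exact summable_zero
  have := (hasSum_fourier_series_of_summable hs).unique
    (by simp only [hF, zero_smul]; exact hasSum_zero)
  simpa [F] using congrArg (fun G : C(AddCircle (2 * π), ℂ) => G 0) this

end Mean

section ThetaSpace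

/-- Holomorphic functions on `ℂˣ` with parity `σ` under inversion and quasi-period `p` of degree
`m`. -/
structure IsTheta (p : ℂ) (m : ℕ) (σ : ℂ) (f : ℂ → ℂ) : Prop where
  differentiableAt : ∀ z ≠ 0, DifferentiableAt ℂ f z
  inv : ∀ z ≠ 0, f z⁻¹ = σ * f z
  nome_mul : ∀ z ≠ 0, (p * z ^ 2) ^ m * f (p * z) = f z

lemma exists_relation {ι κ : Type*} [Fintype ι] [Fintype κ]
    (h : Fintype.card κ < Fintype.card ι) (v : ι → κ → ℂ) :
    ∃ c : ι → ℂ, (∀ j, ∑ i, c i * v i j = 0) ∧ ∃ i, c i ≠ 0 := by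
  have : ¬ LinearIndependent ℂ v := fun hv => by
    have := hv.fintype_card_le_finrank
    rw [Module.finrank_fintype_fun_eq_card] at this
    omega
  obtain ⟨c, hc, h⟩ := Fintype.not_linearIndependent_iff.1 this
  exact ⟨c, fun j => by simpa using congrFun hc j, h⟩

namespace IsTheta

variable {p : ℂ} {m k : ℕ} {σ τ : ℂ} {f g : ℂ → ℂ}

lemma mul (hf : IsTheta p m σ f) (hg : IsTheta p k τ g) :
    IsTheta p (m + k) (σ * τ) fun z => f z * g z where
  differentiableAt z hz := (hf.1 z hz).mul (hg.1 z hz)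
  inv z hz := by rw [hf.2 z hz, hg.2 z hz]; ring
  nome_mul z hz := by rw [← hf.3 z hz, ← hg.3 z hz]; ring

lemma pow (hf : IsTheta p m 1 f) : ∀ k : ℕ, IsTheta p (m * k) 1 fun z => f z ^ k
  | 0 => ⟨by simp, by simp, by simp⟩
  | k + 1 => by simpa [pow_succ, Nat.mul_succ] using (hf.pow k).mul hf

lemma const_mul (c : ℂ) (hf : IsTheta p m σ f) : IsTheta p m σ fun z => c * f z where
  differentiableAt z hz := (hf.1 z hz).const_mul c
  inv z hz := by rw [hf.2 z hz]; ring
  nome_mul z hz := by rw [← hf.3 z hz]; ring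

lemma sum {ι : Type*} (s : Finset ι) {f : ι → ℂ → ℂ} (hf : ∀ i ∈ s, IsTheta p m σ (f i)) :
    IsTheta p m σ fun z => ∑ i ∈ s, f i z where
  differentiableAt z hz := DifferentiableAt.fun_sum fun i hi => (hf i hi).1 z hz
  inv z hz := by rw [Finset.mul_sum]; exact Finset.sum_congr rfl fun i hi => (hf i hi).2 z hz
  nome_mul z hz := by rw [Finset.mul_sum]; exact Finset.sum_congr rfl fun i hi => (hf i hi).3 z hz

lemma differentiableAt_zpow_mul (hf : IsTheta p m σ f) (k : ℤ) {z : ℂ} (hz : z ≠ 0) :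
    DifferentiableAt ℂ (fun z => z ^ (-k) * f z) z :=
  (differentiableAt_zpow.2 (Or.inl hz)).mul (hf.1 z hz)

lemma mean_neg (hf : IsTheta p m σ f) (k : ℤ) :
    mean (fun z => z ^ (-(-k)) * f z) = σ * mean (fun z => z ^ (-k) * f z) := by
  rw [← mean_inv, ← mean_const_mul]
  refine mean_congr fun z hz => ?_
  have hz0 : z ≠ 0 := by rintro rfl; simp at hz
  rw [hf.inv z hz0, inv_zpow', neg_neg]
  ring

lemma mean_sum_mul {ι : Type*} [Fintype ι] {F : ι → ℂ → ℂ} (hF : ∀ i, IsTheta p m σ (F i))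
    (c : ι → ℂ) (k : ℤ) : mean (fun z => z ^ (-k) * ∑ i, c i * F i z) =
      ∑ i, c i * mean (fun z => z ^ (-k) * F i z) := by
  simp_rw [← mean_const_mul, Finset.mul_sum]
  rw [mean_sum]
  · exact Finset.sum_congr rfl fun i _ => mean_congr fun z _ => by ring
  · intro i _ z hz
    have hz0 : z ≠ 0 := by rintro rfl; simp at hz
    have := ((hF i).const_mul (c i)).differentiableAt_zpow_mul k hz0
    exact this.continuousAt.continuousWithinAt

variable [Nome p]

lemma mean_add (hf : IsTheta p m σ f) (k : ℤ) :
    mean (fun z => z ^ (-k) * f z) =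
      p ^ (-k - m) * mean (fun z => z ^ (-(k + 2 * m)) * f z) := by
  have hp0 := Nome.ne_zero (p := p)
  rw [← mean_comp_const_mul' (fun z hz => hf.differentiableAt_zpow_mul k hz) hp0, ← mean_const_mul]
  refine mean_congr fun z hz => ?_
  have hz0 : z ≠ 0 := by rintro rfl; simp at hz
  rw [← hf.nome_mul z hz0, mul_zpow, mul_pow, ← pow_mul, neg_add, zpow_add₀ hz0, zpow_sub₀ hp0,
    zpow_natCast, zpow_neg z (2 * m), show (2 * m : ℤ) = ((2 * m : ℕ) : ℤ) by push_cast; rfl,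
    zpow_natCast]
  field_simp

/-- A theta function of degree `m` whose Laurent coefficients vanish on a fundamental range is
zero. -/
lemma eq_zero (hf : IsTheta p m σ f) (hm : 0 < m)
    (h0 : ∀ k : ℕ, k ≤ m → mean (fun z => z ^ (-k : ℤ) * f z) = 0) : ∀ z ≠ 0, f z = 0 := by
  have hp0 := Nome.ne_zero (p := p)
  have hall : ∀ N : ℕ, ∀ k : ℤ, k.natAbs = N → mean (fun z => z ^ (-k) * f z) = 0 := by
    intro N
    induction N using Nat.strong_induction_on with
    | _ N ih =>
      have hpos : ∀ j : ℕ, j = N → mean (fun z => z ^ (-j : ℤ) * f z) = 0 := fun j hj => by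
        rcases le_or_gt j m with h | h
        · exact h0 j h
        · have h1 := ih (j - 2 * m : ℤ).natAbs (by omega) (j - 2 * m) rfl
          rw [hf.mean_add, sub_add_cancel] at h1
          exact (mul_eq_zero.1 h1).resolve_left (zpow_ne_zero _ hp0)
      intro k hk
      rcases Int.natAbs_eq k with h | h
      · rw [h]; exact hpos _ hk
      · rw [h, hf.mean_neg, hpos _ hk, mul_zero]
  intro c hc
  have hc' : ContinuousOn (fun z => f (c * z)) (Metric.sphere 0 1) := fun z hz => by
    have hz0 : z ≠ 0 := by rintro rfl; simp at hz
    have := hf.1 (c * z) (mul_ne_zero hc hz0)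
    exact DifferentiableAt.continuousAt (𝕜 := ℂ) (by fun_prop) |>.continuousWithinAt
  have := eq_zero_of_mean_zpow_mul hc' fun k => by
    have h1 := mean_comp_const_mul' (fun z hz => hf.differentiableAt_zpow_mul k hz) hc
    rw [mean_congr (g := fun z => c ^ (-k) * (z ^ (-k) * f (c * z)))
      (fun z _ => by rw [mul_zpow, mul_assoc]), mean_const_mul] at h1
    refine (mul_eq_zero.1 (h1.trans (hall _ k rfl))).resolve_left (zpow_ne_zero _ hc)
  simpa using this

/-- Even theta functions of degree `m` form a space of dimension at most `m + 1`. -/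
lemma exists_relation_even {ι : Type*} [Fintype ι] {F : ι → ℂ → ℂ} (hm : 0 < m)
    (h : m + 1 < Fintype.card ι) (hF : ∀ i, IsTheta p m 1 (F i)) :
    ∃ c : ι → ℂ, (∀ z ≠ 0, ∑ i, c i * F i z = 0) ∧ ∃ i, c i ≠ 0 := by
  obtain ⟨c, hc, hi⟩ := exists_relation (κ := Fin (m + 1)) (by simpa using h)
    fun i k => mean (fun z => z ^ (-(k : ℕ) : ℤ) * F i z)
  refine ⟨c, (sum Finset.univ fun i _ => (hF i).const_mul (c i)).eq_zero hm fun k hk => ?_, hi⟩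
  rw [mean_sum_mul hF]
  exact hc ⟨k, by omega⟩

/-- Odd theta functions of degree `m + 1` form a space of dimension at most `m`. -/
lemma exists_relation_odd {ι : Type*} [Fintype ι] {F : ι → ℂ → ℂ}
    (h : m < Fintype.card ι) (hF : ∀ i, IsTheta p (m + 1) (-1) (F i)) :
    ∃ c : ι → ℂ, (∀ z ≠ 0, ∑ i, c i * F i z = 0) ∧ ∃ i, c i ≠ 0 := by
  obtain ⟨c, hc, hi⟩ := exists_relation (κ := Fin m) (by simpa using h)
    fun i k => mean (fun z => z ^ (-((k : ℕ) + 1) : ℤ) * F i z)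
  have hs := sum Finset.univ fun i _ => (hF i).const_mul (c i)
  refine ⟨c, hs.eq_zero m.succ_pos fun k hk => ?_, hi⟩
  rcases Nat.eq_zero_or_pos k with rfl | hk0
  · have := hs.mean_neg 0
    simp only [neg_zero] at this
    simp only [Nat.cast_zero, neg_zero]
    linear_combination this / 2
  · rcases hk.lt_or_eq with h1 | rfl
    · rw [mean_sum_mul hF]
      have := hc ⟨k - 1, by omega⟩
      simpa [Nat.cast_sub hk0] using this
    · have h1 := hs.mean_neg (m + 1 : ℕ)
      have h2 := hs.mean_add (-(m + 1 : ℕ))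
      rw [neg_neg, sub_self, zpow_zero, one_mul,
        show (-((m + 1 : ℕ) : ℤ) + 2 * ((m + 1 : ℕ) : ℤ)) = ((m + 1 : ℕ) : ℤ) by ring] at h2
      rw [neg_neg] at h1
      linear_combination (h1 - h2) / 2

end IsTheta

end ThetaSpace

section ThetaBasis

variable {p : ℂ}

/-- The even degree one theta function vanishing at `1`. -/
noncomputable def xi₀ (p z : ℂ) : ℂ := theta p z * theta p z⁻¹

/-- The even degree one theta function vanishing at `-1`, normalized at `1`. -/
noncomputable def xi₁ (p z : ℂ) : ℂ := xi₀ p (-z) / theta p (-1) ^ 2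

/-- The monomials of degree `N` in `xi₀` and `xi₁`. -/
noncomputable def xiMon (p : ℂ) (N k : ℕ) (z : ℂ) : ℂ := xi₀ p z ^ k * xi₁ p z ^ (N - k)

lemma xi₀_neg_one : xi₀ p (-1) = theta p (-1) ^ 2 := by simp [xi₀, sq]

variable [Nome p]

lemma isTheta_xi₀ : IsTheta p 1 1 (xi₀ p) where
  differentiableAt z hz := by
    have h1 := differentiableAt_theta (p := p) hz
    have h2 := differentiableAt_theta (p := p) (inv_ne_zero hz)
    exact h1.mul (h2.comp z (differentiableAt_inv hz))
  inv z hz := by simp only [xi₀, inv_inv]; ring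
  nome_mul z hz := by
    have hp0 := Nome.ne_zero (p := p)
    simp only [xi₀]
    rw [theta_nome_mul hz, theta_inv (mul_ne_zero hp0 hz), theta_nome_mul hz, theta_inv hz]
    field_simp

lemma isTheta_xi₁ : IsTheta p 1 1 (xi₁ p) where
  differentiableAt z hz := by
    have h := (isTheta_xi₀ (p := p)).1 (-z) (neg_ne_zero.2 hz)
    exact (h.comp z differentiableAt_id.neg).div_const _
  inv z hz := by
    have h := (isTheta_xi₀ (p := p)).2 (-z) (neg_ne_zero.2 hz)
    rw [inv_neg] at h
    simp [xi₁, h]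
  nome_mul z hz := by
    have h := (isTheta_xi₀ (p := p)).3 (-z) (neg_ne_zero.2 hz)
    rw [neg_sq, mul_neg] at h
    rw [xi₁, xi₁, ← h]
    ring

lemma isTheta_xiMon {N k : ℕ} (hk : k ≤ N) : IsTheta p N 1 (xiMon p N k) := by
  have h := (isTheta_xi₀ (p := p).pow k).mul (isTheta_xi₁.pow (N - k))
  rwa [one_mul, one_mul, one_mul, Nat.add_sub_cancel' hk] at h

@[simp] lemma xi₀_one : xi₀ p 1 = 0 := by simp [xi₀]

@[simp] lemma xi₁_neg_one : xi₁ p (-1) = 0 := by simp [xi₁]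

@[simp] lemma xi₁_one : xi₁ p 1 = 1 := by
  rw [xi₁, xi₀_neg_one, div_self (pow_ne_zero _ theta_neg_one_ne_zero)]

lemma isTheta_mul_div {a : ℂ} (ha : a ≠ 0) :
    IsTheta p 1 1 fun z => a⁻¹ * (theta p (a * z) * theta p (a / z)) where
  differentiableAt z hz := by
    have h1 := differentiableAt_theta (p := p) (mul_ne_zero ha hz)
    have h2 := differentiableAt_theta (p := p) (div_ne_zero ha hz)
    fun_prop (disch := exact hz)
  inv z hz := by rw [div_inv_eq_mul, ← div_eq_mul_inv]; ring
  nome_mul z hz := by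
    have hp0 := Nome.ne_zero (p := p)
    have e : a / z = p * (a / (p * z)) := by field_simp
    rw [e, theta_nome_mul (by positivity), show a * (p * z) = p * (a * z) by ring,
      theta_nome_mul (by positivity)]
    field_simp

/-- The addition formula for theta functions. -/
lemma theta_mul_theta_div {a z : ℂ} (ha : a ≠ 0) (hz : z ≠ 0) :
    a⁻¹ * (theta p (a * z) * theta p (a / z)) = xi₁ p a * xi₀ p z - xi₀ p a * xi₁ p z := by
  have hn : theta p (-1) ≠ 0 := theta_neg_one_ne_zero
  obtain ⟨c, hc, hi⟩ := IsTheta.exists_relation_even (p := p) one_pos (by simp)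
    (F := ![fun z => a⁻¹ * (theta p (a * z) * theta p (a / z)), xi₀ p, xi₁ p]) (by
      intro i
      fin_cases i
      exacts [isTheta_mul_div ha, isTheta_xi₀, isTheta_xi₁])
  simp only [Fin.sum_univ_three, Matrix.cons_val] at hc
  have h1 := hc 1 one_ne_zero
  have h2 := hc (-1) (by simp)
  rw [xi₀_one, xi₁_one, mul_one, div_one] at h1
  rw [xi₁_neg_one, xi₀_neg_one, mul_neg_one, div_neg, div_one] at h2
  have e0 : a⁻¹ * (theta p a * theta p a) = -xi₀ p a := by
    rw [xi₀, theta_inv ha]; ring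
  have e1 : a⁻¹ * (theta p (-a) * theta p (-a)) = xi₁ p a * theta p (-1) ^ 2 := by
    rw [xi₁, div_mul_cancel₀ _ (pow_ne_zero _ hn), xi₀, theta_inv (neg_ne_zero.2 ha), inv_neg]
    ring
  rw [e0] at h1
  rw [e1] at h2
  have e2 : c 0 * xi₁ p a + c 1 = 0 :=
    mul_right_cancel₀ (pow_ne_zero 2 hn) (by linear_combination h2)
  have h0 : c 0 ≠ 0 := by
    intro h0
    rw [h0] at h1 e2
    obtain ⟨i, hi⟩ := hi
    apply hi
    fin_cases i
    · exact h0
    · simpa using e2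
    · simpa using h1
  refine mul_left_cancel₀ h0 ?_
  linear_combination hc z hz - xi₀ p z * e2 - xi₁ p z * h1

/-- Monomials in `xi₀` and `xi₁` are linearly independent away from any discrete set. -/
lemma eq_zero_of_sum_xiMon {N : ℕ} {c : Fin (N + 1) → ℂ}
    (h : ∀ z ≠ 0, theta p (z ^ 2) ≠ 0 → ∑ k, c k * xiMon p N k z = 0) : c = 0 := by
  have hp0 : 0 < ‖p‖ := norm_pos_iff.2 Nome.ne_zero
  have hp1 : ‖p‖ < 1 := Nome.norm_lt_one
  have hs : √‖p‖ < 1 := by rw [Real.sqrt_lt' one_pos]; simpa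
  set e := (Set.Ioo_infinite hs).natEmbedding
  let z : Fin (N + 1) → ℂ := fun i => ((e i : ℝ) : ℂ)
  have hz : ∀ i, √‖p‖ < ‖z i‖ ∧ ‖z i‖ < 1 := fun i => by
    have := (e i).2
    rw [Complex.norm_real, Real.norm_eq_abs, abs_of_pos ((Real.sqrt_nonneg _).trans_lt this.1)]
    exact this
  have hz0 : ∀ i, z i ≠ 0 := fun i => norm_pos_iff.1 ((Real.sqrt_nonneg _).trans_lt (hz i).1)
  have hlt : ∀ i j, ‖p‖ < ‖z i * z j‖ ∧ ‖z i * z j‖ < 1 := fun i j => by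
    rw [norm_mul]
    constructor
    · rw [← Real.mul_self_sqrt hp0.le]
      exact mul_lt_mul'' (hz i).1 (hz j).1 (Real.sqrt_nonneg _) (Real.sqrt_nonneg _)
    · exact mul_lt_one_of_nonneg_of_lt_one_left (norm_nonneg _) (hz i).2 (hz j).2.le
  have hdet : (Matrix.projVandermonde (fun i => xi₀ p (z i)) fun i => xi₁ p (z i)).det ≠ 0 := by
    rw [Matrix.det_projVandermonde]
    refine Finset.prod_ne_zero_iff.2 fun i _ => Finset.prod_ne_zero_iff.2 fun j hj => ?_
    rw [show xi₀ p (z j) * xi₁ p (z i) - xi₀ p (z i) * xi₁ p (z j) =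
      xi₁ p (z i) * xi₀ p (z j) - xi₀ p (z i) * xi₁ p (z j) by ring,
      ← theta_mul_theta_div (hz0 i) (hz0 j)]
    refine mul_ne_zero (inv_ne_zero (hz0 i)) (mul_ne_zero
      (theta_ne_zero_of_norm_lt_one (hlt i j).1 (hlt i j).2) (theta_ne_zero ?_ ?_ ?_))
    · rw [norm_div, lt_div_iff₀ (norm_pos_iff.2 (hz0 j))]
      have h1 : ‖p‖ ≤ √‖p‖ := Real.le_sqrt_of_sq_le (by nlinarith)
      nlinarith [hz i, hz j]
    · rw [norm_mul, norm_div, ← mul_div_assoc, div_lt_one (norm_pos_iff.2 (hz0 j))]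
      have h1 : ‖p‖ ≤ √‖p‖ := Real.le_sqrt_of_sq_le (by nlinarith)
      nlinarith [hz i, hz j]
    · rw [Ne, div_eq_one_iff_eq (hz0 j)]
      intro h
      have := e.injective (Subtype.ext (Complex.ofReal_injective h))
      exact (Finset.mem_Ioi.1 hj).ne (Fin.ext this)
  refine Matrix.eq_zero_of_mulVec_eq_zero hdet (funext fun i => ?_)
  have := h (z i) (hz0 i) (by
    rw [sq]; exact theta_ne_zero_of_norm_lt_one (hlt i i).1 (hlt i i).2)
  rw [Matrix.mulVec, dotProduct, Pi.zero_apply, ← this]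
  refine Finset.sum_congr rfl fun k _ => ?_
  rw [Matrix.projVandermonde_apply, xiMon, Fin.val_rev, mul_comm]
  congr 3
  omega

end ThetaBasis

section ThetaRelation

variable {p : ℂ} [Nome p]

lemma isTheta_theta_sq : IsTheta p 2 (-1) fun z => z⁻¹ * theta p (z ^ 2) where
  differentiableAt z hz := by
    have h1 := differentiableAt_theta (p := p) (pow_ne_zero 2 hz)
    fun_prop (disch := exact hz)
  inv z hz := by
    rw [inv_inv, inv_pow, theta_inv (pow_ne_zero 2 hz)]
    field_simp
  nome_mul z hz := by
    have hp0 := Nome.ne_zero (p := p)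
    rw [show (p * z) ^ 2 = p * (p * z ^ 2) by ring,
      theta_nome_mul (mul_ne_zero hp0 (pow_ne_zero 2 hz)), theta_nome_mul (pow_ne_zero 2 hz)]
    field_simp

variable {n : ℕ} {t : Fin (2 * n + 4) → ℂ}

lemma prod_theta_nome_mul (ht : ∏ r, t r = p) {z : ℂ} (hz : z ≠ 0) :
    p * z ^ (2 * n + 4) * ∏ r, theta p (t r * (p * z)) = ∏ r, theta p (t r * z) := by
  have hp0 := Nome.ne_zero (p := p)
  have ht0 : ∀ r, t r ≠ 0 := fun r h => hp0 (ht ▸ Finset.prod_eq_zero (Finset.mem_univ r) h)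
  have : ∀ r, theta p (t r * (p * z)) = -(t r)⁻¹ * z⁻¹ * theta p (t r * z) := fun r => by
    rw [show t r * (p * z) = p * (t r * z) by ring, theta_nome_mul (mul_ne_zero (ht0 r) hz),
      mul_inv]
    ring
  rw [Finset.prod_congr rfl fun r _ => this r, Finset.prod_mul_distrib, Finset.prod_mul_distrib,
    Finset.prod_neg, Finset.prod_inv_distrib, ht]
  simp only [Finset.card_univ, Fintype.card_fin, Finset.prod_const]
  rw [Even.neg_one_pow ⟨n + 2, by ring⟩, inv_pow]
  field_simp
  exact Finset.prod_congr rfl fun r _ => by rw [mul_comm]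

lemma isTheta_prod_sub (ht : ∏ r, t r = p) :
    IsTheta p (n + 1 + 1) (-1) fun z =>
      z ^ (n + 1) * ∏ r, theta p (t r / z) - (z ^ (n + 1))⁻¹ * ∏ r, theta p (t r * z) where
  differentiableAt z hz := by
    have ht0 : ∀ r, t r ≠ 0 := fun r h =>
      Nome.ne_zero (p := p) (ht ▸ Finset.prod_eq_zero (Finset.mem_univ r) h)
    have h1 r := differentiableAt_theta (p := p) (mul_ne_zero (ht0 r) hz)
    have h2 r := differentiableAt_theta (p := p) (div_ne_zero (ht0 r) hz)
    have h3 : DifferentiableAt ℂ (fun z => ∏ r, theta p (t r / z)) z :=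
      DifferentiableAt.fun_finsetProd fun r _ => by
        have := h2 r
        fun_prop (disch := exact hz)
    have h4 : DifferentiableAt ℂ (fun z => ∏ r, theta p (t r * z)) z :=
      DifferentiableAt.fun_finsetProd fun r _ => by
        have := h1 r
        fun_prop
    have : z ^ (n + 1) ≠ 0 := pow_ne_zero _ hz
    fun_prop (disch := assumption)
  inv z hz := by simp only [div_inv_eq_mul, ← div_eq_mul_inv, inv_pow, inv_inv]; ring
  nome_mul z hz := by
    have hp0 := Nome.ne_zero (p := p)
    have hpz := mul_ne_zero hp0 hz
    have h1 := prod_theta_nome_mul ht hz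
    have h2 := prod_theta_nome_mul ht (inv_ne_zero hpz)
    rw [show p * (p * z)⁻¹ = z⁻¹ by field_simp] at h2
    simp only [div_eq_mul_inv]
    rw [← h2, ← h1, inv_pow]
    field_simp
    ring

/-- The basic relation: the antisymmetrization of a product of theta functions is
divisible by `theta p (z ^ 2)`. -/
lemma exists_theta_relation (ht : ∏ r, t r = p) :
    ∃ c : Fin (n + 1) → ℂ, ∀ z ≠ 0,
      z ^ (n + 2) * ∏ r, theta p (t r / z) - (z ^ n)⁻¹ * ∏ r, theta p (t r * z) =
        theta p (z ^ 2) * ∑ k, c k * xiMon p n k z := by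
  obtain ⟨c, hc, hi⟩ := IsTheta.exists_relation_odd (p := p) (m := n + 1)
    (ι := Option (Fin (n + 1)))
    (F := fun o => o.elim (fun z => z ^ (n + 1) * ∏ r, theta p (t r / z) -
      (z ^ (n + 1))⁻¹ * ∏ r, theta p (t r * z))
      fun k z => (z⁻¹ * theta p (z ^ 2)) * xiMon p n k z) (by simp) (by
      rintro (_ | k)
      · exact isTheta_prod_sub ht
      · have := isTheta_theta_sq.mul (isTheta_xiMon (p := p) (Nat.lt_succ_iff.1 k.2))
        rwa [mul_one, show 2 + n = n + 1 + 1 by ring] at this)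
  simp only [Fintype.sum_option, Option.elim] at hc
  have h0 : c none ≠ 0 := by
    intro h0
    have : (fun k => c (some k)) = 0 := eq_zero_of_sum_xiMon (p := p) fun z hz hθ => by
      have := hc z hz
      rw [h0, zero_mul, zero_add] at this
      refine mul_left_cancel₀ (mul_ne_zero (inv_ne_zero hz) hθ) ?_
      rw [mul_zero, ← this, Finset.mul_sum]
      exact Finset.sum_congr rfl fun k _ => by ring
    obtain ⟨_ | k, hi⟩ := hi
    exacts [hi h0, hi (congrFun this k)]
  refine ⟨fun k => -(c none)⁻¹ * c (some k), fun z hz => ?_⟩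
  have h1 := hc z hz
  have h2 : ∑ k : Fin (n + 1), c (some k) * (z⁻¹ * theta p (z ^ 2) * xiMon p n k z) =
      z⁻¹ * theta p (z ^ 2) * ∑ k : Fin (n + 1), c (some k) * xiMon p n k z := by
    rw [Finset.mul_sum]
    exact Finset.sum_congr rfl fun k _ => by ring
  have h3 : ∑ k : Fin (n + 1), -(c none)⁻¹ * c (some k) * xiMon p n k z =
      -(c none)⁻¹ * ∑ k : Fin (n + 1), c (some k) * xiMon p n k z := by
    rw [Finset.mul_sum]
    exact Finset.sum_congr rfl fun k _ => by ring
  rw [h2] at h1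
  rw [h3]
  refine mul_left_cancel₀ (mul_ne_zero h0 (inv_ne_zero hz)) ?_
  have e1 : c none * z⁻¹ * (theta p (z ^ 2) * (-(c none)⁻¹ *
      ∑ k : Fin (n + 1), c (some k) * xiMon p n k z)) =
      -(z⁻¹ * theta p (z ^ 2) * ∑ k : Fin (n + 1), c (some k) * xiMon p n k z) := by
    field_simp
  rw [e1, ← eq_neg_iff_add_eq_zero.2 h1]
  field_simp
  ring

end ThetaRelation

section LinearAlgebra

open Matrix

/-- A linear relation between the rows of all columns of `A` but one determines the dependence of
the determinant on that column up to a scalar. -/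
lemma det_updateCol_mul_dotProduct {ι : Type*} [Fintype ι] [DecidableEq ι] (A : Matrix ι ι ℂ)
    (j₀ : ι) (c : ι → ℂ) (hc : ∀ j, j ≠ j₀ → ∑ i, c i * A i j = 0) (u v : ι → ℂ) :
    (A.updateCol j₀ u).det * (c ⬝ᵥ v) = (A.updateCol j₀ v).det * (c ⬝ᵥ u) := by
  by_cases h0 : c = 0
  · simp [h0]
  have h : (A.updateCol j₀ ((c ⬝ᵥ v) • u + (-(c ⬝ᵥ u)) • v)).det = 0 := by
    refine Matrix.exists_vecMul_eq_zero_iff.1 ⟨c, h0, funext fun j => ?_⟩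
    rw [vecMul, dotProduct, Pi.zero_apply]
    rcases eq_or_ne j j₀ with rfl | hj
    · simp only [updateCol_self]
      change c ⬝ᵥ _ = 0
      rw [dotProduct_add, dotProduct_smul, dotProduct_smul, smul_eq_mul, smul_eq_mul]
      ring
    · simpa [updateCol_ne hj] using hc j hj
  rw [det_updateCol_add, det_updateCol_smul, det_updateCol_smul] at h
  linear_combination h

/-- The special case of `det_updateCol_mul_dotProduct` for matrices split as a first column and the
remaining ones. -/
lemma det_cons_mul_sum {N : ℕ} (R : Matrix (Fin (N + 1)) (Fin N) ℂ) (c : Fin (N + 1) → ℂ)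
    (hc : ∀ l, ∑ k, c k * R k l = 0) (u v : Fin (N + 1) → ℂ) :
    (of fun k => (Fin.cons (u k) (R k) : Fin (N + 1) → ℂ)).det * ∑ k, c k * v k =
      (of fun k => (Fin.cons (v k) (R k) : Fin (N + 1) → ℂ)).det * ∑ k, c k * u k := by
  have key : ∀ w : Fin (N + 1) → ℂ,
      (of fun k => (Fin.cons (u k) (R k) : Fin (N + 1) → ℂ)).updateCol 0 w =
        of fun k => (Fin.cons (w k) (R k) : Fin (N + 1) → ℂ) := fun w => by
    ext k j
    refine Fin.cases ?_ (fun l => ?_) j <;> simp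
  have := det_updateCol_mul_dotProduct
    (of fun k => (Fin.cons (u k) (R k) : Fin (N + 1) → ℂ)) 0 c (fun j hj => by
      obtain ⟨l, rfl⟩ := Fin.exists_succ_eq.2 hj
      simpa using hc l) u v
  rwa [key, key] at this

/-- Composition with multiplication by a linear form, expressed as evaluation at its root. -/
lemma det_linear_form {N : ℕ} {α β : ℂ} (hβ : β ≠ 0) (R : Matrix (Fin (N + 1)) (Fin N) ℂ) :
    (of fun k l : Fin N => β * R k.succ l - α * R k.castSucc l).det =
      (of fun k : Fin (N + 1) =>
        (Fin.cons (α ^ (k : ℕ) * β ^ (N - k)) (R k) : Fin (N + 1) → ℂ)).det := by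
  rw [det_eq_of_forall_row_eq_smul_add_pred (fun _ => α / β)
    (B := of fun k : Fin (N + 1) => (Fin.cons (if k = 0 then β ^ N else 0)
      (fun l => (Fin.cons (R 0 l) (fun k' : Fin N => R k'.succ l - α / β * R k'.castSucc l) :
        Fin (N + 1) → ℂ) k) : Fin (N + 1) → ℂ))]
  · rw [det_succ_column_zero, Fin.sum_univ_succ]
    simp only [of_apply, Fin.cons_zero, Fin.succ_ne_zero, if_true, if_false, mul_zero, zero_mul,
      Finset.sum_const_zero, add_zero, Fin.val_zero, pow_zero, one_mul]
    rw [show β ^ N = β ^ Fintype.card (Fin N) by simp, ← det_smul]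
    congr 1
    ext k l
    simp only [of_apply, Matrix.smul_apply, submatrix_apply, Fin.zero_succAbove, Fin.cons_succ,
      smul_eq_mul]
    field_simp
  · intro j
    refine Fin.cases ?_ (fun l => ?_) j <;> simp
  · intro i j
    refine Fin.cases ?_ (fun l => ?_) j
    · simp only [of_apply, Fin.cons_zero, Fin.succ_ne_zero, if_false, Fin.val_succ,
        Fin.val_castSucc, zero_add]
      rw [show N - (i : ℕ) = N - (i + 1) + 1 by omega, pow_succ, pow_succ]
      field_simp
    · simp

end LinearAlgebra

section Weight

open Metric

variable {p q : ℂ} {ι : Type*} [Fintype ι] {t : ι → ℂ}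

/-- The one-dimensional elliptic beta weight attached to the parameters `t`. -/
noncomputable def weight (p q : ℂ) (t : ι → ℂ) (z : ℂ) : ℂ :=
  (∏ r, ellGamma (t r * z) p q * ellGamma (t r / z) p q) * (theta p (z ^ 2) * theta q (z ^ 2)⁻¹)

/-- Parameters in the punctured unit disc. -/
def IsSmall (t : ι → ℂ) : Prop := ∀ r, t r ≠ 0 ∧ ‖t r‖ < 1

lemma ne_zero_of_norm_eq_one {z : ℂ} (hz : ‖z‖ = 1) : z ≠ 0 := by
  rintro rfl
  simp at hz

variable [Nome p] [Nome q]

lemma weight_comm {z : ℂ} (hz : z ≠ 0) : weight q p t z = weight p q t z := by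
  simp only [weight, ellGamma_comm (p := q) (q := p)]
  rw [theta_inv (pow_ne_zero 2 hz), theta_inv (pow_ne_zero 2 hz)]
  ring

lemma differentiableAt_ellGamma_of_norm_lt_one {x : ℂ} (hx : x ≠ 0) (h : ‖x‖ < 1) :
    DifferentiableAt ℂ (fun x => ellGamma x p q) x :=
  differentiableAt_ellGamma hx h.le (by rintro rfl; simp at h)

lemma continuousOn_weight (ht : IsSmall t) : ContinuousOn (weight p q t) (sphere 0 1) := by
  intro z hz
  have hz1 : ‖z‖ = 1 := by simpa using hz
  have hz0 := ne_zero_of_norm_eq_one hz1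
  have h1 r := differentiableAt_ellGamma_of_norm_lt_one (p := p) (q := q)
    (mul_ne_zero (ht r).1 hz0) (by rw [norm_mul, hz1, mul_one]; exact (ht r).2)
  have h2 r := differentiableAt_ellGamma_of_norm_lt_one (p := p) (q := q)
    (div_ne_zero (ht r).1 hz0) (by rw [norm_div, hz1, div_one]; exact (ht r).2)
  have h3 := differentiableAt_theta (p := p) (pow_ne_zero 2 hz0)
  have hq4 := differentiableAt_theta (p := q) (inv_ne_zero (pow_ne_zero 2 hz0))
  have h5 : DifferentiableAt ℂ
      (fun z => ∏ r, ellGamma (t r * z) p q * ellGamma (t r / z) p q) z :=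
    DifferentiableAt.fun_finsetProd fun r _ =>
      (DifferentiableAt.comp z (h1 r) (by fun_prop)).mul
        (DifferentiableAt.comp z (h2 r) (by fun_prop (disch := assumption)))
  have h6 : DifferentiableAt ℂ (weight p q t) z := by
    refine h5.mul (DifferentiableAt.mul ?_ ?_)
    · exact DifferentiableAt.comp (f := fun z : ℂ => z ^ 2) z h3 (by fun_prop)
    · exact DifferentiableAt.comp z hq4
        ((by fun_prop : DifferentiableAt ℂ (fun z : ℂ => z ^ 2) z).inv (pow_ne_zero 2 hz0))
  exact h6.continuousAt.continuousWithinAt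

end Weight

section Relation

open Metric

variable {p q : ℂ} [Nome q] {n : ℕ} {t : Fin (2 * n + 4) → ℂ}

/-- A holomorphic half of the symmetric integrand. -/
noncomputable def halfKernel (p q : ℂ) (t : Fin (2 * n + 4) → ℂ) (z : ℂ) : ℂ :=
  z ^ (n + 2) * (∏ r, ellGamma (t r * z) p q * ellGamma (q * t r / z) p q) * theta q (z ^ 2)⁻¹

lemma norm_mul_div_lt_one {a z : ℂ} (h1 : ‖q‖ ≤ ‖z‖) (ha : ‖a‖ < 1) : ‖q * a / z‖ < 1 := by
  have hq : 0 < ‖q‖ := norm_pos_iff.2 Nome.ne_zero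
  rw [norm_div, norm_mul, div_lt_one (hq.trans_le h1)]
  nlinarith

lemma halfKernel_nome_mul_inv {z : ℂ} (hz : z ≠ 0) :
    halfKernel p q t (q * z⁻¹) = -((q * z⁻¹ ^ 2) ^ n * (z ^ 2 / q) * halfKernel p q t z) := by
  have hq0 := Nome.ne_zero (p := q)
  have hz2 := pow_ne_zero 2 hz
  have e1 : ((q * z⁻¹) ^ 2)⁻¹ = z ^ 2 / q ^ 2 := by field_simp
  have e2 := theta_nome_mul (p := q) (x := z ^ 2 / q ^ 2) (by positivity)
  have e3 := theta_nome_mul (p := q) (x := z ^ 2 / q) (by positivity)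
  rw [show q * (z ^ 2 / q ^ 2) = z ^ 2 / q by field_simp] at e2
  rw [mul_div_cancel₀ _ hq0, e2] at e3
  have e4 : ∏ r, ellGamma (t r * (q * z⁻¹)) p q * ellGamma (q * t r / (q * z⁻¹)) p q =
      ∏ r, ellGamma (t r * z) p q * ellGamma (q * t r / z) p q :=
    Finset.prod_congr rfl fun r _ => by
      rw [show t r * (q * z⁻¹) = q * t r / z by ring,
        show q * t r / (q * z⁻¹) = t r * z by field_simp, mul_comm]
  rw [halfKernel, halfKernel, e1, e4, theta_inv hz2, e3]
  have e5 : (q / z ^ 2) ^ n * z ^ (n + 2) * q ^ 2 = z ^ 4 * (q / z) ^ (n + 2) := by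
    rw [div_pow, div_pow, ← pow_mul, mul_comm 2 n, pow_mul]
    field_simp
    ring
  field_simp
  simp only [mul_comm z (t _)]
  linear_combination -(∏ x, ellGamma (t x * z) p q * ellGamma (q * t x / z) p q) *
    theta q (z ^ 2 / q ^ 2) * e5

variable [Nome p]

lemma differentiableAt_halfKernel (ht : IsSmall t) {z : ℂ} (hz : ‖q‖ ≤ ‖z‖) (hz' : ‖z‖ ≤ 1) :
    DifferentiableAt ℂ (halfKernel p q t) z := by
  have hq0 := Nome.ne_zero (p := q)
  have hz0 : z ≠ 0 := norm_pos_iff.1 ((norm_pos_iff.2 hq0).trans_le hz)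
  have h1 r := differentiableAt_ellGamma_of_norm_lt_one (p := p) (q := q)
    (mul_ne_zero (ht r).1 hz0) (by
      rw [norm_mul]; exact mul_lt_one_of_nonneg_of_lt_one_left (norm_nonneg _) (ht r).2 hz')
  have h2 r := differentiableAt_ellGamma_of_norm_lt_one (p := p) (q := q)
    (div_ne_zero (mul_ne_zero hq0 (ht r).1) hz0) (norm_mul_div_lt_one hz (ht r).2)
  have hq4 := differentiableAt_theta (p := q) (inv_ne_zero (pow_ne_zero 2 hz0))
  have h5 : DifferentiableAt ℂ
      (fun z => ∏ r, ellGamma (t r * z) p q * ellGamma (q * t r / z) p q) z :=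
    DifferentiableAt.fun_finsetProd fun r _ =>
      (DifferentiableAt.comp z (h1 r) (by fun_prop)).mul
        (DifferentiableAt.comp z (h2 r) (by fun_prop (disch := assumption)))
  refine ((by fun_prop : DifferentiableAt ℂ (fun z : ℂ => z ^ (n + 2)) z).mul h5).mul ?_
  exact DifferentiableAt.comp z hq4
    ((by fun_prop : DifferentiableAt ℂ (fun z : ℂ => z ^ 2) z).inv (pow_ne_zero 2 hz0))

lemma halfKernel_eq (ht : IsSmall t) {z : ℂ} (hz : ‖z‖ = 1) :
    halfKernel p q t z = z ^ (n + 2) * (∏ r, theta p (t r / z)) *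
      (∏ r, ellGamma (t r * z) p q * ellGamma (t r / z) p q) * theta q (z ^ 2)⁻¹ := by
  have hz0 := ne_zero_of_norm_eq_one hz
  rw [halfKernel, mul_assoc (z ^ (n + 2)) (∏ r, theta p (t r / z)), ← Finset.prod_mul_distrib]
  congr 2
  refine Finset.prod_congr rfl fun r _ => ?_
  rw [mul_div_assoc, ellGamma_right_mul (div_ne_zero (ht r).1 hz0)
    (by rw [norm_div, hz, div_one]; exact (ht r).2)]
  ring

/-- Symmetrization of the basic theta relation. -/
lemma sum_mul_mean (ht : IsSmall t) {c : Fin (n + 1) → ℂ}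
    (hc : ∀ z ≠ 0, z ^ (n + 2) * ∏ r, theta p (t r / z) - (z ^ n)⁻¹ * ∏ r, theta p (t r * z) =
        theta p (z ^ 2) * ∑ k, c k * xiMon p n k z)
    {φ : ℂ → ℂ} (hφ : ContinuousOn φ (sphere 0 1)) (hi : ∀ z, ‖z‖ = 1 → φ z⁻¹ = φ z) :
    ∑ k, c k * mean (fun z => xiMon p n k z * (φ z * weight p q t z)) =
      2 * mean (fun z => φ z * halfKernel p q t z) := by
  have hne : ∀ z ∈ sphere (0 : ℂ) 1, z ≠ 0 := fun z hz => ne_zero_of_norm_eq_one (by simpa using hz)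
  have hG : ContinuousOn (fun z => φ z * halfKernel p q t z) (sphere 0 1) := by
    refine hφ.mul fun z hz => ?_
    have hz1 : ‖z‖ = 1 := by simpa using hz
    exact (differentiableAt_halfKernel ht (by rw [hz1]; exact Nome.norm_lt_one.le)
      hz1.le).continuousAt.continuousWithinAt
  have hG' : ContinuousOn (fun z => φ z⁻¹ * halfKernel p q t z⁻¹) (sphere 0 1) :=
    hG.comp (f := fun z => z⁻¹) (continuousOn_inv₀.mono fun z hz => hne z hz) fun z hz => by
      simpa using hz
  have e : 2 * mean (fun z => φ z * halfKernel p q t z) =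
      mean (fun z => φ z * halfKernel p q t z + φ z⁻¹ * halfKernel p q t z⁻¹) := by
    rw [mean_add hG hG', mean_inv fun z => φ z * halfKernel p q t z, two_mul]
  rw [e]
  simp_rw [← mean_const_mul]
  rw [← mean_sum]
  · refine mean_congr fun z hz => ?_
    have hz0 := ne_zero_of_norm_eq_one hz
    have h := hc z hz0
    have e1 : ∑ k, c k * (xiMon p n k z * (φ z * weight p q t z)) =
        (theta p (z ^ 2) * ∑ k, c k * xiMon p n k z) * (φ z * (theta q (z ^ 2)⁻¹ *
          ∏ r, ellGamma (t r * z) p q * ellGamma (t r / z) p q)) := by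
      rw [Finset.mul_sum, Finset.sum_mul, weight]
      exact Finset.sum_congr rfl fun k _ => by ring
    rw [e1, ← h, hi z hz, halfKernel_eq ht hz, halfKernel_eq ht (by simpa using hz), inv_pow,
      inv_pow, theta_inv (x := (z ^ 2)⁻¹) (by simpa using hz0)]
    simp only [div_inv_eq_mul, ← div_eq_mul_inv, inv_inv, mul_comm (ellGamma (_ / z) p q)]
    field_simp
    ring
  · intro k _
    refine continuousOn_const.mul (ContinuousOn.mul (fun z hz => ?_)
      (hφ.mul (continuousOn_weight ht)))
    exact ((isTheta_xiMon (p := p) (Nat.lt_succ_iff.1 k.2)).1 z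
      (hne z hz)).continuousAt.continuousWithinAt

/-- The moments of the weight satisfy a linear relation with coefficients from the theta
relation. -/
lemma sum_mul_mean_eq_zero {N : ℕ} {t : Fin (2 * (N + 1) + 4) → ℂ} (ht : IsSmall t)
    {c : Fin (N + 1 + 1) → ℂ}
    (hc : ∀ z ≠ 0, z ^ (N + 1 + 2) * ∏ r, theta p (t r / z) -
        (z ^ (N + 1))⁻¹ * ∏ r, theta p (t r * z) =
        theta p (z ^ 2) * ∑ k, c k * xiMon p (N + 1) k z)
    {φ : ℂ → ℂ} (hφ : IsTheta q N 1 φ) :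
    ∑ k, c k * mean (fun z => xiMon p (N + 1) k z * (φ z * weight p q t z)) = 0 := by
  have hq0 := Nome.ne_zero (p := q)
  rw [sum_mul_mean ht hc (fun z hz => ?_) (fun z hz => ?_),
    mean_eq_zero_of_reflect hq0 Nome.norm_lt_one.le (fun z h1 h2 => ?_) fun z hz => ?_, mul_zero]
  · exact (hφ.1 z (norm_pos_iff.1 ((norm_pos_iff.2 hq0).trans_le h1))).mul
      (differentiableAt_halfKernel ht h1 h2)
  · have hz0 := ne_zero_of_norm_eq_one hz
    have h1 := hφ.3 z⁻¹ (inv_ne_zero hz0)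
    rw [hφ.2 z hz0, one_mul] at h1
    rw [← h1, halfKernel_nome_mul_inv hz0, pow_succ]
    field_simp
  · exact (hφ.1 z (ne_zero_of_norm_eq_one (by simpa using hz))).continuousAt.continuousWithinAt
  · rw [hφ.2 z (ne_zero_of_norm_eq_one hz), one_mul]

end Relation

section GammaProd

/-- The product of the elliptic Gamma functions of all pairwise products of parameters. -/
noncomputable def gammaProd (p q : ℂ) {m : ℕ} (t : Fin m → ℂ) : ℂ :=
  ∏ r, ∏ s, if r < s then ellGamma (t r * t s) p q else 1

variable {p q : ℂ} {m : ℕ}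

lemma gammaProd_insertNth (j : Fin (m + 1)) (x : ℂ) (u : Fin m → ℂ) :
    gammaProd p q (j.insertNth x u : Fin (m + 1) → ℂ) =
      (∏ s, ellGamma (x * u s) p q) * gammaProd p q u := by
  simp only [gammaProd, Fin.prod_univ_succAbove _ j, Fin.insertNth_apply_same,
    Fin.insertNth_apply_succAbove, lt_irrefl, if_false, one_mul, Finset.prod_mul_distrib,
    Fin.succAbove_lt_succAbove_iff]
  rw [← mul_assoc, ← Finset.prod_mul_distrib]
  congr 1
  refine Finset.prod_congr rfl fun s _ => ?_
  rcases (Fin.succAbove_ne j s).lt_or_gt with h | h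
  · rw [if_neg h.not_gt, if_pos h, one_mul, mul_comm x]
  · rw [if_pos h, if_neg h.not_gt, mul_one]

lemma gammaProd_update (j : Fin (m + 1)) (x : ℂ) (t : Fin (m + 1) → ℂ) :
    gammaProd p q (Function.update t j x) =
      (∏ s, ellGamma (x * t (j.succAbove s)) p q) * gammaProd p q (j.removeNth t) := by
  rw [← Fin.insertNth_removeNth, gammaProd_insertNth]
  rfl

lemma gammaProd_eq (j : Fin (m + 1)) (t : Fin (m + 1) → ℂ) :
    gammaProd p q t =
      (∏ s, ellGamma (t j * t (j.succAbove s)) p q) * gammaProd p q (j.removeNth t) := by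
  rw [← gammaProd_update, Function.update_eq_self]

variable [Nome p] [Nome q]

/-- Multiplying one parameter by `q`. -/
lemma gammaProd_update_nome_mul {t : Fin (m + 1) → ℂ} (ht : IsSmall t) (j : Fin (m + 1)) :
    gammaProd p q (Function.update t j (q * t j)) =
      (∏ s, theta p (t j * t (j.succAbove s))) * gammaProd p q t := by
  rw [gammaProd_update, gammaProd_eq j t, ← mul_assoc, ← Finset.prod_mul_distrib]
  congr 1
  refine Finset.prod_congr rfl fun s _ => ?_
  rw [mul_assoc, ellGamma_right_mul (mul_ne_zero (ht _).1 (ht _).1)]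
  rw [norm_mul]
  exact mul_lt_one_of_nonneg_of_lt_one_left (norm_nonneg _) (ht _).2 (ht _).2.le

end GammaProd

section Moment

open Metric Matrix

variable {p q : ℂ} {ι : Type*} [Fintype ι] {t : ι → ℂ}

/-- The moments of the weight against monomials of degrees `N` and `N'`. -/
noncomputable def moment (p q : ℂ) (t : ι → ℂ) (N N' k l : ℕ) : ℂ :=
  mean fun z => xiMon p N k z * (xiMon q N' l z * weight p q t z)

/-- The determinant of moments. -/
noncomputable def momentDet (p q : ℂ) (t : ι → ℂ) (n : ℕ) : ℂ :=
  (of fun k l : Fin n => moment p q t (n - 1) (n - 1) k l).det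

variable [Nome p] [Nome q]

lemma continuousOn_xiMon {N k : ℕ} (hk : k ≤ N) : ContinuousOn (xiMon p N k) (sphere 0 1) :=
  fun z hz => ((isTheta_xiMon hk).1 z
    (ne_zero_of_norm_eq_one (by simpa using hz))).continuousAt.continuousWithinAt

lemma IsSmall.update_nome_mul {ι : Type*} [DecidableEq ι] {t : ι → ℂ} (ht : IsSmall t) (j : ι) :
    IsSmall (Function.update t j (q * t j)) := by
  intro r
  rcases eq_or_ne r j with rfl | hr
  · rw [Function.update_self]
    refine ⟨mul_ne_zero Nome.ne_zero (ht r).1, ?_⟩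
    rw [norm_mul]
    exact mul_lt_one_of_nonneg_of_lt_one_left (norm_nonneg _) Nome.norm_lt_one (ht r).2.le
  · rw [Function.update_of_ne hr]
    exact ht r

lemma weight_update_nome_mul [DecidableEq ι] (ht : IsSmall t) (j : ι) {z : ℂ} (hz : ‖z‖ = 1) :
    weight p q (Function.update t j (q * t j)) z =
      theta p (t j * z) * theta p (t j / z) * weight p q t z := by
  have hz0 := ne_zero_of_norm_eq_one hz
  rw [weight, weight, ← Finset.mul_prod_erase _ _ (Finset.mem_univ j),
    ← Finset.mul_prod_erase Finset.univ (fun r => ellGamma (t r * z) p q * ellGamma (t r / z) p q)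
      (Finset.mem_univ j)]
  rw [Finset.prod_congr rfl fun r hr => by rw [Function.update_of_ne (Finset.ne_of_mem_erase hr)]]
  rw [Function.update_self, mul_assoc q, mul_div_assoc q,
    ellGamma_right_mul (mul_ne_zero (ht j).1 hz0) (by rw [norm_mul, hz, mul_one]; exact (ht j).2),
    ellGamma_right_mul (div_ne_zero (ht j).1 hz0) (by rw [norm_div, hz, div_one]; exact (ht j).2)]
  ring

lemma moment_update [DecidableEq ι] (ht : IsSmall t) (j : ι) {N k l : ℕ} (hk : k ≤ N)
    {N' : ℕ} (hl : l ≤ N') :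
    moment p q (Function.update t j (q * t j)) N N' k l =
      t j * (xi₁ p (t j) * moment p q t (N + 1) N' (k + 1) l -
        xi₀ p (t j) * moment p q t (N + 1) N' k l) := by
  have hc : ∀ k ≤ N + 1, ContinuousOn
      (fun z => xiMon p (N + 1) k z * (xiMon q N' l z * weight p q t z)) (sphere 0 1) :=
    fun k hk => (continuousOn_xiMon hk).mul ((continuousOn_xiMon hl).mul (continuousOn_weight ht))
  simp only [moment]
  rw [← mean_const_mul, ← mean_const_mul, ← mean_sub, ← mean_const_mul]
  · refine mean_congr fun z hz => ?_
    have hz0 := ne_zero_of_norm_eq_one hz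
    have h := theta_mul_theta_div (p := p) (ht j).1 hz0
    rw [inv_mul_eq_iff_eq_mul₀ (ht j).1] at h
    rw [weight_update_nome_mul ht j hz, h]
    simp only [xiMon]
    rw [show N + 1 - (k + 1) = N - k by omega, show N + 1 - k = N - k + 1 by omega]
    ring
  · exact continuousOn_const.mul (hc _ (by omega))
  · exact continuousOn_const.mul (hc _ (by omega))

/-- The matrix of moments of degrees `n` and `n - 1`, extended by a first column `u`. -/
noncomputable def extMoment (p q : ℂ) (t : ι → ℂ) (n : ℕ) (u : Fin (n + 1) → ℂ) :
    Matrix (Fin (n + 1)) (Fin (n + 1)) ℂ :=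
  of fun k => (Fin.cons (u k) (fun l : Fin n => moment p q t n (n - 1) k l) : Fin (n + 1) → ℂ)

/-- The determinant of moments after multiplying a parameter by `q`, in terms of an evaluation. -/
lemma momentDet_update [DecidableEq ι] (ht : IsSmall t) (j : ι) (n : ℕ) (hj : xi₁ p (t j) ≠ 0) :
    momentDet p q (Function.update t j (q * t j)) n =
      t j ^ n * (extMoment p q t n fun k => xiMon p n k (t j)).det := by
  rcases n with _ | N
  · simp [momentDet, extMoment, xiMon]
  have h := det_linear_form (α := xi₀ p (t j)) hj (N := N + 1)
    (of fun k l => moment p q t (N + 1) N k l)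
  simp only [xiMon]
  refine Eq.trans ?_ (congrArg _ h)
  rw [show t j ^ (N + 1) = t j ^ Fintype.card (Fin (N + 1)) by simp, ← det_smul, momentDet]
  congr 1
  ext k l
  simp only [of_apply, Matrix.smul_apply, smul_eq_mul, Nat.add_sub_cancel]
  rw [moment_update ht j (Nat.lt_succ_iff.1 k.2) (Nat.lt_succ_iff.1 l.2)]
  rfl

end Moment

section Shift

variable {p q : ℂ} [Nome p] [Nome q] {n : ℕ} {t : Fin (2 * n + 4) → ℂ}

/-- The value at a parameter of the form appearing in the theta relation. -/
lemma sum_mul_xiMon_eval {c : Fin (n + 1) → ℂ} (ht : IsSmall t)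
    (hc : ∀ z ≠ 0, z ^ (n + 2) * ∏ r, theta p (t r / z) - (z ^ n)⁻¹ * ∏ r, theta p (t r * z) =
        theta p (z ^ 2) * ∑ k, c k * xiMon p n k z)
    (j : Fin (2 * n + 4)) (hj : theta p (t j ^ 2) ≠ 0) :
    ∑ k, c k * xiMon p n k (t j) =
      -((t j ^ n)⁻¹ * ∏ s : Fin (2 * n + 3), theta p (t j * t (j.succAbove s))) := by
  refine mul_left_cancel₀ hj ?_
  rw [← hc _ (ht j).1, Finset.prod_eq_zero (Finset.mem_univ j) (by simp [div_self (ht j).1]),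
    Fin.prod_univ_succAbove _ j]
  simp only [mul_comm (t (j.succAbove _)), ← sq]
  ring

lemma extMoment_det_mul_sum {c : Fin (n + 1) → ℂ} (ht : IsSmall t)
    (hc : ∀ z ≠ 0, z ^ (n + 2) * ∏ r, theta p (t r / z) - (z ^ n)⁻¹ * ∏ r, theta p (t r * z) =
        theta p (z ^ 2) * ∑ k, c k * xiMon p n k z) (u v : Fin (n + 1) → ℂ) :
    (extMoment p q t n u).det * ∑ k, c k * v k = (extMoment p q t n v).det * ∑ k, c k * u k := by
  refine det_cons_mul_sum (Matrix.of fun k l => moment p q t n (n - 1) k l) c (fun l => ?_) u v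
  obtain _ | N := n
  · exact l.elim0
  · exact sum_mul_mean_eq_zero ht hc (isTheta_xiMon (Nat.lt_succ_iff.1 l.2))

/-- The determinant of moments and the product of Gamma functions change in the same way when a
factor `q` is moved between two parameters. -/
lemma momentDet_mul_gammaProd_shift (ht : IsSmall t) (hp : ∏ r, t r = p) (i j : Fin (2 * n + 4))
    (hi : theta p (t i ^ 2) ≠ 0) (hi' : xi₁ p (t i) ≠ 0)
    (hj : theta p (t j ^ 2) ≠ 0) (hj' : xi₁ p (t j) ≠ 0) :
    momentDet p q (Function.update t j (q * t j)) n *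
        gammaProd p q (Function.update t i (q * t i)) =
      momentDet p q (Function.update t i (q * t i)) n *
        gammaProd p q (Function.update t j (q * t j)) := by
  obtain ⟨c, hc⟩ := exists_theta_relation hp
  have h := extMoment_det_mul_sum (q := q) ht hc (fun k => xiMon p n k (t j))
    (fun k => xiMon p n k (t i))
  rw [sum_mul_xiMon_eval ht hc i hi, sum_mul_xiMon_eval ht hc j hj] at h
  rw [momentDet_update ht j n hj', momentDet_update ht i n hi',
    gammaProd_update_nome_mul ht, gammaProd_update_nome_mul ht]
  have h1 := pow_ne_zero n (ht i).1
  have h2 := pow_ne_zero n (ht j).1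
  field_simp at h
  linear_combination (-gammaProd p q t) * h

end Shift

section Parametric

open Metric

variable {V : Set ℂ} {K : ℂ → ℂ → ℂ}

/-- Circle averages of a holomorphic family are holomorphic. -/
lemma differentiableOn_mean (hV : IsOpen V)
    (hK : ContinuousOn (fun x : ℂ × ℂ => K x.1 x.2) (V ×ˢ sphere 0 1))
    (hd : ∀ z, ‖z‖ = 1 → DifferentiableOn ℂ (fun w => K w z) V) :
    DifferentiableOn ℂ (fun w => mean (K w)) V := by
  intro w hw
  obtain ⟨r, hr, hrV⟩ := nhds_basis_closedBall.mem_iff.1 (hV.mem_nhds hw)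
  have hcirc θ : circleMap 0 1 θ ∈ sphere (0 : ℂ) 1 := circleMap_mem_sphere 0 zero_le_one θ
  have hcirc' θ : ‖circleMap 0 1 θ‖ = 1 := by simp
  obtain ⟨M, hM⟩ :=
    ((isCompact_closedBall w r).prod (isCompact_sphere (0 : ℂ) 1)).exists_bound_of_continuousOn
      (hK.mono (Set.prod_mono_left hrV))
  have hcont : ∀ v ∈ V, Continuous fun θ => K v (circleMap 0 1 θ) := fun v hv =>
    hK.comp_continuous (f := fun θ => (v, circleMap 0 1 θ)) (by fun_prop) fun θ => ⟨hv, hcirc θ⟩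
  have hder : ∀ θ, ∀ v ∈ V, HasDerivAt (fun v => K v (circleMap 0 1 θ))
      (deriv (fun v => K v (circleMap 0 1 θ)) v) v := fun θ v hv =>
    ((hd _ (hcirc' θ)).differentiableAt (hV.mem_nhds hv)).hasDerivAt
  have h := (intervalIntegral.hasDerivAt_integral_of_dominated_loc_of_deriv_le (μ := volume)
    (a := 0) (b := 2 * π) (F := fun v θ => K v (circleMap 0 1 θ))
    (F' := fun v θ => deriv (fun v => K v (circleMap 0 1 θ)) v) (x₀ := w)
    (s := ball w (r / 2)) (bound := fun _ => M / (r / 2)) (ball_mem_nhds w (by positivity))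
    ?_ ?_ ?_ ?_ ?_ ?_).2
  · simp only [mean, Real.circleAverage]
    exact (h.differentiableAt.const_smul _).differentiableWithinAt
  · filter_upwards [hV.mem_nhds hw] with v hv using (hcont v hv).aestronglyMeasurable
  · exact (hcont w hw).intervalIntegrable _ _
  · classical
    refine aestronglyMeasurable_of_tendsto_ae (𝓝[≠] (0 : ℂ)) (f := fun h θ => if w + h ∈ V then
      h⁻¹ • (K (w + h) (circleMap 0 1 θ) - K w (circleMap 0 1 θ)) else 0) (fun h => ?_)
      (ae_of_all _ fun θ => ?_)
    · split_ifs with hh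
      · exact (((hcont _ hh).sub (hcont w hw)).const_smul h⁻¹).aestronglyMeasurable
      · exact aestronglyMeasurable_const
    · refine (hasDerivAt_iff_tendsto_slope_zero.1 (hder θ w hw)).congr' ?_
      have : Tendsto (fun h : ℂ => w + h) (𝓝[≠] 0) (𝓝 w) :=
        tendsto_nhdsWithin_of_tendsto_nhds (by simpa using (continuous_const_add w).tendsto 0)
      filter_upwards [this (hV.mem_nhds hw)] with h hh using (if_pos hh).symm
  · refine ae_of_all _ fun θ _ v hv => ?_
    have hsub : closedBall v (r / 2) ⊆ closedBall w r := closedBall_subset_closedBall' (by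
      have := mem_ball.1 hv; linarith)
    refine Complex.norm_deriv_le_of_forall_mem_sphere_norm_le (by positivity) ?_ fun u hu => ?_
    · exact ((hd _ (hcirc' θ)).mono (hsub.trans hrV)).diffContOnCl_ball le_rfl
    · exact hM (u, _) ⟨hsub (sphere_subset_closedBall hu), hcirc θ⟩
  · exact intervalIntegrable_const
  · refine ae_of_all _ fun θ _ v hv => hder θ v (hrV ?_)
    exact ball_subset_closedBall (ball_subset_ball (by linarith) hv)

variable {p q : ℂ} [Nome p] [Nome q] {ι : Type*} {T : ℂ → ι → ℂ}

lemma differentiableOn_moment [Fintype ι] (hV : IsOpen V)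
    (hT : ∀ r, DifferentiableOn ℂ (fun w => T w r) V) (hs : ∀ w ∈ V, IsSmall (T w))
    {N N' k l : ℕ} (hk : k ≤ N) (hl : l ≤ N') :
    DifferentiableOn ℂ (fun w => moment p q (T w) N N' k l) V := by
  refine differentiableOn_mean hV ?_ fun z hz => ?_
  · have hz : ∀ x ∈ V ×ˢ sphere (0 : ℂ) 1, ‖x.2‖ = 1 := fun x hx => by simpa using hx.2
    have hz0 : ∀ x ∈ V ×ˢ sphere (0 : ℂ) 1, x.2 ≠ 0 := fun x hx =>
      ne_zero_of_norm_eq_one (hz x hx)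
    have hc2 : ContinuousOn (fun x : ℂ × ℂ => x.2) (V ×ˢ sphere 0 1) := continuous_snd.continuousOn
    have hm2 : Set.MapsTo (fun x : ℂ × ℂ => x.2) (V ×ˢ sphere 0 1) (sphere 0 1) := fun x hx => hx.2
    have hTc r : ContinuousOn (fun x : ℂ × ℂ => T x.1 r) (V ×ˢ sphere 0 1) :=
      (hT r).continuousOn.comp continuous_fst.continuousOn fun x hx => hx.1
    have hth : ∀ p : ℂ, Nome p → ∀ x : ℂ, x ≠ 0 → ContinuousAt (theta p) x := fun p _ x hx =>
      (differentiableAt_theta hx).continuousAt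
    have hΓ : ∀ x : ℂ, x ≠ 0 → ‖x‖ < 1 → ContinuousAt (fun x => ellGamma x p q) x :=
      fun x h1 h2 => (differentiableAt_ellGamma_of_norm_lt_one h1 h2).continuousAt
    refine ((continuousOn_xiMon hk).comp hc2 hm2).mul
      (((continuousOn_xiMon hl).comp hc2 hm2).mul ?_)
    refine (continuousOn_finsetProd _ fun r _ => ?_).mul
      (ContinuousOn.mul (fun x hx => ?_) (fun x hx => ?_))
    · refine ContinuousOn.mul (fun x hx => ?_) (fun x hx => ?_)
      · obtain ⟨h0, h1⟩ := hs x.1 hx.1 r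
        exact (hΓ _ (mul_ne_zero h0 (hz0 x hx))
          (by rwa [norm_mul, hz x hx, mul_one])).comp_continuousWithinAt
          (f := fun x : ℂ × ℂ => T x.1 r * x.2)
          (((hTc r).mul hc2) x hx)
      · obtain ⟨h0, h1⟩ := hs x.1 hx.1 r
        exact (hΓ _ (div_ne_zero h0 (hz0 x hx))
          (by rwa [norm_div, hz x hx, div_one])).comp_continuousWithinAt
          (f := fun x : ℂ × ℂ => T x.1 r / x.2)
          (((hTc r).div hc2 hz0) x hx)
    · exact (hth p ‹_› _ (pow_ne_zero 2 (hz0 x hx))).comp_continuousWithinAt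
        (f := fun x : ℂ × ℂ => x.2 ^ 2) ((hc2.pow 2) x hx)
    · exact (hth q ‹_› _ (inv_ne_zero (pow_ne_zero 2 (hz0 x hx)))).comp_continuousWithinAt
        (f := fun x : ℂ × ℂ => (x.2 ^ 2)⁻¹)
        (((hc2.pow 2).inv₀ fun x hx => pow_ne_zero 2 (hz0 x hx)) x hx)
  · have hz0 := ne_zero_of_norm_eq_one hz
    refine (DifferentiableOn.mul_const ?_ _).const_mul _ |>.const_mul _
    refine DifferentiableOn.fun_finsetProd fun r _ => DifferentiableOn.mul (fun w hw => ?_)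
      (fun w hw => ?_)
    · obtain ⟨h0, h1⟩ := hs w hw r
      exact (differentiableAt_ellGamma_of_norm_lt_one (mul_ne_zero h0 hz0)
        (by rwa [norm_mul, hz, mul_one])).comp_differentiableWithinAt (f := fun w => T w r * z) w
        ((hT r w hw).mul_const z)
    · obtain ⟨h0, h1⟩ := hs w hw r
      exact (differentiableAt_ellGamma_of_norm_lt_one (div_ne_zero h0 hz0)
        (by rwa [norm_div, hz, div_one])).comp_differentiableWithinAt (f := fun w => T w r / z) w
        ((hT r w hw).div_const z)

lemma differentiableOn_momentDet [Fintype ι] (hV : IsOpen V)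
    (hT : ∀ r, DifferentiableOn ℂ (fun w => T w r) V) (hs : ∀ w ∈ V, IsSmall (T w)) (n : ℕ) :
    DifferentiableOn ℂ (fun w => momentDet p q (T w) n) V := by
  simp only [momentDet, Matrix.det_apply']
  refine DifferentiableOn.fun_sum fun σ _ => DifferentiableOn.const_mul ?_ _
  exact DifferentiableOn.fun_finsetProd fun i _ => differentiableOn_moment hV hT hs
    (by have := (σ i).2; omega) (by have := i.2; omega)

lemma differentiableOn_gammaProd {m : ℕ} {T : ℂ → Fin m → ℂ}
    (hT : ∀ r, DifferentiableOn ℂ (fun w => T w r) V) (hs : ∀ w ∈ V, IsSmall (T w)) :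
    DifferentiableOn ℂ (fun w => gammaProd p q (T w)) V := by
  refine DifferentiableOn.fun_finsetProd fun r _ => DifferentiableOn.fun_finsetProd fun s _ => ?_
  split_ifs
  · intro w hw
    exact (differentiableAt_ellGamma_of_norm_lt_one (mul_ne_zero (hs w hw r).1 (hs w hw s).1)
      (by rw [norm_mul]; exact mul_lt_one_of_nonneg_of_lt_one_left (norm_nonneg _) (hs w hw r).2
            (hs w hw s).2.le)).comp_differentiableWithinAt
      (f := fun w => T w r * T w s) w ((hT r w hw).mul (hT s w hw))
  · exact differentiableOn_const 1

lemma gammaProd_ne_zero {m : ℕ} {t : Fin (m + 3) → ℂ} (ht : IsSmall t) (hp : ∏ r, t r = p * q) :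
    gammaProd p q t ≠ 0 := by
  refine Finset.prod_ne_zero_iff.2 fun r _ => Finset.prod_ne_zero_iff.2 fun s _ => ?_
  split_ifs with hrs
  · refine ellGamma_ne_zero ?_ ?_
    · rw [← hp, ← Finset.mul_prod_erase _ _ (Finset.mem_univ r),
        ← Finset.mul_prod_erase _ _ (Finset.mem_erase.2 ⟨hrs.ne', Finset.mem_univ s⟩), ← mul_assoc,
        norm_mul]
      refine mul_lt_of_lt_one_right (norm_pos_iff.2 (mul_ne_zero (ht r).1 (ht s).1)) ?_
      rw [norm_prod]
      refine (Finset.prod_lt_prod_of_nonempty (g := fun _ => (1 : ℝ))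
        (fun i _ => norm_pos_iff.2 (ht i).1) (fun i _ => (ht i).2) ?_).trans_eq (by simp)
      rw [← Finset.card_pos, Finset.card_erase_of_mem, Finset.card_erase_of_mem]
      · simp
      · simp
      · simp [hrs.ne']
    · rw [norm_mul]
      exact mul_lt_one_of_nonneg_of_lt_one_left (norm_nonneg _) (ht r).2 (ht s).2.le
  · exact one_ne_zero

end Parametric

section Constancy

open Metric

/-- A holomorphic function on an annulus which is invariant under multiplication by `q` is
constant. -/
lemma eq_of_nome_mul_invariant {q : ℂ} [Nome q] {β : ℝ} (hβ : 0 ≤ β) {g : ℂ → ℂ}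
    (hg : ∀ w : ℂ, ‖q‖ * β < ‖w‖ → ‖w‖ < 1 → DifferentiableAt ℂ g w)
    (hq : ∀ w : ℂ, β < ‖w‖ → ‖w‖ < 1 → g (q * w) = g w)
    {v w : ℂ} (hv : β < ‖v‖) (hv' : ‖v‖ < 1) (hw : β < ‖w‖) (hw' : ‖w‖ < 1) : g v = g w := by
  have hq0 := Nome.ne_zero (p := q)
  have hq1 := Nome.norm_lt_one (p := q)
  have hqn : 0 < ‖q‖ := norm_pos_iff.2 hq0
  have hdiff : ∀ c : ℂ, ‖c‖ < 1 → ∀ z : ℂ, ‖q‖ * β < ‖c * z‖ → ‖z‖ ≤ 1 →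
      DifferentiableAt ℂ (fun z => g (c * z)) z := fun c hc z hz hz1 =>
    (hg (c * z) hz (by
      rw [norm_mul]; exact mul_lt_one_of_nonneg_of_lt_one_left (norm_nonneg _) hc hz1)).comp z
      (by fun_prop)
  have key : ∀ c : ℂ, β < ‖c‖ → ‖c‖ < 1 → g c = mean fun z => g (c * z) := fun c hc hc1 => by
    set A := mean fun z => g (c * z)
    have hd : ∀ z : ℂ, ‖q‖ ≤ ‖z‖ → ‖z‖ ≤ 1 → DifferentiableAt ℂ (fun z => g (c * z) - A) z :=
      fun z hz hz1 => (hdiff c hc1 z (by rw [norm_mul]; nlinarith) hz1).sub_const A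
    have hcont : ContinuousOn (fun z => g (c * z) - A) (sphere 0 1) := fun z hz => by
      have hz : ‖z‖ = 1 := by simpa using hz
      exact (hd z (by rw [hz]; exact hq1.le) hz.le).continuousAt.continuousWithinAt
    have h := eq_zero_of_mean_zpow_mul hcont fun k => ?_
    · simpa [sub_eq_zero] using h
    rcases eq_or_ne k 0 with rfl | hk
    · have hcg : ContinuousOn (fun z => g (c * z)) (sphere 0 1) :=
        (hcont.add (continuousOn_const (c := A))).congr fun z _ => (sub_add_cancel _ _).symm
      simp only [neg_zero, zpow_zero, one_mul]
      rw [mean_sub hcg continuousOn_const]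
      simp [A, mean, Real.circleAverage_const]
    · have hz0 : ∀ z : ℂ, ‖q‖ ≤ ‖z‖ → z ≠ 0 := fun z hz => norm_pos_iff.1 (hqn.trans_le hz)
      have hd' : ∀ z : ℂ, ‖q‖ ≤ ‖z‖ → ‖z‖ ≤ 1 →
          DifferentiableAt ℂ (fun z => z ^ (-k) * (g (c * z) - A)) z := fun z hz hz1 =>
        (differentiableAt_zpow.2 (Or.inl (hz0 z hz))).mul (hd z hz hz1)
      have h1 := mean_comp_const_mul (f := fun z => z ^ (-k) * (g (c * z) - A)) hq0 hq1.le
        Set.countable_empty (fun z hz => ?_) (fun z hz => ?_)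
      · have h2 : mean (fun z => (q * z) ^ (-k) * (g (c * (q * z)) - A)) =
            q ^ (-k) * mean fun z => z ^ (-k) * (g (c * z) - A) := by
          rw [← mean_const_mul]
          refine mean_congr fun z hz => ?_
          rw [mul_left_comm c, hq (c * z) (by rwa [norm_mul, hz, mul_one])
            (by rwa [norm_mul, hz, mul_one]), mul_zpow, mul_assoc]
        rw [h2] at h1
        have h3 : q ^ (-k) ≠ 1 := fun h => by
          have := congrArg norm h
          rw [norm_zpow, norm_one, zpow_eq_one_iff_right₀ hqn.le hq1.ne] at this
          omega
        by_contra h4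
        exact h3 (mul_right_cancel₀ h4 (h1.trans (one_mul _).symm))
      · simp only [Set.mem_sdiff, mem_closedBall_zero_iff, mem_ball_zero_iff, not_lt] at hz
        exact (hd' z hz.2 hz.1).continuousAt.continuousWithinAt
      · simp only [Set.mem_sdiff, mem_closedBall_zero_iff, mem_ball_zero_iff, not_le] at hz
        exact hd' z hz.1.2.le hz.1.1.le
  wlog hvw : ‖v‖ ≤ ‖w‖ generalizing v w
  · exact (this hw hw' hv hv' (le_of_not_ge hvw)).symm
  have hv0 : v ≠ 0 := norm_pos_iff.1 (hβ.trans_lt hv)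
  have hw0 : w ≠ 0 := norm_pos_iff.1 (hβ.trans_lt hw)
  have hn : ‖v / w‖ ≤ 1 := by rw [norm_div]; exact div_le_one_of_le₀ hvw (norm_nonneg _)
  have hd : ∀ z : ℂ, ‖v / w‖ ≤ ‖z‖ → ‖z‖ ≤ 1 → DifferentiableAt ℂ (fun z => g (w * z)) z :=
    fun z hz hz1 => hdiff w hw' z (by
      rw [norm_div, div_le_iff₀ (hβ.trans_lt hw)] at hz
      rw [norm_mul]
      nlinarith) hz1
  have h1 := mean_comp_const_mul (f := fun z => g (w * z)) (div_ne_zero hv0 hw0) hn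
    Set.countable_empty (fun z hz => ?_) (fun z hz => ?_)
  · rw [key v hv hv', key w hw hw', ← h1]
    refine congrArg mean (funext fun z => ?_)
    rw [← mul_assoc, mul_div_cancel₀ _ hw0]
  · simp only [Set.mem_sdiff, mem_closedBall_zero_iff, mem_ball_zero_iff, not_lt] at hz
    exact (hd z hz.2 hz.1).continuousAt.continuousWithinAt
  · simp only [Set.mem_sdiff, mem_closedBall_zero_iff, mem_ball_zero_iff, not_le] at hz
    exact hd z hz.1.2.le hz.1.1.le

/-- Continuous functions on an open set which agree off a countable set are equal. -/
lemma eqOn_of_countable {U s : Set ℂ} (hU : IsOpen U) (hs : s.Countable) {f g : ℂ → ℂ}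
    (hf : ContinuousOn f U) (hg : ContinuousOn g U) (h : ∀ z ∈ U, z ∉ s → f z = g z) :
    Set.EqOn f g U :=
  Set.EqOn.of_subset_closure (s := U ∩ sᶜ) (fun z hz => h z hz.1 hz.2) hf hg Set.inter_subset_left
    ((hs.dense_compl ℝ).open_subset_closure_inter hU)

variable {p q : ℂ} [Nome p] [Nome q]

lemma countable_theta_sq_or_xi₁_eq_zero :
    {x : ℂ | theta p (x ^ 2) = 0 ∨ xi₁ p x = 0}.Countable := by
  have h := countable_theta_eq_zero (p := p)
  have h1 : {x : ℂ | theta p (x ^ 2) = 0}.Countable := by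
    refine (h.biUnion (t := fun y _ => {x : ℂ | x ^ 2 = y}) fun y _ => ?_).mono fun x hx => ?_
    · refine (((Polynomial.nthRootsFinset 2 y).finite_toSet).subset fun x hx => ?_).countable
      simpa using hx
    · simpa using hx
  refine ((h1.union (h.preimage neg_injective)).union
    (h.preimage (inv_injective.comp neg_injective))).mono fun x hx => ?_
  rcases hx with hx | hx
  · exact Or.inl (Or.inl hx)
  · rw [xi₁, div_eq_zero_iff, xi₀, mul_eq_zero] at hx
    rcases hx with (hx | hx) | hx
    · exact Or.inl (Or.inr hx)
    · exact Or.inr hx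
    · exact absurd hx (pow_ne_zero 2 theta_neg_one_ne_zero)

/-- The quotient of the two sides of the determinantal evaluation. -/
noncomputable def momentRatio (p q : ℂ) (n : ℕ) (t : Fin (2 * n + 4) → ℂ) : ℂ :=
  momentDet p q t n / gammaProd p q t

variable {n : ℕ}

lemma differentiableOn_momentRatio {V : Set ℂ} (hV : IsOpen V) {T : ℂ → Fin (2 * n + 4) → ℂ}
    (hT : ∀ r, DifferentiableOn ℂ (fun w => T w r) V) (hs : ∀ w ∈ V, IsSmall (T w))
    (hp : ∀ w ∈ V, ∏ r, T w r = p * q) :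
    DifferentiableOn ℂ (fun w => momentRatio p q n (T w)) V :=
  (differentiableOn_momentDet hV hT hs n).div (differentiableOn_gammaProd hT hs)
    fun w hw => gammaProd_ne_zero (hs w hw) (hp w hw)

lemma prod_update_mul {ι : Type*} [Fintype ι] [DecidableEq ι] (t : ι → ℂ) (j : ι) (x : ℂ) :
    (∏ r, Function.update t j x r) * t j = x * ∏ r, t r := by
  rw [Finset.prod_update_of_mem (Finset.mem_univ j),
    ← Finset.mul_prod_erase Finset.univ t (Finset.mem_univ j), Finset.sdiff_singleton_eq_erase]
  ring

/-- The parameters obtained from `t` by changing the `j`-th one to `w`, with the `i`-th one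
adjusted to keep the product. -/
noncomputable def pencil (t : Fin (2 * n + 4) → ℂ) (i j : Fin (2 * n + 4)) (b w : ℂ) :
    Fin (2 * n + 4) → ℂ :=
  Function.update (Function.update t j w) i (b / w)

lemma isSmall_pencil {t : Fin (2 * n + 4) → ℂ} (ht : IsSmall t) (i j : Fin (2 * n + 4)) {b w : ℂ}
    (hb : b ≠ 0) (hbw : ‖b‖ < ‖w‖) (hw : ‖w‖ < 1) : IsSmall (pencil t i j b w) := by
  have hw0 : 0 < ‖w‖ := (norm_nonneg b).trans_lt hbw
  have hw0' := norm_pos_iff.1 hw0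
  intro r
  rw [pencil]
  rcases eq_or_ne r i with rfl | hr
  · rw [Function.update_self]
    exact ⟨div_ne_zero hb hw0', by rwa [norm_div, div_lt_one hw0]⟩
  rw [Function.update_of_ne hr]
  rcases eq_or_ne r j with rfl | hr
  · rw [Function.update_self]
    exact ⟨hw0', hw⟩
  · rw [Function.update_of_ne hr]
    exact ht r

lemma prod_pencil {t : Fin (2 * n + 4) → ℂ} {i j : Fin (2 * n + 4)} (hij : i ≠ j)
    {b w : ℂ} (hw : w ≠ 0) : (∏ r, pencil t i j b w r) * (t i * t j) = b * ∏ r, t r := by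
  have h1 := prod_update_mul (Function.update t j w) i (b / w)
  rw [Function.update_of_ne hij] at h1
  have h2 := prod_update_mul t j w
  rw [pencil, ← mul_assoc, h1, mul_assoc, h2]
  field_simp

lemma momentRatio_pencil_nome_mul {t : Fin (2 * n + 4) → ℂ} (ht : IsSmall t)
    (hp : ∏ r, t r = p * q) {i j : Fin (2 * n + 4)} (hij : i ≠ j) {w : ℂ}
    (hw : ‖t i * t j‖ < ‖q‖ * ‖w‖) (hw' : ‖w‖ < 1)
    (h1 : ¬ (theta p (w ^ 2) = 0 ∨ xi₁ p w = 0))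
    (h2 : ¬ (theta p ((t i * t j / q / w) ^ 2) = 0 ∨ xi₁ p (t i * t j / q / w) = 0)) :
    momentRatio p q n (pencil t i j (t i * t j) (q * w)) =
      momentRatio p q n (pencil t i j (t i * t j) w) := by
  have hq0 := Nome.ne_zero (p := q)
  have hqn : 0 < ‖q‖ := norm_pos_iff.2 hq0
  have hb : t i * t j ≠ 0 := mul_ne_zero (ht i).1 (ht j).1
  have hw0 : w ≠ 0 := by
    rintro rfl
    rw [norm_zero, mul_zero] at hw
    exact (norm_nonneg _).not_gt hw
  have hs := isSmall_pencil ht i j (b := t i * t j / q) (w := w) (div_ne_zero hb hq0)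
    (by rwa [norm_div, div_lt_iff₀' hqn]) hw'
  have hsp : ∏ r, pencil t i j (t i * t j / q) w r = p := by
    have h := prod_pencil (t := t) hij (b := t i * t j / q) hw0
    rw [hp] at h
    refine mul_right_cancel₀ hb (h.trans ?_)
    field_simp
  have e1 : pencil t i j (t i * t j / q) w i = t i * t j / q / w := Function.update_self ..
  have e2 : pencil t i j (t i * t j / q) w j = w := by
    rw [pencil, Function.update_of_ne hij.symm, Function.update_self]
  have h := momentDet_mul_gammaProd_shift (q := q) hs hsp i j (by rw [e1]; tauto)
    (by rw [e1]; tauto) (by rw [e2]; tauto) (by rw [e2]; tauto)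
  have e3 : Function.update (pencil t i j (t i * t j / q) w) j (q * w) =
      pencil t i j (t i * t j) (q * w) := by
    rw [pencil, pencil, Function.update_comm hij.symm, Function.update_idem, div_div,
      Function.update_comm hij.symm]
  have e4 : Function.update (pencil t i j (t i * t j / q) w) i (q * (t i * t j / q / w)) =
      pencil t i j (t i * t j) w := by
    rw [pencil, pencil, Function.update_idem]
    congr 1
    field_simp
  rw [e1, e2, e3, e4] at h
  have hP : ∀ v : ℂ, ‖t i * t j‖ < ‖v‖ → ‖v‖ < 1 →
      gammaProd p q (pencil t i j (t i * t j) v) ≠ 0 := fun v hv hv' => by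
    refine gammaProd_ne_zero (isSmall_pencil ht i j hb hv hv') ?_
    have h := prod_pencil (t := t) hij (b := t i * t j)
      (norm_pos_iff.1 ((norm_nonneg _).trans_lt hv))
    rw [mul_comm] at h
    rw [mul_left_cancel₀ hb h, hp]
  have hqw : ‖q‖ * ‖w‖ < ‖w‖ := by
    have := Nome.norm_lt_one (p := q)
    have := norm_pos_iff.2 hw0
    nlinarith
  rw [momentRatio, momentRatio, div_eq_div_iff (hP _ (by rwa [norm_mul q])
    (by rw [norm_mul]; exact hqw.trans hw')) (hP w (hw.trans hqw) hw'), h]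

lemma momentRatio_pencil {t : Fin (2 * n + 4) → ℂ} (ht : IsSmall t)
    (hp : ∏ r, t r = p * q) {i j : Fin (2 * n + 4)} (hij : i ≠ j) (hi : ‖t i‖ < ‖q‖) {w : ℂ}
    (hw : ‖t i * t j‖ < ‖q‖ * ‖w‖) (hw' : ‖w‖ < 1) :
    momentRatio p q n (pencil t i j (t i * t j) w) = momentRatio p q n t := by
  have hq0 := Nome.ne_zero (p := q)
  have hqn : 0 < ‖q‖ := norm_pos_iff.2 hq0
  have hb : t i * t j ≠ 0 := mul_ne_zero (ht i).1 (ht j).1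
  have hprod : ∀ v : ℂ, v ≠ 0 → ∏ r, pencil t i j (t i * t j) v r = p * q := fun v hv => by
    have h := prod_pencil (t := t) hij (b := t i * t j) hv
    rw [mul_comm] at h
    rw [mul_left_cancel₀ hb h, hp]
  have hann : ∀ β : ℝ, IsOpen {v : ℂ | β < ‖v‖ ∧ ‖v‖ < 1} := fun β =>
    (isOpen_lt continuous_const continuous_norm).inter (isOpen_lt continuous_norm continuous_const)
  have hd : DifferentiableOn ℂ (fun v => momentRatio p q n (pencil t i j (t i * t j) v))
      {v : ℂ | ‖t i * t j‖ < ‖v‖ ∧ ‖v‖ < 1} := by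
    have hne : ∀ v : ℂ, ‖t i * t j‖ < ‖v‖ → v ≠ 0 := fun v hv =>
      norm_pos_iff.1 ((norm_nonneg _).trans_lt hv)
    refine differentiableOn_momentRatio (hann _) (fun r => ?_)
      (fun v hv => isSmall_pencil ht i j hb hv.1 hv.2) (fun v hv => hprod v (hne v hv.1))
    simp only [pencil, Function.update_apply]
    split_ifs
    · exact DifferentiableOn.div (by fun_prop) (by fun_prop) fun v hv => hne v hv.1
    · fun_prop
    · fun_prop
  have e : pencil t i j (t i * t j) (t j) = t := by
    rw [pencil, Function.update_eq_self, mul_div_cancel_right₀ _ (ht j).1,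
      Function.update_eq_self]
  conv_rhs => rw [← e]
  have hβ : ‖q‖ * (‖t i * t j‖ / ‖q‖) = ‖t i * t j‖ := mul_div_cancel₀ _ hqn.ne'
  refine eq_of_nome_mul_invariant (q := q) (β := ‖t i * t j‖ / ‖q‖)
    (g := fun v => momentRatio p q n (pencil t i j (t i * t j) v)) (by positivity)
    (fun v hv hv' => ?_) (fun v hv hv' => ?_) ?_ hw' ?_ (ht j).2
  · rw [hβ] at hv
    exact hd.differentiableAt ((hann _).mem_nhds ⟨hv, hv'⟩)
  · have hmul : ∀ v ∈ {v : ℂ | ‖t i * t j‖ / ‖q‖ < ‖v‖ ∧ ‖v‖ < 1}, ‖t i * t j‖ < ‖q‖ * ‖v‖ :=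
      fun v hv => (div_lt_iff₀' hqn).1 hv.1
    have hle : ∀ v : ℂ, ‖q‖ * ‖v‖ ≤ ‖v‖ := fun v =>
      mul_le_of_le_one_left (norm_nonneg _) Nome.norm_lt_one.le
    have hS := countable_theta_sq_or_xi₁_eq_zero (p := p)
    refine eqOn_of_countable (hann _) (hS.union (hS.image fun v => t i * t j / q / v))
      (f := fun v => momentRatio p q n (pencil t i j (t i * t j) (q * v))) ?_
      (hd.continuousOn.mono fun v hv => ⟨(hmul v hv).trans_le (hle v), hv.2⟩)
      (fun v hv hvS => ?_) ⟨hv, hv'⟩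
    · refine hd.continuousOn.comp (f := fun v => q * v) (by fun_prop) fun v hv => ⟨?_, ?_⟩
      · rw [norm_mul q]
        exact hmul v hv
      · rw [norm_mul]
        exact (hle v).trans_lt hv.2
    · rw [Set.mem_union, not_or] at hvS
      refine momentRatio_pencil_nome_mul ht hp hij (hmul v hv) hv.2 hvS.1 fun h => hvS.2
        ⟨_, h, ?_⟩
      have hv0 : v ≠ 0 := norm_pos_iff.1 (lt_of_le_of_lt (by positivity) hv.1)
      have := (ht i).1
      have := (ht j).1
      field_simp
  · rwa [div_lt_iff₀' hqn]
  · rw [div_lt_iff₀' hqn, norm_mul]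
    exact mul_lt_mul_of_pos_right hi (norm_pos_iff.2 (ht j).1)

end Constancy

section Constancy

variable {p q : ℂ} [Nome p] [Nome q] {n : ℕ}

lemma norm_zero_lt_norm_nome {ρ : ℝ} (hρ : 0 < ρ) (hpρ : ‖p‖ ≤ ρ ^ (2 * n + 3))
    {t : Fin (2 * n + 4) → ℂ} (hp : ∏ r, t r = p * q) (hb : ∀ s ≠ 0, ρ < ‖t s‖) :
    ‖t 0‖ < ‖q‖ := by
  have hq : 0 < ‖q‖ := norm_pos_iff.2 Nome.ne_zero
  have hp0 : 0 < ‖p‖ := norm_pos_iff.2 Nome.ne_zero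
  have h := congrArg norm hp
  rw [Fin.prod_univ_succ, norm_mul, norm_mul, norm_prod] at h
  have h1 : ρ ^ (2 * n + 3) < ∏ s : Fin (2 * n + 3), ‖t s.succ‖ := by
    have := Finset.prod_lt_prod_of_nonempty (s := Finset.univ) (f := fun _ : Fin (2 * n + 3) => ρ)
      (g := fun s => ‖t s.succ‖) (fun _ _ => hρ) (fun s _ => hb _ s.succ_ne_zero)
      Finset.univ_nonempty
    simpa using this
  have h2 : 0 < ‖t 0‖ := by
    refine lt_of_le_of_ne (norm_nonneg _) fun h0 => ?_
    rw [← h0, zero_mul] at h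
    exact (mul_pos hp0 hq).ne h
  have h3 := hpρ.trans_lt h1
  nlinarith

lemma momentRatio_eq_of_box {ρ : ℝ} (hρ : 0 < ρ) (hpρ : ‖p‖ ≤ ρ ^ (2 * n + 3))
    {t t' : Fin (2 * n + 4) → ℂ} (ht : IsSmall t) (hp : ∏ r, t r = p * q)
    (hb : ∀ s ≠ 0, ρ < ‖t s‖) (ht' : IsSmall t') (hp' : ∏ r, t' r = p * q)
    (hb' : ∀ s ≠ 0, ρ < ‖t' s‖) : momentRatio p q n t = momentRatio p q n t' := by
  suffices key : ∀ S : Finset (Fin (2 * n + 4)), 0 ∉ S → ∀ t, IsSmall t → ∏ r, t r = p * q →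
      (∀ s ≠ 0, ρ < ‖t s‖) → (∀ s ≠ 0, s ∉ S → t s = t' s) →
      momentRatio p q n t = momentRatio p q n t' from
    key (Finset.univ.erase 0) (Finset.notMem_erase _ _) t ht hp hb fun s hs hs' => by simp_all
  intro S
  induction S using Finset.induction_on with
  | empty =>
    intro _ t ht hp _ he
    congr 1
    have h := hp.trans hp'.symm
    rw [Fin.prod_univ_succ, Fin.prod_univ_succ t', Finset.prod_congr rfl fun s _ =>
      he s.succ s.succ_ne_zero (Finset.notMem_empty _)] at h
    have h0 := mul_right_cancel₀ (Finset.prod_ne_zero_iff.2 fun s _ => (ht' s.succ).1) h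
    funext s
    rcases eq_or_ne s 0 with rfl | hs
    · exact h0
    · exact he s hs (Finset.notMem_empty _)
  | insert j S hj ih =>
    intro h0 t ht hp hb he
    rw [Finset.mem_insert, not_or] at h0
    have hj0 : (0 : Fin (2 * n + 4)) ≠ j := h0.1
    have hb0 : t 0 * t j ≠ 0 := mul_ne_zero (ht 0).1 (ht j).1
    have hq : 0 < ‖q‖ := norm_pos_iff.2 Nome.ne_zero
    have hq1 : ‖q‖ < 1 := Nome.norm_lt_one
    have hpos : 0 < ‖t' j‖ := norm_pos_iff.2 (ht' j).1
    have hprod : ∏ r, pencil t 0 j (t 0 * t j) (t' j) r = p * q := by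
      have h := prod_pencil (t := t) hj0 (b := t 0 * t j) (ht' j).1
      rw [mul_comm] at h
      rw [mul_left_cancel₀ hb0 h, hp]
    have hval : ∀ s ≠ 0, s ≠ j → pencil t 0 j (t 0 * t j) (t' j) s = t s := fun s hs hsj => by
      rw [pencil, Function.update_of_ne hs, Function.update_of_ne hsj]
    have hvalj : pencil t 0 j (t 0 * t j) (t' j) j = t' j := by
      rw [pencil, Function.update_of_ne hj0.symm, Function.update_self]
    have hbox : ∀ s ≠ 0, ρ < ‖pencil t 0 j (t 0 * t j) (t' j) s‖ := fun s hs => by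
      rcases eq_or_ne s j with rfl | hsj
      · rw [hvalj]
        exact hb' s hs
      · rw [hval s hs hsj]
        exact hb s hs
    have hlt := norm_zero_lt_norm_nome hρ hpρ hprod hbox
    rw [pencil, Function.update_self, norm_div, div_lt_iff₀ hpos] at hlt
    rw [← momentRatio_pencil ht hp hj0 (norm_zero_lt_norm_nome hρ hpρ hp hb) hlt (ht' j).2]
    refine ih h0.2 _ (isSmall_pencil ht 0 j hb0 (hlt.trans ?_) (ht' j).2) hprod hbox
      fun s hs hsS => ?_
    · exact mul_lt_of_lt_one_left hpos hq1
    · rcases eq_or_ne s j with rfl | hsj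
      · exact hvalj
      · rw [hval s hs hsj]
        exact he s hs (by simp [hsj, hsS])

/-- A point of the parameter domain with all but one coordinate equal to `σ`. -/
noncomputable def basePoint (p q : ℂ) (σ : ℝ) : Fin (2 * n + 4) → ℂ :=
  Fin.cons (p * q / σ ^ (2 * n + 3)) fun _ => (σ : ℂ)

lemma exists_momentRatio_eq_basePoint : ∃ σ : ℝ, ∀ t : Fin (2 * n + 4) → ℂ, IsSmall t →
    ∏ r, t r = p * q → momentRatio p q n t = momentRatio p q n (basePoint p q σ) := by
  have hp0 : 0 < ‖p‖ := norm_pos_iff.2 Nome.ne_zero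
  have hp1 : ‖p‖ < 1 := Nome.norm_lt_one
  have hq0 : 0 < ‖q‖ := norm_pos_iff.2 Nome.ne_zero
  have hq1 : ‖q‖ < 1 := Nome.norm_lt_one
  obtain ⟨σ, hσ0, hσ1, hσ⟩ : ∃ σ : ℝ, 0 < σ ∧ σ < 1 ∧ σ ^ (2 * (2 * n + 3)) = ‖p‖ :=
    ⟨‖p‖ ^ (((2 * (2 * n + 3) : ℕ) : ℝ)⁻¹), Real.rpow_pos_of_pos hp0 _,
      Real.rpow_lt_one hp0.le hp1 (by positivity),
      Real.rpow_inv_natCast_pow hp0.le (by positivity)⟩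
  have hσ' : 0 < σ ^ (2 * n + 3) := by positivity
  have hσp : ‖p‖ < σ ^ (2 * n + 3) := by
    rw [← hσ, mul_comm, pow_mul]
    exact pow_lt_self_of_lt_one₀ hσ' (pow_lt_one₀ hσ0.le hσ1 (by omega)) (by norm_num)
  refine ⟨σ, fun t ht hp => ?_⟩
  set x : Fin (2 * n + 4) → ℂ := Fin.cons (∑ r, Complex.log (t r) - (2 * n + 3) * Real.log σ)
    fun _ => (Real.log σ : ℂ) with hx
  have hexpσ : Complex.exp (Real.log σ) = σ := by
    rw [← Complex.ofReal_exp, Real.exp_log hσ0]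
  have hexp : ∀ r, Complex.exp (x r) = basePoint p q σ r := by
    refine Fin.cases ?_ fun s => ?_
    · simp only [hx, Fin.cons_zero, basePoint]
      rw [Complex.exp_sub, Complex.exp_sum, Finset.prod_congr rfl fun r _ =>
        Complex.exp_log (ht r).1, hp, ← hexpσ, ← Complex.exp_nat_mul]
      push_cast
      rfl
    · simpa only [hx, Fin.cons_succ, basePoint] using hexpσ
  have hsum : ∑ r, x r = ∑ r, Complex.log (t r) := by
    rw [Fin.sum_univ_succ]
    simp [hx]
  have hxneg : ∀ r, (x r).re < 0 := fun r => by
    rw [← Real.exp_lt_one_iff, ← Complex.norm_exp, hexp]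
    revert r
    refine Fin.cases ?_ fun s => ?_
    · simp only [basePoint, Fin.cons_zero]
      rw [norm_div, norm_mul, norm_pow, Complex.norm_real, Real.norm_of_nonneg hσ0.le,
        div_lt_one hσ']
      nlinarith
    · simpa [basePoint, abs_of_pos hσ0] using hσ1
  set T : ℂ → Fin (2 * n + 4) → ℂ := fun w r =>
    Complex.exp (x r + w * (Complex.log (t r) - x r)) with hT
  have hT0 : T 0 = basePoint p q σ := funext fun r => by simp [hT, hexp]
  have hT1 : T 1 = t := funext fun r => by simp [hT, Complex.exp_log (ht r).1]
  set V : Set ℂ := {w | ∀ r, (x r + w * (Complex.log (t r) - x r)).re < 0} with hVdef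
  have hVo : IsOpen V := by
    simp only [hVdef, Set.ofPred_forall]
    exact isOpen_iInter_of_finite fun r => isOpen_lt (by fun_prop) continuous_const
  have hVc : Convex ℝ V := by
    intro v hv w hw a b ha hb hab r
    have h1 := hv r
    have h2 := hw r
    have e : x r + (a • v + b • w) * (Complex.log (t r) - x r) =
        a * (x r + v * (Complex.log (t r) - x r)) + b * (x r + w * (Complex.log (t r) - x r)) := by
      have hab' : (a : ℂ) + b = 1 := by exact_mod_cast hab
      simp only [Complex.real_smul]
      linear_combination (-x r) * hab'
    rw [e, Complex.add_re, Complex.re_ofReal_mul, Complex.re_ofReal_mul]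
    rcases ha.eq_or_lt with rfl | ha
    · have : b = 1 := by linarith
      subst this
      linarith
    · nlinarith
  have hsmall : ∀ w ∈ V, IsSmall (T w) := fun w hw r =>
    ⟨Complex.exp_ne_zero _, by rw [Complex.norm_exp, Real.exp_lt_one_iff]; exact hw r⟩
  have hprod : ∀ w, ∏ r, T w r = p * q := fun w => by
    rw [← Complex.exp_sum, Finset.sum_add_distrib, ← Finset.mul_sum, Finset.sum_sub_distrib, hsum,
      sub_self, mul_zero, add_zero, Complex.exp_sum, ← hp]
    exact Finset.prod_congr rfl fun r _ => Complex.exp_log (ht r).1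
  have hTd : ∀ r, Differentiable ℂ fun w => T w r := fun r => by
    simp only [hT]
    fun_prop
  have hd : DifferentiableOn ℂ (fun w => momentRatio p q n (T w)) V :=
    differentiableOn_momentRatio hVo (fun r => (hTd r).differentiableOn) hsmall fun w _ => hprod w
  have h0V : (0 : ℂ) ∈ V := fun r => by simpa using hxneg r
  have h1V : (1 : ℂ) ∈ V := fun r => by
    rw [one_mul, add_sub_cancel, ← Real.exp_lt_one_iff, ← Complex.norm_exp,
      Complex.exp_log (ht r).1]
    exact (ht r).2
  have hρ : 0 < σ ^ 2 := by positivity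
  have hpρ : ‖p‖ ≤ (σ ^ 2) ^ (2 * n + 3) := by rw [← pow_mul, hσ]
  have hσσ : σ ^ 2 < σ := by nlinarith
  have hbase : ∀ s ≠ 0, σ ^ 2 < ‖T 0 s‖ := by
    rw [hT0]
    refine Fin.cases (fun h => absurd rfl h) fun s _ => ?_
    simpa [basePoint, abs_of_pos hσ0] using hσσ
  have hev : (fun w => momentRatio p q n (T w)) =ᶠ[𝓝 0] fun _ => momentRatio p q n (T 0) := by
    have hb : ∀ᶠ w in 𝓝 (0 : ℂ), ∀ s ≠ 0, σ ^ 2 < ‖T w s‖ := by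
      refine eventually_all.2 fun s => ?_
      rcases eq_or_ne s 0 with rfl | hs
      · simp
      · filter_upwards [(hTd s).continuous.norm.continuousAt.eventually_const_lt (hbase s hs)]
          with w hw _ using hw
    filter_upwards [hb, hVo.mem_nhds h0V] with w hw hwV
    exact momentRatio_eq_of_box hρ hpρ (hsmall w hwV) (hprod w) hw (hsmall 0 h0V) (hprod 0) hbase
  have := (hd.analyticOnNhd hVo).eqOn_of_preconnected_of_eventuallyEq
    (analyticOnNhd_const) hVc.isPreconnected h0V hev h1V
  rw [← hT0]
  exact (congrArg _ hT1.symm).trans this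

/-- The quotient of the two sides of the determinantal evaluation is constant. -/
lemma momentRatio_eq {t t' : Fin (2 * n + 4) → ℂ} (ht : IsSmall t) (hp : ∏ r, t r = p * q)
    (ht' : IsSmall t') (hp' : ∏ r, t' r = p * q) : momentRatio p q n t = momentRatio p q n t' := by
  obtain ⟨σ, h⟩ := exists_momentRatio_eq_basePoint (p := p) (q := q) (n := n)
  rw [h t ht hp, h t' ht' hp']

end Constancy

section Residue

open Metric

lemma mean_eq_apply_zero {f : ℂ → ℂ} (hf : ∀ z, ‖z‖ ≤ 1 → DifferentiableAt ℂ f z) :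
    mean f = f 0 := by
  rw [mean, DiffContOnCl.circleAverage]
  refine DifferentiableOn.diffContOnCl fun z hz => (hf z ?_).differentiableWithinAt
  rw [abs_one, closure_ball _ one_ne_zero] at hz
  simpa using hz

/-- The residue theorem for an annulus and one simple pole. -/
lemma mean_eq_add_of_simple_pole {c a : ℂ} (hc : c ≠ 0) (hca : ‖c‖ < ‖a‖) (ha : ‖a‖ < 1)
    {G : ℂ → ℂ} (hG : ∀ z, ‖c‖ ≤ ‖z‖ → ‖z‖ ≤ 1 → DifferentiableAt ℂ G z) :
    mean (fun z => G z * (z / (z - a))) =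
      mean (fun z => G (c * z) * (c * z / (c * z - a))) + G a := by
  have hc1 : ‖c‖ < 1 := hca.trans ha
  have hcn : 0 < ‖c‖ := norm_pos_iff.2 hc
  have ha0 : a ≠ 0 := norm_pos_iff.1 (hcn.trans hca)
  set S : Set ℂ := closedBall 0 1 \ ball 0 ‖c‖ with hS
  have hmem : ∀ z, z ∈ S ↔ ‖z‖ ≤ 1 ∧ ‖c‖ ≤ ‖z‖ := fun z => by simp [hS]
  have hSa : S ∈ 𝓝 a := by
    have h1 : IsOpen {z : ℂ | ‖c‖ < ‖z‖ ∧ ‖z‖ < 1} :=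
      (isOpen_lt continuous_const continuous_norm).inter
        (isOpen_lt continuous_norm continuous_const)
    exact Filter.mem_of_superset (h1.mem_nhds ⟨hca, ha⟩) fun z hz => (hmem z).2 ⟨hz.2.le, hz.1.le⟩
  have hds : ContinuousOn (fun z => dslope G a z * z) S :=
    ((continuousOn_dslope hSa).2 ⟨fun z hz => (hG z ((hmem z).1 hz).2
      ((hmem z).1 hz).1).continuousAt.continuousWithinAt, hG a hca.le ha.le⟩).mul continuousOn_id
  have h1 := mean_comp_const_mul (f := fun z => dslope G a z * z) hc hc1.le
    (Set.countable_singleton a) hds fun z hz => by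
      simp only [Set.mem_sdiff, mem_closedBall_zero_iff, mem_ball_zero_iff, not_le,
        Set.mem_singleton_iff] at hz
      exact ((differentiableAt_dslope_of_ne hz.2).2 (hG z hz.1.2.le hz.1.1.le)).mul
        differentiableAt_id
  have hsphere : sphere (0 : ℂ) 1 ⊆ S := fun z hz => by
    have hz : ‖z‖ = 1 := by simpa using hz
    exact (hmem z).2 ⟨hz.le, hz ▸ hc1.le⟩
  have hmaps : Set.MapsTo (fun z => c * z) (sphere (0 : ℂ) 1) S := fun z hz => by
    have hz : ‖z‖ = 1 := by simpa using hz
    exact (hmem _).2 ⟨by rw [norm_mul, hz, mul_one]; exact hc1.le, by rw [norm_mul, hz, mul_one]⟩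
  have hne1 : ∀ z : ℂ, ‖z‖ = 1 → z - a ≠ 0 := fun z hz h => by
    rw [sub_eq_zero] at h
    rw [← h, hz] at ha
    exact lt_irrefl _ ha
  have hnec : ∀ z : ℂ, ‖z‖ ≤ 1 → c * z - a ≠ 0 := fun z hz h => by
    rw [sub_eq_zero] at h
    rw [← h, norm_mul] at hca
    nlinarith
  have hsplit : ∀ z, z - a ≠ 0 → G z * (z / (z - a)) = dslope G a z * z + G a * (z / (z - a)) :=
    fun z hz => by
      rw [dslope_of_ne _ (sub_ne_zero.1 hz), slope_def_field]
      field_simp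
      ring
  have h2 : mean (fun z => z / (z - a)) = 1 := by
    have hne : ∀ z : ℂ, ‖z‖ ≤ 1 → 1 - a * z ≠ 0 := fun z hz h => by
      have := congrArg norm (sub_eq_zero.1 h)
      rw [norm_one, norm_mul] at this
      nlinarith [norm_nonneg a]
    rw [← mean_inv]
    rw [mean_congr (g := fun z => (1 - a * z)⁻¹) fun z hz => ?_, mean_eq_apply_zero fun z hz => ?_]
    · simp
    · exact DifferentiableAt.inv (by fun_prop) (hne z hz)
    · have hz0 := ne_zero_of_norm_eq_one hz
      have := hne z hz.le
      have : z⁻¹ - a ≠ 0 := hne1 _ (by simpa using hz)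
      field_simp
  have h3 : mean (fun z => c * z / (c * z - a)) = 0 := by
    rw [mean_eq_apply_zero fun z hz => ?_]
    · simp
    · exact DifferentiableAt.div (by fun_prop) (by fun_prop) (hnec z hz)
  rw [mean_congr fun z hz => hsplit z (hne1 z hz),
    mean_congr (f := fun z => G (c * z) * (c * z / (c * z - a)))
      fun z hz => hsplit (c * z) (hnec z hz.le), mean_add, mean_add, mean_const_mul,
    mean_const_mul, h2, h3, h1]
  · ring
  · exact hds.comp (by fun_prop) hmaps
  · exact continuousOn_const.mul (ContinuousOn.div (by fun_prop) (by fun_prop) fun z hz =>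
      hnec z (by simpa using hz.le))
  · exact hds.mono hsphere
  · exact continuousOn_const.mul (ContinuousOn.div (by fun_prop) (by fun_prop) fun z hz =>
      hne1 z (by simpa using hz))

variable {p q : ℂ} [Nome p] {m : ℕ} {s : Fin (2 * m + 4) → ℂ} {a c : ℂ}

/-- The theta function with a pole at `a` against which the kernel is averaged. -/
noncomputable def poleFactor (p : ℂ) (m : ℕ) (a z : ℂ) : ℂ :=
  xi₁ p z ^ m / (theta p (a * z) * theta p (a / z))

lemma poleFactor_inv {z : ℂ} (hz : z ≠ 0) :
    poleFactor p m a z⁻¹ = poleFactor p m a z := by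
  rw [poleFactor, poleFactor, (isTheta_xi₁ (p := p)).inv z hz, one_mul, div_inv_eq_mul,
    ← div_eq_mul_inv, mul_comm (theta p (a / z))]

lemma poleFactor_nome_mul_inv (ha : a ≠ 0) {z : ℂ} (hz : z ≠ 0) :
    (p * z⁻¹ ^ 2) ^ m * poleFactor p m a (p * z⁻¹) = p * z⁻¹ ^ 2 * poleFactor p m a z := by
  have hp0 := Nome.ne_zero (p := p)
  have hz' := inv_ne_zero hz
  have h1 := (isTheta_xi₁ (p := p)).nome_mul _ hz'
  have h2 := (isTheta_mul_div (p := p) ha).nome_mul _ hz'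
  have h3 := (isTheta_xi₁ (p := p)).inv z hz
  have h4 := (isTheta_mul_div (p := p) ha).inv z hz
  simp only [pow_one, one_mul] at h1 h2 h3 h4
  rw [h3] at h1
  rw [h4] at h2
  have h5 : theta p (a * z) * theta p (a / z) =
      p * z⁻¹ ^ 2 * (theta p (a * (p * z⁻¹)) * theta p (a / (p * z⁻¹))) := by
    refine mul_left_cancel₀ (inv_ne_zero ha) ?_
    rw [← h2]
    ring
  have hw : p * z⁻¹ ^ 2 ≠ 0 := mul_ne_zero hp0 (pow_ne_zero 2 hz')
  rw [poleFactor, poleFactor, h5, ← h1, mul_pow _ (xi₁ p _), ← mul_div_assoc, ← mul_div_assoc,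
    mul_div_mul_left _ _ hw]

lemma poleFactor_mul_halfKernel_reflect (ha : a ≠ 0) {z : ℂ} (hz : z ≠ 0) :
    poleFactor p m a (p * z⁻¹) * halfKernel q p s (p * z⁻¹) =
      -(poleFactor p m a z * halfKernel q p s z) := by
  have hp0 := Nome.ne_zero (p := p)
  have h : p * z⁻¹ ^ 2 * (z ^ 2 / p) = 1 := by field_simp
  rw [halfKernel_nome_mul_inv hz]
  linear_combination (-(z ^ 2 / p * halfKernel q p s z)) *
      poleFactor_nome_mul_inv (p := p) (m := m) ha hz -
      poleFactor p m a z * halfKernel q p s z * h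

variable [Nome q]

/-- The average of the kernel against a theta function with a pole is a residue. -/
lemma mean_poleFactor_mul_halfKernel (hs : IsSmall s) (hc : c ^ 2 = p) (hca : ‖c‖ < ‖a‖)
    (ha : ‖a‖ < 1) (hm : theta p (a ^ 2) ≠ 0) :
    mean (fun z => poleFactor p m a z * halfKernel q p s z) =
      -(a ^ m * xi₁ p a ^ m *
        ∏ r, ellGamma (s r * a) p q * ellGamma (p * s r / a) p q) / qPoch p ^ 2 := by
  have hp0 := Nome.ne_zero (p := p)
  have hc0 : c ≠ 0 := by
    rintro rfl
    exact hp0 (by simp [← hc])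
  have hcn : 0 < ‖c‖ := norm_pos_iff.2 hc0
  have ha0 : a ≠ 0 := norm_pos_iff.1 (hcn.trans hca)
  have hpc : ‖p‖ = ‖c‖ ^ 2 := by rw [← hc, norm_pow]
  set G : ℂ → ℂ := fun z => xi₁ p z ^ m * halfKernel q p s z /
    (theta p (a * z) * (poch p (p * (a / z)) * poch p (p * (z / a)))) with hG
  have hGF : ∀ z ≠ 0, G z * (z / (z - a)) = poleFactor p m a z * halfKernel q p s z := by
    intro z hz
    have e1 : theta p (a / z) =
        (z - a) / z * (poch p (p * (a / z)) * poch p (p * (z / a))) := by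
      rw [theta, poch_eq (a / z), show p / (a / z) = p * (z / a) by field_simp,
        show (1 - a / z) = (z - a) / z by field_simp]
      ring
    rw [poleFactor, e1, hG]
    simp only [div_eq_mul_inv, mul_inv, inv_inv]
    ring
  have hGd : ∀ z, ‖c‖ ≤ ‖z‖ → ‖z‖ ≤ 1 → DifferentiableAt ℂ G z := by
    intro z h1 h2
    have hzn : 0 < ‖z‖ := hcn.trans_le h1
    have hz0 : z ≠ 0 := norm_pos_iff.1 hzn
    have han : 0 < ‖a‖ := hcn.trans hca
    have n1 : theta p (a * z) ≠ 0 := theta_ne_zero_of_norm_lt_one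
      (by rw [norm_mul, hpc]; nlinarith) (by rw [norm_mul]; nlinarith)
    have n2 : poch p (p * (a / z)) ≠ 0 := poch_ne_zero_of_norm_lt_one (by
      rw [norm_mul, norm_div, hpc, mul_div_assoc', div_lt_one hzn]
      nlinarith [mul_lt_mul_of_pos_left ha hcn])
    have n3 : poch p (p * (z / a)) ≠ 0 := poch_ne_zero_of_norm_lt_one (by
      rw [norm_mul, norm_div, hpc, mul_div_assoc', div_lt_one han]
      nlinarith [mul_le_mul_of_nonneg_left h2 (sq_nonneg ‖c‖), hca.trans ha])
    have d1 : DifferentiableAt ℂ (fun z => theta p (a * z)) z :=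
      DifferentiableAt.comp z (differentiableAt_theta (mul_ne_zero ha0 hz0)) (by fun_prop)
    refine DifferentiableAt.div (((isTheta_xi₁.1 z hz0).pow m).mul
      (differentiableAt_halfKernel hs ?_ h2)) (d1.mul (DifferentiableAt.mul ?_ ?_))
      (mul_ne_zero n1 (mul_ne_zero n2 n3))
    · rw [hpc]; nlinarith
    · exact DifferentiableAt.comp z (differentiable_poch _) (by fun_prop (disch := assumption))
    · exact DifferentiableAt.comp z (differentiable_poch _) (by fun_prop)
  have h0 : mean (fun z => G (c * z) * (c * z / (c * z - a))) = 0 := by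
    set f : ℂ → ℂ := fun z => G (c * z) * (c * z / (c * z - a)) with hf
    have h1 : mean f = mean fun z => -1 * f z := by
      rw [← mean_inv]
      refine mean_congr fun z hz => ?_
      have hz0 := ne_zero_of_norm_eq_one hz
      simp only [hf]
      rw [hGF _ (mul_ne_zero hc0 (inv_ne_zero hz0)), hGF _ (mul_ne_zero hc0 hz0), neg_one_mul,
        ← poleFactor_mul_halfKernel_reflect ha0 (mul_ne_zero hc0 hz0),
        show p * (c * z)⁻¹ = c * z⁻¹ by rw [← hc]; field_simp]
    rw [mean_const_mul] at h1
    linear_combination h1 / 2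
  rw [mean_congr fun z hz => (hGF z (ne_zero_of_norm_eq_one hz)).symm,
    mean_eq_add_of_simple_pole hc0 hca ha hGd, h0, zero_add, hG]
  simp only [halfKernel, div_self ha0, mul_one, theta_inv (pow_ne_zero 2 ha0), qPoch_eq_poch, ← sq,
    ellGamma_comm (p := q) (q := p)]
  have hP : poch p p ≠ 0 := poch_ne_zero_of_norm_lt_one Nome.norm_lt_one
  generalize (∏ r : Fin (2 * m + 4), ellGamma (s r * a) p q * ellGamma (p * s r / a) p q) = g
  field_simp
  ring

end Residue

section Recursion

open Metric Matrix

variable {p q : ℂ} [Nome p] [Nome q]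

lemma ellGamma_mul_ellGamma_nome_div {x : ℂ} (h : ‖p‖ < ‖x‖) (h1 : ‖x‖ < 1) :
    ellGamma x p q * ellGamma (p / x) p q = (theta p x)⁻¹ := by
  have hp0 := Nome.ne_zero (p := p)
  have hx0 : 0 < ‖x‖ := (norm_nonneg p).trans_lt h
  have hx : x ≠ 0 := norm_pos_iff.1 hx0
  have h2 : ‖p * q‖ < ‖x‖ := by
    rw [norm_mul]
    nlinarith [Nome.norm_lt_one (p := q), norm_nonneg p, norm_nonneg q]
  have h3 := ellGamma_mul_reflect h2 h1
  have h4 : theta p (p / x) = theta p x := by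
    rw [theta, theta, div_div_cancel₀ hp0, mul_comm]
  rw [show p * q / x = q * (p / x) by ring, ellGamma_right_mul (div_ne_zero hp0 hx)
    (by rwa [norm_div, div_lt_one hx0]), h4] at h3
  exact eq_inv_of_mul_eq_one_left (by rw [← h3]; ring)

lemma xi₁_ne_zero {x : ℂ} (h : ‖p‖ < ‖x‖) (h1 : ‖x‖ < 1) : xi₁ p x ≠ 0 := by
  have hx : x ≠ 0 := norm_pos_iff.1 ((norm_nonneg p).trans_lt h)
  have h2 : theta p (-x) ≠ 0 := theta_ne_zero_of_norm_lt_one (by rwa [norm_neg]) (by rwa [norm_neg])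
  rw [xi₁, xi₀, theta_inv (neg_ne_zero.2 hx)]
  exact div_ne_zero (mul_ne_zero h2 (mul_ne_zero (by simpa using hx) h2))
    (pow_ne_zero 2 theta_neg_one_ne_zero)

variable {m : ℕ} {s : Fin m → ℂ} {a : ℂ}

lemma isSmall_cons_cons (hs : IsSmall s) (h : ‖p‖ < ‖a‖) (h1 : ‖a‖ < 1) :
    IsSmall (Fin.cons a (Fin.cons (p / a) s : Fin (m + 1) → ℂ) : Fin (m + 1 + 1) → ℂ) := by
  have ha0 : 0 < ‖a‖ := (norm_nonneg p).trans_lt h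
  refine Fin.cases ⟨norm_pos_iff.1 ha0, h1⟩ (Fin.cases ⟨?_, ?_⟩ hs)
  · exact div_ne_zero Nome.ne_zero (norm_pos_iff.1 ha0)
  · simpa [norm_div, div_lt_one ha0] using h

lemma theta_mul_weight_cons_cons (h : ‖p‖ < ‖a‖) (h1 : ‖a‖ < 1) {z : ℂ} (hz : ‖z‖ = 1) :
    theta p (a * z) * theta p (a / z) *
      weight p q (Fin.cons a (Fin.cons (p / a) s : Fin (m + 1) → ℂ) : Fin (m + 1 + 1) → ℂ) z =
      weight p q s z := by
  have n1 : ‖a * z‖ = ‖a‖ := by rw [norm_mul, hz, mul_one]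
  have n2 : ‖a / z‖ = ‖a‖ := by rw [norm_div, hz, div_one]
  have e1 := ellGamma_mul_ellGamma_nome_div (q := q) (n1.symm ▸ h) (n1.symm ▸ h1)
  have e2 := ellGamma_mul_ellGamma_nome_div (q := q) (n2.symm ▸ h) (n2.symm ▸ h1)
  have t1 := theta_ne_zero_of_norm_lt_one (n1.symm ▸ h) (n1.symm ▸ h1)
  have t2 := theta_ne_zero_of_norm_lt_one (n2.symm ▸ h) (n2.symm ▸ h1)
  replace e1 := congrArg (theta p (a * z) * ·) e1
  replace e2 := congrArg (theta p (a / z) * ·) e2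
  simp only [mul_inv_cancel₀ t1, mul_inv_cancel₀ t2] at e1 e2
  rw [show p / (a * z) = p / a / z by rw [div_div]] at e1
  rw [show p / (a / z) = p / a * z by rw [div_div_eq_mul_div]; ring] at e2
  rw [weight, weight]
  simp only [Fin.prod_univ_succ, Fin.cons_zero, Fin.cons_succ]
  set W := (∏ r, ellGamma (s r * z) p q * ellGamma (s r / z) p q) *
    (theta p (z ^ 2) * theta q (z ^ 2)⁻¹)
  linear_combination W * (ellGamma (a / z) p q * ellGamma (p / a * z) p q * theta p (a / z)) * e1 +
    W * e2

lemma xi₁_pow_mul_weight_cons_cons (h : ‖p‖ < ‖a‖) (h1 : ‖a‖ < 1) (N : ℕ) {z : ℂ} (hz : ‖z‖ = 1) :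
    xi₁ p z ^ N *
      weight p q (Fin.cons a (Fin.cons (p / a) s : Fin (m + 1) → ℂ) : Fin (m + 1 + 1) → ℂ) z =
      poleFactor p N a z * weight p q s z := by
  have n1 : ‖a * z‖ = ‖a‖ := by rw [norm_mul, hz, mul_one]
  have n2 : ‖a / z‖ = ‖a‖ := by rw [norm_div, hz, div_one]
  have t1 := theta_ne_zero_of_norm_lt_one (n1.symm ▸ h) (n1.symm ▸ h1)
  have t2 := theta_ne_zero_of_norm_lt_one (n2.symm ▸ h) (n2.symm ▸ h1)
  rw [← theta_mul_weight_cons_cons (s := s) h h1 hz, poleFactor]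
  field_simp

/-- With two parameters `a` and `p / a`, the determinant of moments is an extended determinant for
the remaining parameters. -/
lemma momentDet_cons_cons (hs : IsSmall s) (h : ‖p‖ < ‖a‖) (h1 : ‖a‖ < 1) (N : ℕ) :
    (a * xi₁ p a) ^ N * momentDet p q
      (Fin.cons a (Fin.cons (p / a) s : Fin (m + 1) → ℂ) : Fin (m + 1 + 1) → ℂ) (N + 1) =
      (extMoment q p s N fun l =>
        mean fun z => xiMon q N l z * (poleFactor p N a z * weight q p s z)).det := by
  have ha0 : a ≠ 0 := norm_pos_iff.1 ((norm_nonneg p).trans_lt h)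
  have hβ : xi₁ p a ≠ 0 := xi₁_ne_zero h h1
  have ht := isSmall_cons_cons hs h h1
  set t : Fin (m + 1 + 1) → ℂ := Fin.cons a (Fin.cons (p / a) s : Fin (m + 1) → ℂ) with htdef
  set u : Fin (N + 1) → ℂ := fun l =>
    mean fun z => xiMon q N l z * (poleFactor p N a z * weight q p s z) with hu
  set v : Fin (N + 1) → ℂ := Fin.cons 1 fun _ => (a * xi₁ p a)⁻¹ with hv
  have hcont : ∀ {k l : ℕ}, k ≤ N → l ≤ N →
      ContinuousOn (fun z => xiMon p N k z * (xiMon q N l z * weight p q t z)) (sphere 0 1) :=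
    fun hk hl => (continuousOn_xiMon hk).mul ((continuousOn_xiMon hl).mul (continuousOn_weight ht))
  have hrec : ∀ (l : Fin (N + 1)) (k : Fin N),
      xi₁ p a * moment p q t N N (k + 1) l - xi₀ p a * moment p q t N N k l =
        a⁻¹ * moment q p s N (N - 1) l k := by
    intro l k
    have hk := k.2
    have hl := Nat.lt_succ_iff.1 l.2
    simp only [moment]
    rw [← mean_const_mul, ← mean_const_mul, ← mean_sub, ← mean_const_mul]
    rotate_left
    · exact continuousOn_const.mul (hcont hk hl)
    · exact continuousOn_const.mul (hcont hk.le hl)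
    refine mean_congr fun z hz => ?_
    have hz0 := ne_zero_of_norm_eq_one hz
    rw [weight_comm (t := s) hz0, ← theta_mul_weight_cons_cons (s := s) h h1 hz]
    simp only [xiMon]
    rw [show N - (k + 1 : ℕ) = N - 1 - k by omega, show N - (k : ℕ) = N - 1 - k + 1 by omega]
    linear_combination (-(xi₀ p z ^ (k : ℕ) * xi₁ p z ^ (N - 1 - k) * xi₀ q z ^ (l : ℕ) *
      xi₁ q z ^ (N - l) * weight p q t z)) * theta_mul_theta_div (p := p) ha0 hz0
  have hdet : momentDet p q t (N + 1) = (of fun l k => v k * extMoment q p s N u l k).det := by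
    rw [momentDet, ← det_transpose]
    refine det_eq_of_forall_col_eq_smul_add_pred (fun _ => xi₀ p a / xi₁ p a) (fun l => ?_)
      fun l k => ?_
    · simp only [transpose_apply, of_apply, hv, Fin.cons_zero, one_mul, extMoment, hu, moment,
        Nat.add_sub_cancel, Fin.val_zero]
      refine mean_congr fun z hz => ?_
      rw [weight_comm (t := s) (ne_zero_of_norm_eq_one hz),
        ← xi₁_pow_mul_weight_cons_cons (s := s) h h1 N hz, xiMon]
      simp only [pow_zero, Nat.sub_zero]
      ring
    · simp only [transpose_apply, of_apply, hv, Fin.cons_succ, extMoment, Nat.add_sub_cancel,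
        Fin.val_succ, Fin.val_castSucc]
      have := hrec l k
      field_simp
      field_simp at this
      linear_combination this
  rw [hdet, det_mul_row, Fin.prod_univ_succ]
  simp only [hv, Fin.cons_zero, Fin.cons_succ, Finset.prod_const, Finset.card_univ,
    Fintype.card_fin, one_mul, inv_pow]
  rw [mul_inv_cancel_left₀ (pow_ne_zero _ (mul_ne_zero ha0 hβ))]

end Recursion

section Constant

open Metric Matrix

variable {p q : ℂ} [Nome p] [Nome q]

lemma momentDet_cons_cons_mul_prod_theta {m : ℕ} {s : Fin (2 * m + 4) → ℂ} {a c : ℂ}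
    (hs : IsSmall s) (hprod : ∏ r, s r = q) (hc : c ^ 2 = p) (hca : ‖c‖ < ‖a‖) (ha : ‖a‖ < 1)
    (j : Fin (2 * m + 4)) (hj : theta q (s j ^ 2) ≠ 0) (hj' : xi₁ q (s j) ≠ 0) :
    momentDet p q (Fin.cons a (Fin.cons (p / a) s : Fin (2 * m + 4 + 1) → ℂ) :
        Fin (2 * m + 4 + 1 + 1) → ℂ) (m + 1) *
        (∏ r, theta q (s j * s (j.succAbove r))) * qPoch p ^ 2 =
      2 * momentDet q p (Function.update s j (p * s j)) m *
        ∏ r, ellGamma (s r * a) p q * ellGamma (p * s r / a) p q := by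
  have hpc : ‖p‖ = ‖c‖ ^ 2 := by rw [← hc, norm_pow]
  have ha2 : theta p (a ^ 2) ≠ 0 := theta_ne_zero_of_norm_lt_one
    (by rw [hpc, norm_pow]; gcongr)
    (by rw [norm_pow]; exact pow_lt_one₀ (norm_nonneg _) ha two_ne_zero)
  have hpa : ‖p‖ < ‖a‖ := by
    rw [hpc]
    nlinarith [norm_nonneg c]
  have ha0 : a ≠ 0 := norm_pos_iff.1 ((norm_nonneg p).trans_lt hpa)
  obtain ⟨k, hk⟩ := exists_theta_relation hprod
  have hcont : ContinuousOn (poleFactor p m a) (sphere 0 1) := by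
    intro z hz
    have hz : ‖z‖ = 1 := by simpa using hz
    have hz0 := ne_zero_of_norm_eq_one hz
    have n1 : theta p (a * z) ≠ 0 := theta_ne_zero_of_norm_lt_one
      (by rwa [norm_mul, hz, mul_one]) (by rwa [norm_mul, hz, mul_one])
    have n2 : theta p (a / z) ≠ 0 := theta_ne_zero_of_norm_lt_one
      (by rwa [norm_div, hz, div_one]) (by rwa [norm_div, hz, div_one])
    have d1 := ((isTheta_xi₁ (p := p)).1 z hz0).pow m
    refine (d1.div (DifferentiableAt.mul ?_ ?_) (mul_ne_zero n1 n2)).continuousAt.continuousWithinAt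
    · exact DifferentiableAt.comp z (differentiableAt_theta (p := p) (mul_ne_zero ha0 hz0))
        (by fun_prop)
    · exact DifferentiableAt.comp z (differentiableAt_theta (p := p) (div_ne_zero ha0 hz0))
        (by fun_prop (disch := assumption))
  have h1 := sum_mul_mean (p := q) (q := p) hs hk hcont
    fun z hz => poleFactor_inv (ne_zero_of_norm_eq_one hz)
  have h2 := extMoment_det_mul_sum (p := q) (q := p) hs hk
    (fun l => mean fun z => xiMon q m l z * (poleFactor p m a z * weight q p s z))
    fun l => xiMon q m l (s j)
  rw [h1, mean_poleFactor_mul_halfKernel hs hc hca ha ha2, sum_mul_xiMon_eval hs hk j hj,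
    ← momentDet_cons_cons hs hpa ha] at h2
  rw [momentDet_update hs j m hj']
  have hP := qPoch_ne_zero (p := p)
  have hx := xi₁_ne_zero hpa ha
  have hsj := pow_ne_zero m (hs j).1
  rw [mul_pow] at h2
  generalize
    (∏ r : Fin (2 * m + 4), ellGamma (s r * a) p q * ellGamma (p * s r / a) p q) = g at h2 ⊢
  generalize (∏ r : Fin (2 * m + 3), theta q (s j * s (j.succAbove r))) = w at h2 ⊢
  refine mul_left_cancel₀ (mul_ne_zero (pow_ne_zero m ha0) (pow_ne_zero m hx)) ?_
  field_simp at h2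
  linear_combination (-a ^ m * xi₁ p a ^ m) * h2

lemma gammaProd_cons_cons {m : ℕ} {s : Fin m → ℂ} {a : ℂ} (ha : a ≠ 0) :
    gammaProd p q (Fin.cons a (Fin.cons (p / a) s : Fin (m + 1) → ℂ) : Fin (m + 1 + 1) → ℂ) =
      qPoch q / qPoch p * (∏ r, ellGamma (s r * a) p q * ellGamma (p * s r / a) p q) *
        gammaProd p q s := by
  rw [← Fin.insertNth_zero', gammaProd_insertNth, ← Fin.insertNth_zero', gammaProd_insertNth,
    Fin.insertNth_zero', Fin.prod_univ_succ, Finset.prod_mul_distrib, ← ellGamma_left_nome]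
  simp only [Fin.cons_zero, Fin.cons_succ, mul_div_cancel₀ _ ha, mul_comm a, div_mul_eq_mul_div]
  ring

lemma gammaProd_comm {m : ℕ} (t : Fin m → ℂ) : gammaProd q p t = gammaProd p q t := by
  simp only [gammaProd, ellGamma_comm (p := q) (q := p)]

lemma gammaProd_four {t : Fin 4 → ℂ} (ht : IsSmall t) (hp : ∏ r, t r = p * q) :
    gammaProd p q t = 1 := by
  have key : ∀ i j k l, t i * t j * (t k * t l) = p * q →
      ellGamma (t i * t j) p q * ellGamma (t k * t l) p q = 1 := by
    intro i j k l h
    have h0 : t i * t j ≠ 0 := mul_ne_zero (ht i).1 (ht j).1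
    have h1 : ∀ i j, ‖t i * t j‖ < 1 := fun i j => by
      rw [norm_mul]
      exact mul_lt_one_of_nonneg_of_lt_one_left (norm_nonneg _) (ht i).2 (ht j).2.le
    rw [show t k * t l = p * q / (t i * t j) by
      rw [← h, mul_div_cancel_left₀ _ h0]]
    refine ellGamma_mul_reflect ?_ (h1 i j)
    rw [← h, norm_mul]
    exact mul_lt_of_lt_one_right (norm_pos_iff.2 h0) (h1 k l)
  simp only [Fin.prod_univ_four] at hp
  have h1 := key 0 1 2 3 (by rw [← hp]; ring)
  have h2 := key 0 2 1 3 (by rw [← hp]; ring)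
  have h3 := key 0 3 1 2 (by rw [← hp]; ring)
  simp only [gammaProd, Fin.prod_univ_four]
  simp
  linear_combination (ellGamma (t 0 * t 2) p q * ellGamma (t 1 * t 3) p q *
    ellGamma (t 0 * t 3) p q * ellGamma (t 1 * t 2) p q) * h1 +
    (ellGamma (t 0 * t 3) p q * ellGamma (t 1 * t 2) p q) * h2 + h3

lemma exists_isSmall_prod_eq (m : ℕ) : ∃ s : Fin (2 * m + 4) → ℂ, IsSmall s ∧ ∏ r, s r = q ∧
    ∃ j, ‖q‖ < ‖s j ^ 2‖ := by
  have hq0 : 0 < ‖q‖ := norm_pos_iff.2 Nome.ne_zero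
  have hq1 : ‖q‖ < 1 := Nome.norm_lt_one
  obtain ⟨σ, hσ0, hσ1, hσ⟩ : ∃ σ : ℝ, 0 < σ ∧ σ < 1 ∧ σ ^ (2 * m + 4) = ‖q‖ :=
    ⟨‖q‖ ^ (((2 * m + 4 : ℕ) : ℝ)⁻¹), Real.rpow_pos_of_pos hq0 _,
      Real.rpow_lt_one hq0.le hq1 (by positivity),
      Real.rpow_inv_natCast_pow hq0.le (by positivity)⟩
  have hn : ‖(σ : ℂ)‖ = σ := by simp [abs_of_pos hσ0]
  have hσc : (σ : ℂ) ≠ 0 := by exact_mod_cast hσ0.ne'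
  refine ⟨Fin.cons (q / σ ^ (2 * m + 3)) fun _ => (σ : ℂ), ?_, ?_, Fin.succ 0, ?_⟩
  · refine Fin.cases ⟨div_ne_zero (Nome.ne_zero (p := q)) (pow_ne_zero _ hσc), ?_⟩
      fun _ => ⟨hσc, hn.trans_lt hσ1⟩
    rw [Fin.cons_zero, norm_div, norm_pow, hn, div_lt_one (by positivity), ← hσ, pow_succ]
    exact mul_lt_of_lt_one_right (by positivity) hσ1
  · simp [Fin.prod_univ_succ (n := 2 * m + 3), hσc]
  · rw [Fin.cons_succ, norm_pow, hn, ← hσ]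
    exact pow_lt_pow_right_of_lt_one₀ hσ0 hσ1 (by omega)

/-- The evaluation of the determinant of moments. -/
theorem momentDet_eq (n : ℕ) : ∀ (p q : ℂ) [Nome p] [Nome q] (t : Fin (2 * n + 4) → ℂ),
    IsSmall t → ∏ r, t r = p * q →
      momentDet p q t n * (qPoch p * qPoch q) ^ n = 2 ^ n * gammaProd p q t := by
  induction n with
  | zero =>
    intro p q _ _ t ht hp
    rw [gammaProd_four ht hp]
    simp [momentDet]
  | succ m ih =>
    intro p q _ _ t ht hp
    obtain ⟨s, hs, hsq, j, hj⟩ := exists_isSmall_prod_eq (q := q) m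
    obtain ⟨c, hc⟩ := IsAlgClosed.exists_pow_nat_eq p two_pos
    have hpc : ‖p‖ = ‖c‖ ^ 2 := by rw [← hc, norm_pow]
    have hc1 : ‖c‖ < 1 := by
      have := Nome.norm_lt_one (p := p)
      rw [hpc] at this
      exact (sq_lt_one_iff₀ (norm_nonneg c)).1 this
    obtain ⟨a, hca, ha⟩ : ∃ a : ℂ, ‖c‖ < ‖a‖ ∧ ‖a‖ < 1 := by
      obtain ⟨x, h1, h2⟩ := exists_between hc1
      have : ‖(x : ℂ)‖ = x := by simp [abs_of_nonneg ((norm_nonneg c).trans h1.le)]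
      exact ⟨x, by rwa [this], by rwa [this]⟩
    have hpa : ‖p‖ < ‖a‖ := by
      rw [hpc]
      nlinarith [norm_nonneg c]
    have ha0 : a ≠ 0 := norm_pos_iff.1 ((norm_nonneg p).trans_lt hpa)
    have hjq : ‖q‖ < ‖s j‖ := hj.trans (by
      rw [norm_pow]
      exact pow_lt_self_of_lt_one₀ (norm_pos_iff.2 (hs j).1) (hs j).2 one_lt_two)
    have hj2 : theta q (s j ^ 2) ≠ 0 := theta_ne_zero_of_norm_lt_one hj (by
      rw [norm_pow]
      exact pow_lt_one₀ (norm_nonneg _) (hs j).2 two_ne_zero)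
    have h1 := momentDet_cons_cons_mul_prod_theta hs hsq hc hca ha j hj2
      (xi₁_ne_zero hjq (hs j).2)
    set s' := Function.update s j (p * s j) with hs'
    have hs'small : IsSmall s' := hs.update_nome_mul j
    have hs'prod : ∏ r, s' r = q * p := by
      have := prod_update_mul s j (p * s j)
      refine mul_right_cancel₀ (hs j).1 (this.trans ?_)
      rw [hsq]
      ring
    have h2 := ih q p s' hs'small hs'prod
    have h3 : gammaProd q p s' = _ := gammaProd_update_nome_mul hs j
    have h4 : gammaProd q p s' ≠ 0 := gammaProd_ne_zero hs'small hs'prod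
    rw [h3, gammaProd_comm] at h2 h4
    have ht' := isSmall_cons_cons hs hpa ha
    set t' : Fin (2 * (m + 1) + 4) → ℂ :=
      (Fin.cons a (Fin.cons (p / a) s : Fin (2 * m + 4 + 1) → ℂ) :
        Fin (2 * m + 4 + 1 + 1) → ℂ) with htd
    have htp : ∏ r, t' r = p * q := by
      change ∏ r : Fin (2 * m + 4 + 1 + 1), t' r = p * q
      rw [Fin.prod_univ_succ, Fin.prod_univ_succ]
      simp only [htd, Fin.cons_zero, Fin.cons_succ, hsq]
      field_simp
    have h5 : gammaProd p q t' = _ := gammaProd_cons_cons (q := q) (s := s) ha0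
    have h6 := momentRatio_eq (p := p) (q := q) (n := m + 1) ht hp ht' htp
    have hG : gammaProd p q t ≠ 0 := gammaProd_ne_zero ht hp
    have hG' : gammaProd p q t' ≠ 0 := gammaProd_ne_zero ht' htp
    have hP := qPoch_ne_zero (p := p)
    have hQ := qPoch_ne_zero (p := q)
    rw [momentRatio, momentRatio, div_eq_div_iff hG hG'] at h6
    replace h1 : momentDet p q t' (m + 1) * _ * qPoch p ^ 2 = _ := h1
    replace h5 : qPoch p * gammaProd p q t' = qPoch q *
        (∏ r, ellGamma (s r * a) p q * ellGamma (p * s r / a) p q) * gammaProd p q s := by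
      rw [h5, ← mul_assoc, ← mul_assoc, mul_div_cancel₀ _ hP]
    refine mul_left_cancel₀ (mul_ne_zero (mul_ne_zero (left_ne_zero_of_mul h4) hG') hP) ?_
    linear_combination ((∏ r, theta q (s j * s (j.succAbove r))) * qPoch p *
        (qPoch p * qPoch q) ^ (m + 1)) * h6 +
      gammaProd p q t * qPoch q * (qPoch p * qPoch q) ^ m * h1 +
      2 * (∏ r, ellGamma (s r * a) p q * ellGamma (p * s r / a) p q) * qPoch q *
        gammaProd p q t * h2 -
      2 ^ (m + 1) * (∏ r, theta q (s j * s (j.succAbove r))) * gammaProd p q t * h5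

end Constant

section Torus

open Metric Matrix

variable {n : ℕ}

lemma torusInt_congr {f g : (Fin n → ℂ) → ℂ} (h : ∀ z, (∀ i, ‖z i‖ = 1) → f z = g z) :
    torusInt n f = torusInt n g := by
  rw [torusInt, torusInt]
  congr 2
  refine funext fun θ => h _ fun i => ?_
  rw [mul_comm, Complex.norm_exp_ofReal_mul_I]

lemma volume_restrict_univ_pi : (volume : Measure (Fin n → ℝ)).restrict
    (Set.univ.pi fun _ => Set.Icc 0 (2 * π)) =
      Measure.pi fun _ => volume.restrict (Set.Icc 0 (2 * π)) := by
  rw [volume_pi, Measure.restrict_pi_pi]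

lemma torusInt_prod (f : Fin n → ℂ → ℂ) :
    torusInt n (fun z => ∏ i, f i (z i)) = ∏ i, mean (f i) := by
  rw [torusInt, volume_restrict_univ_pi,
    integral_fintype_prod_eq_prod (f := fun i (θ : ℝ) => f i (Complex.exp (Complex.I * θ)))]
  simp only [mean, Real.circleAverage_def, Complex.real_smul, Finset.prod_mul_distrib,
    Finset.prod_const, Finset.card_univ, Fintype.card_fin, one_div, circleMap_zero,
    intervalIntegral.integral_of_le Real.two_pi_pos.le, integral_Icc_eq_integral_Ioc,
    Complex.ofReal_one, one_mul, mul_comm Complex.I]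

lemma torusInt_sum {ι : Type*} (s : Finset ι) (c : ι → ℂ) {f : ι → Fin n → ℂ → ℂ}
    (hf : ∀ k i, ContinuousOn (f k i) (sphere 0 1)) :
    torusInt n (fun z => ∑ k ∈ s, c k * ∏ i, f k i (z i)) =
      ∑ k ∈ s, c k * ∏ i, mean (f k i) := by
  simp_rw [← torusInt_prod]
  simp only [torusInt, volume_restrict_univ_pi]
  rw [integral_finsetSum, Finset.mul_sum]
  · refine Finset.sum_congr rfl fun k _ => ?_
    rw [integral_const_mul]
    ring
  · intro k _
    refine (Integrable.fintype_prod (f := fun i (θ : ℝ) => f k i (Complex.exp (Complex.I * θ)))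
      fun i => ?_).const_mul _
    refine ContinuousOn.integrableOn_compact isCompact_Icc (Continuous.continuousOn ?_)
    refine (hf k i).comp_continuous (by fun_prop) fun θ => ?_
    rw [mem_sphere_zero_iff_norm, mul_comm, Complex.norm_exp_ofReal_mul_I]

/-- The Andréief identity on the torus. -/
lemma torusInt_det_mul_det {w : ℂ → ℂ} {φ ψ : Fin n → ℂ → ℂ} (hw : ContinuousOn w (sphere 0 1))
    (hφ : ∀ k, ContinuousOn (φ k) (sphere 0 1)) (hψ : ∀ k, ContinuousOn (ψ k) (sphere 0 1)) :
    torusInt n (fun z => (of fun k i => φ k (z i)).det * (of fun k i => ψ k (z i)).det *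
      ∏ i, w (z i)) =
      n.factorial * (of fun k l => mean fun z => φ k z * (ψ l z * w z)).det := by
  set M : Matrix (Fin n) (Fin n) ℂ := of fun k l => mean fun z => φ k z * (ψ l z * w z) with hM
  have h1 : ∀ z : Fin n → ℂ, (of fun k i => φ k (z i)).det * (of fun k i => ψ k (z i)).det *
      ∏ i, w (z i) = ∑ x : Equiv.Perm (Fin n) × Equiv.Perm (Fin n),
        ((Equiv.Perm.sign x.1 : ℤ) : ℂ) * ((Equiv.Perm.sign x.2 : ℤ) : ℂ) *
          ∏ i, φ (x.1 i) (z i) * (ψ (x.2 i) (z i) * w (z i)) := by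
    intro z
    rw [det_apply', det_apply', Finset.sum_mul_sum, ← Finset.sum_product', Finset.sum_mul]
    refine Finset.sum_congr rfl fun x _ => ?_
    simp only [of_apply, Finset.prod_mul_distrib]
    ring
  rw [torusInt_congr fun z _ => h1 z]
  refine (torusInt_sum Finset.univ
    (fun x : Equiv.Perm (Fin n) × Equiv.Perm (Fin n) =>
      ((Equiv.Perm.sign x.1 : ℤ) : ℂ) * ((Equiv.Perm.sign x.2 : ℤ) : ℂ))
    (f := fun x i z => φ (x.1 i) z * (ψ (x.2 i) z * w z))
    fun x i => (hφ _).mul ((hψ _).mul hw)).trans ?_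
  have h2 : ∀ σ : Equiv.Perm (Fin n), ∑ τ : Equiv.Perm (Fin n),
      ((Equiv.Perm.sign σ : ℤ) : ℂ) * ((Equiv.Perm.sign τ : ℤ) : ℂ) * ∏ i, M (σ i) (τ i) =
        M.det := by
    intro σ
    have h3 := det_permute σ M
    rw [← det_transpose, det_apply'] at h3
    simp only [transpose_apply, submatrix_apply, id] at h3
    simp_rw [mul_assoc, ← Finset.mul_sum, h3, ← mul_assoc]
    rw [← Int.cast_mul, ← Units.val_mul, Int.units_mul_self, Units.val_one, Int.cast_one, one_mul]
  rw [← Finset.univ_product_univ, Finset.sum_product]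
  refine (Finset.sum_congr rfl fun σ _ => h2 σ).trans ?_
  rw [Finset.sum_const, Finset.card_univ, Fintype.card_perm, Fintype.card_fin, nsmul_eq_mul]

end Torus

section Integrand

open Matrix

variable {p q : ℂ}

lemma det_xiMon {n : ℕ} (z : Fin n → ℂ) :
    (of fun k i : Fin n => xiMon p (n - 1) k (z i)).det =
      ∏ i, ∏ j, if i < j then xi₁ p (z i) * xi₀ p (z j) - xi₀ p (z i) * xi₁ p (z j) else 1 := by
  have h : (of fun k i : Fin n => xiMon p (n - 1) k (z i)) =
      (projVandermonde (fun i => xi₀ p (z i)) fun i => xi₁ p (z i))ᵀ := by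
    ext k i
    rw [transpose_apply, projVandermonde_apply, of_apply, xiMon, Fin.val_rev,
      show n - 1 - (k : ℕ) = n - (k + 1) by omega]
  rw [h, det_transpose, det_projVandermonde]
  refine Finset.prod_congr rfl fun i _ => ?_
  rw [← Finset.prod_filter]
  refine Finset.prod_congr (by ext; simp) fun j _ => by ring

variable [Nome p] [Nome q]

lemma inv_ellGamma_four {x y : ℂ} (hx : ‖x‖ = 1) (hy : ‖y‖ = 1) :
    (ellGamma (x * y) p q * ellGamma (x / y) p q * ellGamma (y / x) p q *
      ellGamma (1 / (x * y)) p q)⁻¹ =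
      (xi₁ p x * xi₀ p y - xi₀ p x * xi₁ p y) * (xi₁ q x * xi₀ q y - xi₀ q x * xi₁ q y) := by
  have hx0 := ne_zero_of_norm_eq_one hx
  have hy0 := ne_zero_of_norm_eq_one hy
  have h1 := inv_ellGamma_mul_ellGamma_inv (p := p) (q := q) (x := x * y)
    (by rw [norm_mul, hx, hy, mul_one])
  have h2 := inv_ellGamma_mul_ellGamma_inv (p := p) (q := q) (x := x / y)
    (by rw [norm_div, hx, hy, div_one])
  rw [theta_inv (mul_ne_zero hx0 hy0)] at h1
  rw [theta_inv (div_ne_zero hx0 hy0), inv_div] at h2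
  have e : ellGamma (x * y) p q * ellGamma (x / y) p q * ellGamma (y / x) p q *
      ellGamma (1 / (x * y)) p q = (ellGamma (x * y) p q * ellGamma (x * y)⁻¹ p q) *
        (ellGamma (x / y) p q * ellGamma (y / x) p q) := by
    rw [one_div]
    ring
  rw [e, mul_inv, h1, h2, ← theta_mul_theta_div hx0 hy0, ← theta_mul_theta_div hx0 hy0]
  field_simp

lemma integrand_eq {n : ℕ} {ι : Type*} [Fintype ι] (t : ι → ℂ) {z : Fin n → ℂ}
    (hz : ∀ i, ‖z i‖ = 1) :
    (∏ i, ∏ r, ellGamma (t r * z i) p q * ellGamma (t r / z i) p q) /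
      ((∏ i, ∏ j, if i < j then ellGamma (z i * z j) p q * ellGamma (z i / z j) p q *
          ellGamma (z j / z i) p q * ellGamma (1 / (z i * z j)) p q else 1) *
        ∏ i, ellGamma (z i ^ 2) p q * ellGamma (1 / z i ^ 2) p q) =
      (of fun k i : Fin n => xiMon p (n - 1) k (z i)).det *
        (of fun k i : Fin n => xiMon q (n - 1) k (z i)).det * ∏ i, weight p q t (z i) := by
  have e1 : (∏ i, ∏ j, if i < j then ellGamma (z i * z j) p q * ellGamma (z i / z j) p q *
      ellGamma (z j / z i) p q * ellGamma (1 / (z i * z j)) p q else 1)⁻¹ =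
      (of fun k i : Fin n => xiMon p (n - 1) k (z i)).det *
        (of fun k i : Fin n => xiMon q (n - 1) k (z i)).det := by
    simp_rw [det_xiMon, ← Finset.prod_inv_distrib, ← Finset.prod_mul_distrib]
    refine Finset.prod_congr rfl fun i _ => Finset.prod_congr rfl fun j _ => ?_
    split_ifs
    · exact inv_ellGamma_four (hz i) (hz j)
    · rw [inv_one, one_mul]
  have e2 : (∏ i, ellGamma (z i ^ 2) p q * ellGamma (1 / z i ^ 2) p q)⁻¹ =
      ∏ i, theta p (z i ^ 2) * theta q (z i ^ 2)⁻¹ := by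
    rw [← Finset.prod_inv_distrib]
    refine Finset.prod_congr rfl fun i _ => ?_
    rw [one_div, inv_ellGamma_mul_ellGamma_inv (by rw [norm_pow, hz i, one_pow])]
  have e3 : ∏ i, weight p q t (z i) =
      (∏ i, ∏ r, ellGamma (t r * z i) p q * ellGamma (t r / z i) p q) *
        ∏ i, theta p (z i ^ 2) * theta q (z i ^ 2)⁻¹ := Finset.prod_mul_distrib
  rw [div_eq_mul_inv, mul_inv, e1, e2, e3]
  ring

end Integrand

lemma isSmall_of_prod_eq {p q : ℂ} [Nome p] [Nome q] {m : ℕ} {t : Fin m → ℂ}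
    (ht : ∀ r, ‖t r‖ < 1) (h : ∏ r, t r = p * q) : IsSmall t := fun r =>
  ⟨fun h0 => mul_ne_zero (Nome.ne_zero (p := p)) (Nome.ne_zero (p := q))
    (h ▸ Finset.prod_eq_zero (Finset.mem_univ r) h0), ht r⟩

end EllipticBeta

/-- The Type I (`BC_n`) elliptic beta integral of van Diejen and Spiridonov. -/
theorem typeI_integral (n : ℕ) (p q : ℂ)
    (hp0 : 0 < ‖p‖) (hp1 : ‖p‖ < 1)
    (hq0 : 0 < ‖q‖) (hq1 : ‖q‖ < 1)
    (t : Fin (2 * n + 4) → ℂ)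
    (ht : ∀ r, ‖t r‖ < 1)
    (hbal : ∏ r, t r = p * q) :
    (qPoch p * qPoch q) ^ n / ((2 ^ n * n.factorial : ℕ) : ℂ) *
      torusInt n (fun z =>
        (∏ i, ∏ r, ellGamma (t r * z i) p q * ellGamma (t r / z i) p q) /
          ((∏ i, ∏ j, if i < j then
              ellGamma (z i * z j) p q * ellGamma (z i / z j) p q *
                ellGamma (z j / z i) p q * ellGamma (1 / (z i * z j)) p q
            else 1) *
            ∏ i, ellGamma (z i ^ 2) p q * ellGamma (1 / z i ^ 2) p q)) =
      ∏ r, ∏ s, if r < s then ellGamma (t r * t s) p q else 1 := by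
  have : EllipticBeta.Nome p := ⟨norm_pos_iff.1 hp0, hp1⟩
  have : EllipticBeta.Nome q := ⟨norm_pos_iff.1 hq0, hq1⟩
  have hs := EllipticBeta.isSmall_of_prod_eq ht hbal
  have h := EllipticBeta.momentDet_eq n p q t hs hbal
  have hn : (n.factorial : ℂ) ≠ 0 := by exact_mod_cast n.factorial_ne_zero
  rw [EllipticBeta.torusInt_congr fun z hz => EllipticBeta.integrand_eq t hz,
    EllipticBeta.torusInt_det_mul_det (EllipticBeta.continuousOn_weight hs)
      (fun k => EllipticBeta.continuousOn_xiMon (by omega))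
      fun k => EllipticBeta.continuousOn_xiMon (by omega)]
  change _ * (_ * EllipticBeta.momentDet p q t n) = EllipticBeta.gammaProd p q t
  push_cast
  field_simp
  linear_combination h
end

section
/- Let n ≥ 1 be an integer, let q ∈ ℂ with 0 < |q| < 1, and let a_1, ..., a_n, z_1, ..., z_n ∈ ℂ, all nonzero, with θ(a_i z_j;q) ≠ 0 and θ(a_i/z_j;q) ≠ 0 for all i, j. Then det_{1≤i,j≤n}( a_i/(θ(a_i z_j;q) θ(a_i/z_j;q)) ) = (−1)^{n(n−1)/2} · ( ∏_{1≤i<j≤n} a_i^{−1} θ(a_i a_j;q) θ(a_i/a_j;q) · z_i^{−1} θ(z_i z_j;q) θ(z_i/z_j;q) ) / ∏_{1≤i,j≤n} a_i^{−1} θ(a_i z_j;q) θ(a_i/z_j;q). -/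
open scoped BigOperators Real

/-- The theta function `θ(x;q)`. -/
noncomputable def ellTheta (x q : ℂ) : ℂ :=
  ∏' k : ℕ, ((1 - q ^ k * x) * (1 - q ^ (k + 1) / x))

open Filter Topology

/-- The homogeneous Cauchy determinant. -/
theorem det_inv_cross {X F : Type*} [Field F] (u v : X → F) (f : X → X → F)
    (hf : ∀ x y, f x y = u x * v y - v x * u y) (n : ℕ) (a z : Fin n → X)
    (h : ∀ i j, f (a i) (z j) ≠ 0) :
    Matrix.det (Matrix.of fun i j => (f (a i) (z j))⁻¹) =
      (∏ i, ∏ j, if i < j then f (a i) (a j) * f (z j) (z i) else 1) /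
        ∏ i, ∏ j, f (a i) (z j) := by
  induction n with
  | zero => simp
  | succ n ih =>
    have key : Matrix.det (Matrix.of fun i j => (f (a i) (z j))⁻¹) =
        Matrix.det (Matrix.of fun i j => (f (a i) (z j))⁻¹ +
          (if i = 0 then 0 else -(f (a 0) (z 0) / f (a i) (z 0))) * (f (a 0) (z j))⁻¹) := by
      symm
      refine Matrix.det_eq_of_forall_row_eq_smul_add_const
        (fun i => if i = 0 then 0 else -(f (a 0) (z 0) / f (a i) (z 0))) 0 (by simp) ?_
      intro i j
      simp
    rw [key, Matrix.det_succ_column_zero, Fin.sum_univ_succ, Finset.sum_eq_zero]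
    · have hminor : ((Matrix.of fun i j => (f (a i) (z j))⁻¹ +
          (if i = 0 then 0 else -(f (a 0) (z 0) / f (a i) (z 0))) *
            (f (a 0) (z j))⁻¹).submatrix (Fin.succAbove 0) Fin.succ) =
          Matrix.of fun i j : Fin n => (f (a 0) (a i.succ) / f (a i.succ) (z 0)) *
            (Matrix.of fun i j : Fin n => (f (z j.succ) (z 0) / f (a 0) (z j.succ)) *
              (Matrix.of fun i j : Fin n => (f (a i.succ) (z j.succ))⁻¹) i j) i j := by
        ext i j
        have h1 := h i.succ j.succ
        have h2 := h 0 j.succ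
        have h3 := h i.succ 0
        simp only [Matrix.submatrix_apply, Matrix.of_apply, Fin.succAbove_zero,
          Fin.succ_ne_zero, if_false]
        field_simp
        simp only [hf]
        ring
      rw [hminor, Matrix.det_mul_column, Matrix.det_mul_row,
        ih (fun i => a i.succ) (fun i => z i.succ) (fun i j => h _ _)]
      simp only [Fin.prod_univ_succ, Finset.prod_mul_distrib, Finset.prod_div_distrib]
      simp [Finset.prod_mul_distrib]
      field_simp
    · intro i _
      have h1 := h 0 0
      have h2 := h i.succ 0
      have h0 : (f (a i.succ) (z 0))⁻¹ + -(f (a 0) (z 0) / f (a i.succ) (z 0)) *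
          (f (a 0) (z 0))⁻¹ = 0 := by
        field_simp
        ring
      rw [Matrix.of_apply, if_neg (Fin.succ_ne_zero i), h0, mul_zero, zero_mul]

/-- The Gaussian binomial coefficients, defined by the `q`-Pascal recursion. -/
noncomputable def gaussBinom (q : ℂ) : ℕ → ℕ → ℂ
  | _, 0 => 1
  | 0, _ + 1 => 0
  | M + 1, j + 1 => q ^ (j + 1) * gaussBinom q M (j + 1) + gaussBinom q M j

theorem gaussBinom_zero_right (q : ℂ) (M : ℕ) : gaussBinom q M 0 = 1 := by
  cases M <;> rfl

theorem gaussBinom_eq_zero (q : ℂ) {M j : ℕ} (h : M < j) : gaussBinom q M j = 0 := by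
  induction M generalizing j with
  | zero => obtain ⟨j, rfl⟩ := Nat.exists_eq_succ_of_ne_zero h.ne'; rfl
  | succ M ih =>
    obtain ⟨j, rfl⟩ := Nat.exists_eq_succ_of_ne_zero (by omega : j ≠ 0)
    simp only [Nat.succ_eq_add_one] at *
    rw [gaussBinom, ih (by omega), ih (by omega)]; simp

/-- The finite `q`-factorial product `(1 - q) ⋯ (1 - q ^ m)`. -/
noncomputable def qFac (q : ℂ) (m : ℕ) : ℂ := ∏ k ∈ Finset.range m, (1 - q ^ (k + 1))

theorem gaussBinom_mul_qFac (q : ℂ) (j k : ℕ) :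
    gaussBinom q (j + k) j * (qFac q j * qFac q k) = qFac q (j + k) := by
  induction hM : j + k generalizing j k with
  | zero =>
    obtain rfl : j = 0 := by omega
    obtain rfl : k = 0 := by omega
    simp [gaussBinom, qFac]
  | succ M ih =>
    rcases j with _ | j
    · obtain rfl : k = M + 1 := by omega
      simp [gaussBinom, qFac]
    · have h1 := ih j k (by omega)
      have hQ : ∀ m, qFac q (m + 1) = qFac q m * (1 - q ^ (m + 1)) := fun m =>
        Finset.prod_range_succ _ _
      rw [gaussBinom]
      rcases k with _ | k
      · obtain rfl : M = j := by omega
        rw [gaussBinom_eq_zero q (by omega : M < M + 1), hQ M]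
        linear_combination (1 - q ^ (M + 1)) * h1
      · have h2 := ih (j + 1) k (by omega)
        obtain rfl : M = j + k + 1 := by omega
        rw [hQ (j + k + 1)]
        rw [hQ k] at h1 ⊢
        rw [hQ j] at h2 ⊢
        linear_combination (1 - q ^ (j + 1)) * h1 + q ^ (j + 1) * (1 - q ^ (k + 1)) * h2

theorem prod_one_sub_eq_sum_gaussBinom (q : ℂ) (M : ℕ) (y : ℂ) :
    ∏ k ∈ Finset.range M, (1 - q ^ k * y) =
      ∑ j ∈ Finset.range (M + 1), (-1) ^ j * q ^ (j.choose 2) * gaussBinom q M j * y ^ j := by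
  induction M generalizing y with
  | zero => simp [gaussBinom]
  | succ M ih =>
    rw [Finset.prod_range_succ']
    have : ∏ k ∈ Finset.range M, (1 - q ^ (k + 1) * y) =
        ∏ k ∈ Finset.range M, (1 - q ^ k * (q * y)) :=
      Finset.prod_congr rfl fun k _ => by ring
    rw [this, ih, Finset.sum_range_succ' _ (M + 1)]
    have e1 : ∑ j ∈ Finset.range (M + 1),
        (-1) ^ j * q ^ (j.choose 2) * gaussBinom q M j * (q * y) ^ j =
        ∑ j ∈ Finset.range (M + 1), (-1) ^ (j + 1) * q ^ ((j + 1).choose 2) *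
          gaussBinom q M (j + 1) * (q * y) ^ (j + 1) + 1 := by
      rw [Finset.sum_range_succ', Finset.sum_range_succ _ M,
        gaussBinom_eq_zero q (by omega : M < M + 1)]
      simp [gaussBinom_zero_right]
    have e2 : ∀ S : ℂ, S * (1 - q ^ 0 * y) = S - y * S := fun S => by ring
    rw [e2]
    nth_rewrite 1 [e1]
    rw [Finset.mul_sum, add_sub_right_comm, ← Finset.sum_sub_distrib]
    congr 1
    · refine Finset.sum_congr rfl fun j _ => ?_
      rw [gaussBinom, Nat.choose_succ_succ' j 1, Nat.choose_one_right]
      ring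
    · simp [gaussBinom]

/-- The triangular numbers `n * (n - 1) / 2`, indexed by integers. -/
def tri (n : ℤ) : ℤ := n * (n - 1) / 2

theorem two_mul_tri (n : ℤ) : 2 * tri n = n * (n - 1) :=
  Int.two_mul_ediv_two_of_even (Int.even_mul_pred_self n)

theorem tri_natCast (j : ℕ) : tri j = (j.choose 2 : ℕ) := by
  have := two_mul_tri j
  induction j with
  | zero => simp [tri]
  | succ j ih =>
    have h1 := ih (two_mul_tri j)
    have h2 := two_mul_tri j
    rw [Nat.choose_succ_succ' j 1, Nat.choose_one_right]
    push_cast at this ⊢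
    linarith

theorem finite_triple_product {q x : ℂ} (hq : q ≠ 0) (hx : x ≠ 0) (N : ℕ) :
    ∏ k ∈ Finset.range N, ((1 - q ^ k * x) * (1 - q ^ (k + 1) / x)) =
      ∑ j ∈ Finset.range (2 * N + 1),
        (-1) ^ ((j : ℤ) - N) * q ^ tri ((j : ℤ) - N) * x ^ ((j : ℤ) - N) *
          gaussBinom q (2 * N) j := by
  have h1 : ∏ k ∈ Finset.range N, ((1 - q ^ k * x) * (1 - q ^ (k + 1) / x)) =
      (-1) ^ N * q ^ ((N + 1).choose 2) * x ^ (-(N : ℤ)) *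
        ∏ k ∈ Finset.range (2 * N), (1 - q ^ k * (x * q ^ (-(N : ℤ)))) := by
    rw [two_mul, Finset.prod_range_add, Finset.prod_mul_distrib, mul_comm, ← mul_assoc]
    congr 1
    · rw [← Finset.prod_range_reflect (fun k => 1 - q ^ k * (x * q ^ (-(N : ℤ))))]
      have : ∀ k ∈ Finset.range N, 1 - q ^ (N - 1 - k) * (x * q ^ (-(N : ℤ))) =
          1 - x * (q ^ (k + 1))⁻¹ := by
        intro k hk
        have hk := Finset.mem_range.1 hk
        have : q ^ (-(N : ℤ)) = (q ^ (N - 1 - k))⁻¹ * (q ^ (k + 1))⁻¹ := by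
          rw [zpow_neg, zpow_natCast, ← mul_inv, ← pow_add]
          congr 2; omega
        rw [this]
        field_simp
      rw [Finset.prod_congr rfl this]
      clear this
      induction N with
      | zero => simp
      | succ N ih =>
        rw [Finset.prod_range_succ, Finset.prod_range_succ, ih, Nat.choose_succ_succ' (N + 1) 1,
          Nat.choose_one_right]
        have : x ^ (-((N + 1 : ℕ) : ℤ)) = x ^ (-(N : ℤ)) * x⁻¹ := by
          push_cast
          rw [neg_add, zpow_add₀ hx, zpow_neg_one]
        rw [this]
        field_simp
        ring
    · refine Finset.prod_congr rfl fun k _ => ?_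
      rw [zpow_neg, zpow_natCast, pow_add]
      field_simp
  rw [h1, prod_one_sub_eq_sum_gaussBinom, Finset.mul_sum]
  refine Finset.sum_congr rfl fun j _ => ?_
  have e1 : tri ((j : ℤ) - N) = ((N + 1).choose 2 : ℕ) + (j.choose 2 : ℕ) + -(N : ℤ) * j := by
    have a1 := two_mul_tri ((j : ℤ) - N)
    have a2 := two_mul_tri j
    have a3 := two_mul_tri ((N + 1 : ℕ))
    rw [tri_natCast] at a2 a3
    push_cast at a3
    linarith
  have e2 : ((-1 : ℂ)) ^ ((j : ℤ) - N) = (-1) ^ N * (-1) ^ j := by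
    rw [zpow_sub₀ (by norm_num), zpow_natCast, zpow_natCast, div_eq_iff (by simp)]
    rw [mul_right_comm, ← mul_pow]; simp
  rw [e1, e2, zpow_add₀ hq, zpow_add₀ hq, zpow_natCast, zpow_natCast, zpow_mul, zpow_natCast,
    sub_eq_add_neg, zpow_add₀ hx, zpow_natCast, mul_pow]
  ring

theorem summable_norm_pow_succ {q : ℂ} (hq1 : ‖q‖ < 1) : Summable fun k : ℕ => ‖q ^ (k + 1)‖ := by
  simp_rw [norm_pow]
  exact (summable_nat_add_iff 1).2 (summable_geometric_of_lt_one (norm_nonneg q) hq1)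

theorem one_sub_pow_succ_ne_zero {q : ℂ} (hq1 : ‖q‖ < 1) (k : ℕ) : 1 - q ^ (k + 1) ≠ 0 := by
  intro h
  have h1 : ‖q ^ (k + 1)‖ < 1 := by
    rw [norm_pow]; exact pow_lt_one₀ (norm_nonneg q) hq1 (Nat.succ_ne_zero k)
  rw [← sub_eq_zero.1 h, norm_one] at h1
  exact lt_irrefl _ h1

theorem qFac_ne_zero {q : ℂ} (hq1 : ‖q‖ < 1) (m : ℕ) : qFac q m ≠ 0 :=
  Finset.prod_ne_zero_iff.2 fun k _ => one_sub_pow_succ_ne_zero hq1 k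

theorem exists_tendsto_qFac {q : ℂ} (hq1 : ‖q‖ < 1) :
    ∃ c : ℂ, c ≠ 0 ∧ Tendsto (qFac q) atTop (𝓝 c) := by
  have hs : Summable fun k : ℕ => ‖-q ^ (k + 1)‖ := by
    simpa only [norm_neg] using summable_norm_pow_succ hq1
  refine ⟨∏' k : ℕ, (1 + -q ^ (k + 1)), tprod_one_add_ne_zero_of_summable (fun k => ?_) hs, ?_⟩
  · simpa only [← sub_eq_add_neg] using one_sub_pow_succ_ne_zero hq1 k
  · simpa only [← sub_eq_add_neg] using!
      (multipliable_one_add_of_summable hs).tendsto_prod_tprod_nat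

theorem tendsto_prod_ellTheta {q : ℂ} (hq1 : ‖q‖ < 1) (x : ℂ) :
    Tendsto (fun N => ∏ k ∈ Finset.range N, ((1 - q ^ k * x) * (1 - q ^ (k + 1) / x))) atTop
      (𝓝 (ellTheta x q)) := by
  refine Multipliable.tendsto_prod_tprod_nat (Multipliable.mul ?_ ?_)
  · simp_rw [sub_eq_add_neg]
    refine multipliable_one_add_of_summable ?_
    simp_rw [norm_neg, norm_mul, norm_pow]
    exact (summable_geometric_of_lt_one (norm_nonneg q) hq1).mul_right _
  · simp_rw [sub_eq_add_neg]
    refine multipliable_one_add_of_summable ?_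
    simp_rw [norm_neg, norm_div]
    exact (summable_norm_pow_succ hq1).div_const _

/-- The general term of the two-sided theta series. -/
noncomputable def triTerm (q y : ℂ) (n : ℤ) : ℂ := q ^ tri n * y ^ n

theorem tri_add_one (n : ℤ) : tri (n + 1) = tri n + n := by
  have h1 := two_mul_tri n
  have h2 := two_mul_tri (n + 1)
  linarith

theorem tri_neg (n : ℤ) : tri (-n) = tri n + n := by
  have h1 := two_mul_tri n
  have h2 := two_mul_tri (-n)
  linarith

theorem summable_triTerm_natCast {q y : ℂ} (hq : q ≠ 0) (hq1 : ‖q‖ < 1) (hy : y ≠ 0) :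
    Summable fun n : ℕ => triTerm q y n := by
  refine summable_of_ratio_test_tendsto_lt_one (l := 0) zero_lt_one
    (Eventually.of_forall fun n => mul_ne_zero (zpow_ne_zero _ hq) (zpow_ne_zero _ hy)) ?_
  have h : ∀ n : ℕ, ‖triTerm q y (n + 1 : ℕ)‖ / ‖triTerm q y n‖ = ‖q‖ ^ n * ‖y‖ := by
    intro n
    rw [← norm_div, ← norm_pow, ← norm_mul]
    congr 1
    have := zpow_ne_zero (tri n) hq
    rw [triTerm, triTerm, Nat.cast_succ, tri_add_one, zpow_add₀ hq, zpow_add₀ hy, zpow_natCast,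
      zpow_natCast, zpow_one]
    field_simp
  simp_rw [h]
  simpa using (tendsto_pow_atTop_nhds_zero_of_lt_one (norm_nonneg q) hq1).mul_const ‖y‖

theorem summable_triTerm {q y : ℂ} (hq : q ≠ 0) (hq1 : ‖q‖ < 1) (hy : y ≠ 0) :
    Summable (triTerm q y) := by
  refine Summable.of_nat_of_neg (summable_triTerm_natCast hq hq1 hy) ?_
  refine (summable_triTerm_natCast hq hq1 (div_ne_zero hq hy)).congr fun n => ?_
  rw [triTerm, triTerm, tri_neg, zpow_add₀ hq, zpow_neg, div_zpow, div_eq_mul_inv, mul_assoc]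

/-- Central Gaussian binomial coefficients `[2N, N + n]`, indexed by integers. -/
noncomputable def centralGaussBinom (q : ℂ) (N : ℕ) (n : ℤ) : ℂ :=
  if 0 ≤ n + N then gaussBinom q (2 * N) (n + N).toNat else 0

theorem centralGaussBinom_eq_zero (q : ℂ) {N : ℕ} {n : ℤ} (h : ¬(-N ≤ n ∧ n ≤ N)) :
    centralGaussBinom q N n = 0 := by
  rw [centralGaussBinom]
  split_ifs with h0
  · exact gaussBinom_eq_zero q (by omega)
  · rfl

theorem centralGaussBinom_eq_div {q : ℂ} (hq1 : ‖q‖ < 1) {N : ℕ} {n : ℤ} (h : -N ≤ n ∧ n ≤ N) :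
    centralGaussBinom q N n =
      qFac q (2 * N) / (qFac q (N + n).toNat * qFac q (N - n).toNat) := by
  have h1 := gaussBinom_mul_qFac q (n + N).toNat (N - n).toNat
  rw [show (n + N).toNat + (N - n).toNat = 2 * N by omega] at h1
  rw [eq_div_iff (mul_ne_zero (qFac_ne_zero hq1 _) (qFac_ne_zero hq1 _)), centralGaussBinom,
    if_pos (by omega), add_comm (N : ℤ) n, h1]

theorem prod_eq_tsum_triTerm {q x : ℂ} (hq : q ≠ 0) (hx : x ≠ 0) (N : ℕ) :
    ∏ k ∈ Finset.range N, ((1 - q ^ k * x) * (1 - q ^ (k + 1) / x)) =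
      ∑' n : ℤ, triTerm q (-x) n * centralGaussBinom q N n := by
  rw [finite_triple_product hq hx]
  symm
  have hinj : Function.Injective fun j : ℕ => (j : ℤ) - N := fun i j h => by
    simpa using h
  refine HasSum.tsum_eq ((hinj.hasSum_iff ?_).1 ?_)
  · intro n hn
    rw [centralGaussBinom, if_neg, mul_zero]
    exact fun h0 => hn ⟨(n + N).toNat, by simp; omega⟩
  · have hterm : ∀ j : ℕ, ((fun n : ℤ => triTerm q (-x) n * centralGaussBinom q N n) ∘
        fun j : ℕ => (j : ℤ) - N) j = (-1) ^ ((j : ℤ) - N) * q ^ tri ((j : ℤ) - N) *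
          x ^ ((j : ℤ) - N) * gaussBinom q (2 * N) j := by
      intro j
      rw [Function.comp_apply, centralGaussBinom, if_pos (by omega), triTerm, neg_eq_neg_one_mul x,
        mul_zpow]
      simp only [sub_add_cancel, Int.toNat_natCast]
      ring
    rw [← Finset.sum_congr rfl fun j _ => hterm j]
    refine hasSum_sum_of_ne_finset_zero fun j hj => ?_
    rw [hterm, gaussBinom_eq_zero q (by simpa using hj), mul_zero]

theorem exists_ellTheta_eq_tsum {q : ℂ} (hq : q ≠ 0) (hq1 : ‖q‖ < 1) :
    ∃ C : ℂ, ∀ x, x ≠ 0 → ellTheta x q = C * ∑' n : ℤ, triTerm q (-x) n := by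
  obtain ⟨c, hc, hlim⟩ := exists_tendsto_qFac hq1
  refine ⟨c / (c * c), fun x hx => tendsto_nhds_unique (tendsto_prod_ellTheta hq1 x) ?_⟩
  simp_rw [prod_eq_tsum_triTerm hq hx]
  rw [← tsum_mul_left]
  obtain ⟨A, hA⟩ := isBounded_iff_forall_norm_le.1 (Metric.isBounded_range_of_tendsto _ hlim)
  obtain ⟨B, hB⟩ := isBounded_iff_forall_norm_le.1
    (Metric.isBounded_range_of_tendsto _ (hlim.inv₀ hc))
  have hA' : ∀ m, ‖qFac q m‖ ≤ A := fun m => hA _ ⟨m, rfl⟩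
  have hB' : ∀ m, ‖(qFac q m)⁻¹‖ ≤ B := fun m => hB _ ⟨m, rfl⟩
  have hA0 : 0 ≤ A := (norm_nonneg _).trans (hA' 0)
  have hB0 : 0 ≤ B := (norm_nonneg _).trans (hB' 0)
  refine tendsto_tsum_of_dominated_convergence
    (bound := fun n => ‖triTerm q (-x) n‖ * (A * (B * B)))
    ((summable_triTerm hq hq1 (neg_ne_zero.2 hx)).norm.mul_right _) (fun n => ?_)
    (Eventually.of_forall fun N n => ?_)
  · rw [mul_comm]
    refine Tendsto.const_mul _ ?_
    have h1 : Tendsto (fun N : ℕ => 2 * N) atTop atTop :=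
      tendsto_id.const_mul_atTop' two_pos
    have h2 : Tendsto (fun N : ℕ => ((N : ℤ) + n).toNat) atTop atTop :=
      tendsto_atTop_mono (fun N => by omega) (tendsto_sub_atTop_nat n.natAbs)
    have h3 : Tendsto (fun N : ℕ => ((N : ℤ) - n).toNat) atTop atTop :=
      tendsto_atTop_mono (fun N => by omega) (tendsto_sub_atTop_nat n.natAbs)
    refine ((hlim.comp h1).div ((hlim.comp h2).mul (hlim.comp h3)) (mul_ne_zero hc hc)).congr' ?_
    filter_upwards [eventually_ge_atTop n.natAbs] with N hN
    exact (centralGaussBinom_eq_div hq1 (by omega)).symm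
  · rw [norm_mul]
    refine mul_le_mul_of_nonneg_left ?_ (norm_nonneg _)
    by_cases h : -N ≤ n ∧ n ≤ N
    · rw [centralGaussBinom_eq_div hq1 h, div_eq_mul_inv, mul_inv, norm_mul, norm_mul]
      gcongr
      exacts [hA' _, hB' _, hB' _]
    · rw [centralGaussBinom_eq_zero q h, norm_zero]
      positivity

/-- The even part `∑ q ^ (k ^ 2) a ^ (2 k)` of the theta series. -/
noncomputable def evenTheta (q a : ℂ) : ℂ := ∑' k : ℤ, q ^ (k * k) * a ^ (2 * k)

/-- The odd part `∑ q ^ (k ^ 2 + k) a ^ (2 k + 1)` of the theta series. -/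
noncomputable def oddTheta (q a : ℂ) : ℂ := ∑' k : ℤ, q ^ (k * k + k) * a ^ (2 * k + 1)

theorem summable_triTerm_sq {q y : ℂ} (hq : q ≠ 0) (hq1 : ‖q‖ < 1) (hy : y ≠ 0) :
    Summable (triTerm (q ^ 2) y) :=
  summable_triTerm (pow_ne_zero 2 hq)
    (by rw [norm_pow]; exact pow_lt_one₀ (norm_nonneg q) hq1 two_ne_zero) hy

theorem triTerm_sq (q y : ℂ) (k : ℤ) : triTerm (q ^ 2) y k = q ^ (k * (k - 1)) * y ^ k := by
  rw [triTerm, ← zpow_natCast, ← zpow_mul, ← two_mul_tri, Nat.cast_ofNat]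

theorem hasSum_evenTheta {q a : ℂ} (hq : q ≠ 0) (hq1 : ‖q‖ < 1) (ha : a ≠ 0) :
    HasSum (fun k : ℤ => q ^ (k * k) * a ^ (2 * k)) (evenTheta q a) := by
  refine Summable.hasSum (Summable.congr
    (summable_triTerm_sq hq hq1 (mul_ne_zero hq (pow_ne_zero 2 ha))) fun k => ?_)
  rw [triTerm_sq, mul_zpow, ← mul_assoc, ← zpow_add₀ hq, zpow_mul a, ← zpow_natCast a 2,
    Nat.cast_ofNat]
  congr 2
  ring

theorem hasSum_oddTheta {q a : ℂ} (hq : q ≠ 0) (hq1 : ‖q‖ < 1) (ha : a ≠ 0) :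
    HasSum (fun k : ℤ => q ^ (k * k + k) * a ^ (2 * k + 1)) (oddTheta q a) := by
  refine Summable.hasSum (Summable.congr ((summable_triTerm_sq hq hq1
    (mul_ne_zero (pow_ne_zero 2 hq) (pow_ne_zero 2 ha))).mul_right a) fun k => ?_)
  rw [triTerm_sq, mul_zpow, ← mul_assoc, ← zpow_natCast q 2, ← zpow_mul q, ← zpow_add₀ hq,
    zpow_add₀ ha, zpow_mul a, ← zpow_natCast a 2, zpow_one, Nat.cast_ofNat, mul_assoc]
  congr 2
  ring

theorem hasSum_mul_prod {f g : ℤ → ℂ} {s t : ℂ} (hf : HasSum f s) (hg : HasSum g t) :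
    HasSum (fun p : ℤ × ℤ => f p.1 * g p.2) (s * t) :=
  hf.mul hg (summable_mul_of_summable_norm hf.summable.norm hg.summable.norm)

/-- A double series over `ℤ × ℤ` splits according to the parity of the sum of the indices. -/
theorem hasSum_of_hasSum_parity {f : ℤ × ℤ → ℂ} {a b : ℂ}
    (ha : HasSum (fun p : ℤ × ℤ => f (p.1 + p.2 + 1, p.1 - p.2 + 1)) a)
    (hb : HasSum (fun p : ℤ × ℤ => f (p.1 + p.2 + 1, p.1 - p.2)) b) : HasSum f (a + b) := by
  let φ : ℤ × ℤ → ℤ × ℤ := fun p => (p.1 + p.2 + 1, p.1 - p.2 + 1)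
  let ψ : ℤ × ℤ → ℤ × ℤ := fun p => (p.1 + p.2 + 1, p.1 - p.2)
  have hφ : Function.Injective φ := by
    rintro ⟨k, l⟩ ⟨k', l'⟩ h
    simp only [φ, Prod.mk.injEq] at h ⊢
    omega
  have hψ : Function.Injective ψ := by
    rintro ⟨k, l⟩ ⟨k', l'⟩ h
    simp only [ψ, Prod.mk.injEq] at h ⊢
    omega
  have hcompl : IsCompl (Set.range φ) (Set.range ψ) := by
    rw [isCompl_iff, Set.disjoint_left, codisjoint_iff_le_sup]
    constructor
    · rintro _ ⟨⟨k, l⟩, rfl⟩ ⟨⟨k', l'⟩, h⟩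
      simp only [φ, ψ, Prod.mk.injEq] at h
      omega
    · rintro ⟨m, n⟩ -
      rcases Int.even_or_odd' (m + n) with ⟨s, hs | hs⟩
      · exact Or.inl ⟨(s - 1, m - s), by simp only [φ, Prod.mk.injEq]; omega⟩
      · exact Or.inr ⟨(s, m - s - 1), by simp only [ψ, Prod.mk.injEq]; omega⟩
  exact HasSum.add_isCompl hcompl (hφ.hasSum_range_iff.2 ha) (hψ.hasSum_range_iff.2 hb)

theorem tsum_triTerm_mul_tsum_triTerm {q a z : ℂ} (hq : q ≠ 0) (hq1 : ‖q‖ < 1)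
    (ha : a ≠ 0) (hz : z ≠ 0) :
    a⁻¹ * ((∑' n, triTerm q (-(a * z)) n) * ∑' n, triTerm q (-(a / z)) n) =
      oddTheta q a * evenTheta q z - evenTheta q a * oddTheta q z := by
  have hs1 := summable_triTerm hq hq1 (neg_ne_zero.2 (mul_ne_zero ha hz))
  have hs2 := summable_triTerm hq hq1 (neg_ne_zero.2 (div_ne_zero ha hz))
  have hL := (hasSum_mul_prod hs1.hasSum hs2.hasSum).mul_left a⁻¹
  have hoe := hasSum_mul_prod (hasSum_oddTheta hq hq1 ha) (hasSum_evenTheta hq hq1 hz)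
  have heo := (hasSum_mul_prod (hasSum_evenTheta hq hq1 ha) (hasSum_oddTheta hq hq1 hz)).neg
  have hterm : ∀ m n : ℤ, a⁻¹ * (triTerm q (-(a * z)) m * triTerm q (-(a / z)) n) =
      (-1) ^ (m + n) * q ^ (tri m + tri n) * a ^ (m + n - 1) * z ^ (m - n) := by
    intro m n
    rw [triTerm, triTerm, neg_eq_neg_one_mul (a * z), neg_eq_neg_one_mul (a / z), mul_zpow,
      mul_zpow, mul_zpow, div_zpow, zpow_add₀ (by norm_num), zpow_add₀ hq, zpow_sub₀ ha,
      zpow_add₀ ha, zpow_sub₀ hz, zpow_one]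
    ring
  simp only [hterm] at hL
  rw [sub_eq_add_neg]
  refine hL.unique (hasSum_of_hasSum_parity ?_ ?_)
  · convert hoe using 1
    funext ⟨k, l⟩
    have e : tri (k + l + 1) + tri (k - l + 1) = (k * k + k) + l * l := by
      have h1 := two_mul_tri (k + l + 1)
      have h2 := two_mul_tri (k - l + 1)
      linarith
    simp only [e]
    rw [show k + l + 1 + (k - l + 1) = 2 * (k + 1) by ring,
      show 2 * (k + 1) - 1 = 2 * k + 1 by ring,
      show k + l + 1 - (k - l + 1) = 2 * l by ring, zpow_add₀ hq (k * k + k),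
      (even_two_mul (k + 1)).neg_one_zpow]
    ring
  · refine Eq.mpr (congrArg (fun F => HasSum F _) (funext ?_)) heo
    rintro ⟨k, l⟩
    have e : tri (k + l + 1) + tri (k - l) = k * k + (l * l + l) := by
      have h1 := two_mul_tri (k + l + 1)
      have h2 := two_mul_tri (k - l)
      linarith
    simp only [e]
    rw [show k + l + 1 + (k - l) = 2 * k + 1 by ring,
      show 2 * k + 1 - 1 = 2 * k by ring,
      show k + l + 1 - (k - l) = 2 * l + 1 by ring, zpow_add₀ hq (k * k),
      (odd_two_mul_add_one k).neg_one_zpow]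
    ring

theorem exists_inv_mul_ellTheta_mul_ellTheta_eq {q : ℂ} (hq : q ≠ 0) (hq1 : ‖q‖ < 1) :
    ∃ u v : ℂ → ℂ, ∀ a z, a ≠ 0 → z ≠ 0 →
      a⁻¹ * (ellTheta (a * z) q * ellTheta (a / z) q) = u a * v z - v a * u z := by
  obtain ⟨C, hC⟩ := exists_ellTheta_eq_tsum hq hq1
  refine ⟨fun a => C * oddTheta q a, fun a => C * evenTheta q a, fun a z ha hz => ?_⟩
  rw [hC _ (mul_ne_zero ha hz), hC _ (div_ne_zero ha hz)]
  linear_combination C * C * tsum_triTerm_mul_tsum_triTerm hq hq1 ha hz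

theorem prod_ite_lt_neg_one (n : ℕ) :
    ∏ i : Fin n, ∏ j : Fin n, (if i < j then (-1 : ℂ) else 1) = (-1) ^ (n * (n - 1) / 2) := by
  induction n with
  | zero => simp
  | succ n ih =>
    simp only [Fin.prod_univ_succ (n := n), Fin.succ_lt_succ_iff, Fin.succ_pos,
      Fin.not_lt_zero, if_true, if_false, one_mul,
      Finset.prod_const, Finset.card_univ, Fintype.card_fin]
    rw [ih, ← Nat.choose_two_right, ← Nat.choose_two_right, Nat.choose_succ_succ' n 1,
      Nat.choose_one_right, pow_add]

/-- The Cauchy-type theta determinant identity (a special case of Warnaar's determinant). -/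
theorem warnaar_determinant (n : ℕ) (hn : 1 ≤ n) (q : ℂ)
    (hq0 : 0 < ‖q‖) (hq1 : ‖q‖ < 1)
    (a z : Fin n → ℂ)
    (ha0 : ∀ i, a i ≠ 0) (hz0 : ∀ i, z i ≠ 0)
    (haz : ∀ i j, ellTheta (a i * z j) q ≠ 0 ∧ ellTheta (a i / z j) q ≠ 0) :
    Matrix.det (Matrix.of fun i j : Fin n =>
        a i / (ellTheta (a i * z j) q * ellTheta (a i / z j) q)) =
      (-1 : ℂ) ^ (n * (n - 1) / 2) *
        ((∏ i, ∏ j, if i < j then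
            (a i)⁻¹ * (ellTheta (a i * a j) q * ellTheta (a i / a j) q) *
              ((z i)⁻¹ * (ellTheta (z i * z j) q * ellTheta (z i / z j) q))
          else 1) /
          ∏ i, ∏ j, (a i)⁻¹ * (ellTheta (a i * z j) q * ellTheta (a i / z j) q)) := by
  have hq : q ≠ 0 := norm_pos_iff.1 hq0
  obtain ⟨u, v, huv⟩ := exists_inv_mul_ellTheta_mul_ellTheta_eq hq hq1
  have hne : ∀ i j, u (a i) * v (z j) - v (a i) * u (z j) ≠ 0 := fun i j => by
    rw [← huv _ _ (ha0 i) (hz0 j)]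
    exact mul_ne_zero (inv_ne_zero (ha0 i)) (mul_ne_zero (haz i j).1 (haz i j).2)
  have hdet := det_inv_cross u v (fun x y => u x * v y - v x * u y) (fun _ _ => rfl) n a z hne
  have hentry : ∀ i j, a i / (ellTheta (a i * z j) q * ellTheta (a i / z j) q) =
      (u (a i) * v (z j) - v (a i) * u (z j))⁻¹ := fun i j => by
    rw [← huv _ _ (ha0 i) (hz0 j), mul_inv, inv_inv, div_eq_mul_inv]
  simp only [hentry, hdet, huv _ _ (ha0 _) (hz0 _), huv _ _ (ha0 _) (ha0 _),
    huv _ _ (hz0 _) (hz0 _)]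
  rw [← prod_ite_lt_neg_one, ← mul_div_assoc]
  congr 1
  simp only [← Finset.prod_mul_distrib]
  refine Finset.prod_congr rfl fun i _ => Finset.prod_congr rfl fun j _ => ?_
  split_ifs
  · ring
  · simp
end
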